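/- Let L₀ = a₀X + b₀Y + c₀Z + d₀W and L₁ = a₁X + b₁Y + c₁Z + d₁W be two linearly independent linear forms in four variables over k, let ℓ ⊂ P³(k) be the line they define, and set u = (a₀x + b₀y + c₀ + d₀x²)/(a₁x + b₁y + c₁ + d₁x²) ∈ F (the denominator is nonzero since 1, x, y, x² are linearly independent over k). Then F is a Galois extension of the subfield k⟮u⟯ generated by k and u if and only if one of the following holds: (I) b₀ = b₁ = 0 and there exists (a, c, d) ≠ (0,0,0) in k³ with a² = cd, a₀a + c₀c + d₀d = 0 and a₁a + c₁c + d₁d = 0 (ℓ passes through (0:1:0:0) and meets the conic Y = X² − ZW = 0); (II) b₀ = b₁ = 0, no such triple (a,c,d) exists, and the k-span of L₀ and L₁ admits a basis consisting of forms all of whose coefficients e satisfy e^q = e (ℓ is an F_q-line through (0:1:0:0) missing the conic); (III) Y lies in the k-span of L₀ and L₁ and that span admits a basis of forms with all coefficients fixed by the q-power map (ℓ is an F_q-line in the plane Y = 0); (IV) there exists α ∈ k with α^(q²) = α and α^q ≠ α such that the k-span of L₀ and L₁ equals the k-span of Y and −2αX + α²Z + W (ℓ is the tangent line of the conic at an F_{q²}-point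 not defined over F_q). -/

import Mathlib

open IntermediateField Polynomial

structure ExponentData (p n q m : ℕ) : Prop where
  q_eq : q = p ^ n
  two_mul : 2 * m = q + 1
  three_le : 3 ≤ m

structure IsGenPair (k : Type*) {F : Type*} [Field k] [Field F] [Algebra k F] (q m : ℕ)
    (x y : F) : Prop where
  transcendental : Transcendental k x
  pow_eq : y ^ m = x ^ q - x
  adjoin_eq : adjoin k {x, y} = ⊤

section
variable {k : Type*} [Field k] {p n q m : ℕ}

theorem ExponentData.one_lt (hE : ExponentData p n q m) : 1 < q := by
  have := hE.two_mul; have := hE.three_le; omega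

theorem irreducible_curve (hE : ExponentData p n q m) :
    Irreducible ((X : (RatFunc k)[X]) ^ m - C (RatFunc.X ^ q - RatFunc.X)) := by
  have h3 := hE.three_le
  have h1 := hE.one_lt
  have hm0 : m ≠ 0 := by omega
  have hmon : ((X : k[X][X]) ^ m - C (X ^ q - X)).Monic := monic_X_pow_sub_C _ hm0
  have key : Irreducible ((X : k[X][X]) ^ m - C (X ^ q - X)) := by
    have hP : (Ideal.span {(X : k[X])}).IsPrime :=
      (Ideal.span_singleton_prime X_ne_zero).2 prime_X
    apply irreducible_of_eisenstein_criterion hP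
    · rw [hmon.leadingCoeff]
      exact fun h => hP.ne_top ((Ideal.eq_top_iff_one _).2 h)
    · intro i hi
      rw [degree_X_pow_sub_C (by omega)] at hi
      have hi : i < m := by exact_mod_cast hi
      rw [coeff_sub, coeff_X_pow, if_neg hi.ne, coeff_C, zero_sub, neg_mem_iff]
      split_ifs
      · rw [Ideal.mem_span_singleton]
        exact dvd_sub (dvd_pow_self _ (by omega)) dvd_rfl
      · simp
    · rw [degree_X_pow_sub_C (by omega)]
      exact_mod_cast (by omega : 0 < m)
    · rw [coeff_sub, coeff_X_pow, if_neg hm0.symm, coeff_C_zero, zero_sub, neg_mem_iff,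
        Ideal.span_singleton_pow, Ideal.mem_span_singleton, X_pow_dvd_iff]
      intro h
      have := h 1 (by omega)
      rw [coeff_sub, coeff_X_pow, if_neg (by omega), coeff_X_one] at this
      simp at this
    · exact hmon.isPrimitive
  have := (hmon.irreducible_iff_irreducible_map_fraction_map (K := RatFunc k)).1 key
  simpa using this

variable {F L : Type*} [Field F] [Algebra k F] [Field L] [Algebra k L]

/-- The embedding of the abstract function field given by a point. -/
theorem exists_hom_of_point {x y : F} (hx : Transcendental k x)
    (hxy : y ^ m = x ^ q - x) :
    ∃ φ : AdjoinRoot ((X : (RatFunc k)[X]) ^ m - C (RatFunc.X ^ q - RatFunc.X)) →+* F,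
      (∀ f : k[X], φ (AdjoinRoot.of _ (algebraMap k[X] _ f)) = aeval x f) ∧
        φ (AdjoinRoot.root _) = y := by
  have hinj : Function.Injective (aeval x : k[X] →ₐ[k] F) :=
    transcendental_iff_injective.1 hx
  have hle : nonZeroDivisors k[X] ≤ (nonZeroDivisors F).comap (aeval x : k[X] →ₐ[k] F) :=
    nonZeroDivisors_le_comap_nonZeroDivisors_of_injective _ hinj
  let ι : RatFunc k →+* F := RatFunc.liftRingHom (aeval x : k[X] →ₐ[k] F).toRingHom hle
  have hι : ∀ f : k[X], ι (algebraMap k[X] _ f) = aeval x f := fun f =>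
    RatFunc.liftRingHom_algebraMap _ _ _
  refine ⟨AdjoinRoot.lift ι y ?_, fun f => ?_, AdjoinRoot.lift_root _⟩
  · have := hι (X ^ q - X)
    simp only [map_sub, map_pow, RatFunc.algebraMap_X, aeval_X] at this
    rw [eval₂_sub, eval₂_X_pow, eval₂_C, hxy, map_sub, map_pow, this, sub_self]
  · rw [AdjoinRoot.lift_of, hι]

theorem IsGenPair.exists_algHom (hE : ExponentData p n q m) {x y : F} (h : IsGenPair k q m x y)
    {x' y' : L} (hx' : Transcendental k x') (hxy' : y' ^ m = x' ^ q - x') :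
    ∃ φ : F →ₐ[k] L, φ x = x' ∧ φ y = y' := by
  have : Fact (Irreducible ((X : (RatFunc k)[X]) ^ m - C (RatFunc.X ^ q - RatFunc.X))) :=
    ⟨irreducible_curve hE⟩
  obtain ⟨φ, hφ, hφy⟩ := exists_hom_of_point h.transcendental h.pow_eq
  obtain ⟨ψ, hψ, hψy⟩ := exists_hom_of_point hx' hxy'
  have hsurj : Function.Surjective φ := by
    have : (adjoin k {x, y} : IntermediateField k F) ≤
        { φ.fieldRange with
          algebraMap_mem' := fun c => ⟨_, (hφ (C c)).trans (aeval_C x c)⟩ } := by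
      rw [adjoin_le_iff]
      rintro z (rfl | rfl)
      · exact ⟨_, (hφ X).trans (aeval_X _)⟩
      · exact ⟨_, hφy⟩
    rw [h.adjoin_eq] at this
    exact fun z => this (mem_top : z ∈ (⊤ : IntermediateField k F))
  let e := RingEquiv.ofBijective φ ⟨φ.injective, hsurj⟩
  have he : ∀ a, e.symm (φ a) = a := fun a => e.symm_apply_apply a
  refine ⟨{ ψ.comp e.symm.toRingHom with commutes' := fun c => ?_ }, ?_, ?_⟩
  · have h1 := hφ (C c)
    have h2 := hψ (C c)
    rw [aeval_C] at h1 h2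
    change ψ (e.symm (algebraMap k F c)) = _
    rw [← h1, he, h2]
  · have h1 := hφ X
    have h2 := hψ X
    rw [aeval_X] at h1 h2
    change ψ (e.symm x) = _
    rw [← h1, he, h2]
  · change ψ (e.symm y) = _
    rw [← hφy, he, hψy]

/-- Automorphism from pair to pair. -/
theorem IsGenPair.exists_algEquiv (hE : ExponentData p n q m) {x y x' y' : F}
    (h : IsGenPair k q m x y) (h' : IsGenPair k q m x' y') :
    ∃ φ : F ≃ₐ[k] F, φ x = x' ∧ φ y = y' := by
  obtain ⟨φ, h1, h2⟩ := h.exists_algHom hE h'.transcendental h'.pow_eq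
  refine ⟨AlgEquiv.ofBijective φ ⟨φ.injective, ?_⟩, h1, h2⟩
  have : adjoin k {x', y'} ≤ φ.fieldRange := by
    rw [adjoin_le_iff]
    rintro z (rfl | rfl)
    exacts [⟨x, h1⟩, ⟨y, h2⟩]
  rw [h'.adjoin_eq] at this
  exact fun z => this (mem_top : z ∈ (⊤ : IntermediateField k F))

theorem IsGenPair.map (σ : F ≃ₐ[k] F) {x y : F} (h : IsGenPair k q m x y) :
    IsGenPair k q m (σ x) (σ y) := by
  refine ⟨?_, ?_, ?_⟩
  · intro ha
    exact h.transcendental ((isAlgebraic_algHom_iff σ.toAlgHom σ.injective).1 ha)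
  · rw [← map_pow, h.pow_eq, map_sub, map_pow]
  · have := congrArg (IntermediateField.map σ.toAlgHom) h.adjoin_eq
    rw [adjoin_map] at this
    simp only [Set.image_insert_eq, Set.image_singleton] at this
    refine (this : adjoin k {σ x, σ y} = _).trans ?_
    exact top_unique fun z _ => ⟨σ.symm z, trivial, σ.apply_symm_apply z⟩

end

section
variable {p n q m : ℕ}

theorem ExponentData.n_ne_zero (hE : ExponentData p n q m) : n ≠ 0 := by
  rintro rfl
  have := hE.one_lt
  have := hE.q_eq
  simp at this
  omega

theorem ExponentData.cast_q (hE : ExponentData p n q m) (R : Type*) [CommRing R] [CharP R p] :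
    (q : R) = 0 := by
  rw [hE.q_eq, Nat.cast_pow, CharP.cast_eq_zero, zero_pow hE.n_ne_zero]

theorem ExponentData.two_mul_cast (hE : ExponentData p n q m) (R : Type*) [CommRing R]
    [CharP R p] : (2 : R) * m = 1 := by
  have := congrArg (Nat.cast : ℕ → R) hE.two_mul
  push_cast at this
  rw [this, hE.cast_q R, zero_add]

theorem ExponentData.cast_m_ne_zero (hE : ExponentData p n q m) (R : Type*) [CommRing R]
    [Nontrivial R] [CharP R p] : (m : R) ≠ 0 := fun h => by
  have := hE.two_mul_cast R
  simp [h] at this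

theorem ExponentData.two_ne_zero (hE : ExponentData p n q m) (R : Type*) [CommRing R]
    [Nontrivial R] [CharP R p] : (2 : R) ≠ 0 := fun h => by
  have := hE.two_mul_cast R
  simp [h] at this

theorem ExponentData.add_pow [Fact p.Prime] (hE : ExponentData p n q m) {R : Type*} [CommRing R]
    [CharP R p] (a b : R) : (a + b) ^ q = a ^ q + b ^ q := by
  rw [hE.q_eq, add_pow_char_pow]

theorem ExponentData.sub_pow [Fact p.Prime] (hE : ExponentData p n q m) {R : Type*} [CommRing R]
    [CharP R p] (a b : R) : (a - b) ^ q = a ^ q - b ^ q := by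
  rw [hE.q_eq, sub_pow_char_pow]

theorem ExponentData.neg_pow [Fact p.Prime] (hE : ExponentData p n q m) {R : Type*} [CommRing R]
    [CharP R p] (a : R) : (-a) ^ q = -a ^ q := by
  have := hE.sub_pow 0 a
  rwa [zero_pow (by have := hE.one_lt; omega), zero_sub, zero_sub] at this

variable {k F : Type*} [Field k] [Field F] [Algebra k F]

theorem IsGenPair.of_mem_adjoin {x y x' y' : F} (h : IsGenPair k q m x y) (hm : m ≠ 0)
    (hpow : y' ^ m = x' ^ q - x') (hx : x ∈ adjoin k {x', y'}) (hy : y ∈ adjoin k {x', y'}) :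
    IsGenPair k q m x' y' := by
  refine ⟨fun ha => h.transcendental ?_, hpow, ?_⟩
  · have hx' : IsIntegral k x' := ha.isIntegral
    have hy' : IsIntegral k y' := by
      refine IsIntegral.of_pow (Nat.pos_of_ne_zero hm) ?_
      rw [hpow]
      exact (hx'.pow q).sub hx'
    have : Algebra.IsAlgebraic k (adjoin k {x', y'}) := by
      apply isAlgebraic_adjoin
      rintro z (rfl | rfl) <;> assumption
    exact isAlgebraic_iff.1 (Algebra.IsAlgebraic.isAlgebraic (R := k) (⟨x, hx⟩ : adjoin k {x', y'}))
  · rw [← top_le_iff, ← h.adjoin_eq, adjoin_le_iff]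
    rintro z (rfl | rfl) <;> assumption

theorem IsGenPair.rotate {x y : F} (h : IsGenPair k q m x y) (hm : m ≠ 0) {ζ : k}
    (hζ : ζ ^ m = 1) : IsGenPair k q m x (algebraMap k F ζ * y) := by
  have hz : ζ ≠ 0 := by rintro rfl; simp [hm] at hζ
  have hx : x ∈ adjoin k {x, algebraMap k F ζ * y} := subset_adjoin _ _ (by simp)
  have hy : algebraMap k F ζ * y ∈ adjoin k {x, algebraMap k F ζ * y} :=
    subset_adjoin _ _ (by simp)
  refine h.of_mem_adjoin hm ?_ hx ?_
  · rw [mul_pow, ← map_pow, hζ, map_one, one_mul, h.pow_eq]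
  · have := mul_mem (IntermediateField.algebraMap_mem (adjoin k {x, algebraMap k F ζ * y}) ζ⁻¹) hy
    rwa [← mul_assoc, ← map_mul, inv_mul_cancel₀ hz, map_one, one_mul] at this

theorem IsGenPair.exists_rotation (hE : ExponentData p n q m) {x y : F}
    (h : IsGenPair k q m x y) {ζ : k} (hζ : ζ ^ m = 1) :
    ∃ ρ : F ≃ₐ[k] F, ρ x = x ∧ ρ y = algebraMap k F ζ * y :=
  h.exists_algEquiv hE (h.rotate (by have := hE.three_le; omega) hζ)

theorem AlgEquiv.apply_eq_of_mem_adjoin {x : F} (ρ : F ≃ₐ[k] F) (hρ : ρ x = x) {c : F}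
    (hc : c ∈ k⟮x⟯) : ρ c = c := by
  obtain ⟨r, s, rfl⟩ := (mem_adjoin_simple_iff k c).1 hc
  have (P : k[X]) : ρ (aeval x P) = aeval x P := by
    have := (aeval_algHom_apply ρ x P).symm
    rwa [hρ] at this
  rw [map_div₀, this, this]

theorem aeval_mem_adjoin_simple (x : F) (P : k[X]) : aeval x P ∈ k⟮x⟯ := by
  have := (aeval (AdjoinSimple.gen k x) P).2
  rwa [← IntermediateField.coe_val, ← aeval_algHom_apply, IntermediateField.coe_val,
    AdjoinSimple.coe_gen] at this

theorem exists_isPrimitiveRoot [IsAlgClosed k] [CharP k p] (hE : ExponentData p n q m) :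
    ∃ ζ : k, IsPrimitiveRoot ζ m := by
  have : NeZero (m : k) := ⟨hE.cast_m_ne_zero k⟩
  exact HasEnoughRootsOfUnity.exists_primitiveRoot k m

theorem IsGenPair.ne_zero {x y : F} (h : IsGenPair k q m x y) (hE : ExponentData p n q m) :
    y ≠ 0 := by
  rintro rfl
  have h1 := hE.one_lt
  have := h.pow_eq
  rw [zero_pow (by have := hE.three_le; omega)] at this
  refine h.transcendental ⟨X ^ q - X, fun h0 => ?_, by simp [← this]⟩
  have := congrArg (fun P => coeff P 1) h0
  simp [coeff_X_pow, h1.ne] at this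

/-- Decomposition into eigencomponents of the rotations. -/
theorem IsGenPair.term_mem_of_sum_mem [IsAlgClosed k] [CharP k p] (hE : ExponentData p n q m)
    {x y : F} (h : IsGenPair k q m x y) (M : Submodule k F)
    (hM : ∀ (ρ : F ≃ₐ[k] F) (ζ : k), ρ x = x → ζ ^ m = 1 → ρ y = algebraMap k F ζ * y →
      ∀ f ∈ M, ρ f ∈ M)
    (c : ℕ → F) (hc : ∀ j, c j ∈ k⟮x⟯)
    (hsum : ∑ j ∈ Finset.range m, c j * y ^ j ∈ M) {j : ℕ} (hj : j < m) : c j * y ^ j ∈ M := by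
  obtain ⟨ζ, hζ⟩ := exists_isPrimitiveRoot (k := k) hE
  have hz : ζ ≠ 0 := hζ.ne_zero (by omega)
  have hpow (i : ℕ) : (ζ ^ i) ^ m = 1 := by rw [← pow_mul, mul_comm, pow_mul, hζ.pow_eq_one, one_pow]
  choose ρ hρx hρy using fun i : ℕ => h.exists_rotation hE (hpow i)
  have key : ∑ i ∈ Finset.range m, (ζ ^ (i * j))⁻¹ • ρ i (∑ l ∈ Finset.range m, c l * y ^ l)
      = (m : k) • (c j * y ^ j) := by
    have h1 (i : ℕ) : (ζ ^ (i * j))⁻¹ • ρ i (∑ l ∈ Finset.range m, c l * y ^ l) =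
        ∑ l ∈ Finset.range m, ((ζ ^ l * (ζ ^ j)⁻¹) ^ i) • (c l * y ^ l) := by
      rw [map_sum, Finset.smul_sum]
      refine Finset.sum_congr rfl fun l _ => ?_
      rw [map_mul, map_pow, hρy, (ρ i).apply_eq_of_mem_adjoin (hρx i) (hc l), Algebra.smul_def,
        Algebra.smul_def, mul_pow, ← map_pow]
      have : algebraMap k F ((ζ ^ l * (ζ ^ j)⁻¹) ^ i) =
          algebraMap k F (ζ ^ (i * j))⁻¹ * algebraMap k F ((ζ ^ i) ^ l) := by
        rw [← map_mul]
        congr 1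
        rw [mul_pow, inv_pow, ← pow_mul, ← pow_mul, ← pow_mul, mul_comm l i, mul_comm j i, mul_comm]
      rw [this]
      ring
    simp only [h1]
    rw [Finset.sum_comm, Finset.sum_eq_single_of_mem j (Finset.mem_range.2 hj)]
    · simp [mul_inv_cancel₀ (pow_ne_zero j hz), ← Nat.cast_smul_eq_nsmul k]
    · intro l hl hlj
      rw [← Finset.sum_smul]
      have hne : ζ ^ l * (ζ ^ j)⁻¹ ≠ 1 := by
        rw [Ne, mul_inv_eq_one₀ (pow_ne_zero j hz)]
        exact fun he => hlj (hζ.pow_inj (Finset.mem_range.1 hl) hj he)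
      have h0 : (ζ ^ l * (ζ ^ j)⁻¹) ^ m = 1 := by rw [mul_pow, inv_pow, hpow, hpow]; simp
      have := mul_geom_sum (ζ ^ l * (ζ ^ j)⁻¹) m
      rw [h0, sub_self] at this
      rw [(mul_eq_zero.1 this).resolve_left (sub_ne_zero.2 hne), zero_smul]
  have hmem : (m : k) • (c j * y ^ j) ∈ M := by
    rw [← key]
    exact M.sum_mem fun i _ => M.smul_mem _ (hM _ _ (hρx i) (hpow i) (hρy i) _ hsum)
  exact (M.smul_mem_iff (hE.cast_m_ne_zero k)).1 hmem

theorem IsGenPair.term_eq_zero_of_sum [IsAlgClosed k] [CharP k p] (hE : ExponentData p n q m)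
    {x y : F} (h : IsGenPair k q m x y) (P : ℕ → k[X])
    (hsum : ∑ j ∈ Finset.range m, aeval x (P j) * y ^ j = 0) {j : ℕ} (hj : j < m) : P j = 0 := by
  have := h.term_mem_of_sum_mem hE ⊥ (by simp) (fun j => aeval x (P j))
    (fun j => aeval_mem_adjoin_simple x (P j)) (by simpa using hsum) hj
  rw [Submodule.mem_bot, mul_eq_zero, or_iff_left (pow_ne_zero _ (h.ne_zero hE))] at this
  exact transcendental_iff.1 h.transcendental _ this

theorem IsGenPair.adjoin_adjoin_eq {x y : F} (h : IsGenPair k q m x y) :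
    (k⟮x⟯)⟮y⟯ = ⊤ := by
  have := adjoin_adjoin_left k {x} {y}
  rw [Set.singleton_union, h.adjoin_eq] at this
  rw [← top_le_iff]
  intro z _
  have hz : z ∈ (⊤ : IntermediateField k F) := trivial
  rw [← this] at hz
  exact hz

theorem IsGenPair.exists_coeffs {x y : F} (hE : ExponentData p n q m) (h : IsGenPair k q m x y)
    (f : F) : ∃ c : ℕ → F, (∀ j, c j ∈ k⟮x⟯) ∧ f = ∑ j ∈ Finset.range m, c j * y ^ j := by
  have hm : m ≠ 0 := by have := hE.three_le; omega
  let r : k⟮x⟯ := AdjoinSimple.gen k x ^ q - AdjoinSimple.gen k x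
  have hmon : ((X : k⟮x⟯[X]) ^ m - C r).Monic := monic_X_pow_sub_C _ hm
  have hy : aeval y ((X : k⟮x⟯[X]) ^ m - C r) = 0 := by
    simp only [map_sub, map_pow, aeval_X, aeval_C, h.pow_eq, r]
    simp
  have hf : f ∈ (k⟮x⟯)⟮y⟯ := by rw [h.adjoin_adjoin_eq]; trivial
  have hint : IsIntegral k⟮x⟯ y := ⟨_, hmon, by rwa [aeval_def] at hy⟩
  rw [← IntermediateField.mem_toSubalgebra, adjoin_simple_toSubalgebra_of_isAlgebraic hint.isAlgebraic,
    Algebra.adjoin_singleton_eq_range_aeval] at hf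
  obtain ⟨P, rfl⟩ := hf
  refine ⟨fun j => ((P %ₘ (X ^ m - C r)).coeff j : k⟮x⟯), fun j => Subtype.prop _, ?_⟩
  have h1 : aeval y P = aeval y (P %ₘ (X ^ m - C r)) := by
    conv_lhs => rw [← modByMonic_add_div P (X ^ m - C r)]
    rw [map_add, map_mul, hy, zero_mul, add_zero]
  have hdeg : (P %ₘ (X ^ m - C r)).natDegree < m := by
    have := natDegree_modByMonic_lt P hmon (fun h1 => by
      have := congrArg natDegree h1
      rw [natDegree_X_pow_sub_C, natDegree_one] at this
      exact hm this)
    rwa [natDegree_X_pow_sub_C] at this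
  change aeval y P = _
  rw [h1, aeval_eq_sum_range' hdeg]
  simp [Algebra.smul_def]

theorem IsGenPair.exists_mul_eq_sum {x y : F} (hE : ExponentData p n q m)
    (h : IsGenPair k q m x y) (f : F) : ∃ (Q : k[X]) (P : ℕ → k[X]), Q ≠ 0 ∧
      aeval x Q * f = ∑ j ∈ Finset.range m, aeval x (P j) * y ^ j := by
  obtain ⟨c, hc, rfl⟩ := h.exists_coeffs hE f
  have hc' (j : ℕ) : ∃ r s : k[X], s ≠ 0 ∧ aeval x s * c j = aeval x r := by
    obtain ⟨r, s, hrs⟩ := (mem_adjoin_simple_iff k _).1 (hc j)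
    by_cases hs : s = 0
    · exact ⟨0, 1, one_ne_zero, by simp [hrs, hs]⟩
    · refine ⟨r, s, hs, ?_⟩
      rw [hrs, mul_div_cancel₀]
      exact fun h0 => hs (transcendental_iff.1 h.transcendental _ h0)
  choose r s hs hrs using hc'
  refine ⟨∏ i ∈ Finset.range m, s i, fun j => r j * ∏ i ∈ (Finset.range m).erase j, s i,
    Finset.prod_ne_zero_iff.2 fun i _ => hs i, ?_⟩
  rw [Finset.mul_sum]
  refine Finset.sum_congr rfl fun j hj => ?_
  rw [← Finset.mul_prod_erase _ _ hj, map_mul, map_mul, ← hrs]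
  ring

end

section
variable {p n q m : ℕ} {k F : Type*} [Field k] [Field F] [Algebra k F]

theorem exists_valuationSubring_notMem {t : F} (ht : ¬ IsIntegral k t) :
    ∃ O : ValuationSubring F, (∀ c : k, algebraMap k F c ∈ O) ∧ t ∉ O := by
  by_contra! hcon
  have h1 := iInf_valuationSubring_superset (K := F) (s := Set.range (algebraMap k F))
  have h2 : t ∈ ⨅ V : {V : ValuationSubring F // Set.range (algebraMap k F) ⊆ V.toSubring},
      V.1.toSubring := by
    rw [Subring.mem_iInf]
    exact fun V => hcon V.1 fun c => V.2 ⟨c, rfl⟩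
  rw [h1] at h2
  have h3 : IsIntegral (Subring.closure (Set.range (algebraMap k F))) t := h2
  have h4 : Subring.closure (Set.range (algebraMap k F)) = (algebraMap k F).range := by
    rw [← RingHom.coe_range, Subring.closure_eq]
  rw [h4] at h3
  apply ht
  obtain ⟨P, hP, hPt⟩ := h3
  let g : k →+* (algebraMap k F).range := (algebraMap k F).rangeRestrict
  have hg : Function.Surjective g := (algebraMap k F).rangeRestrict_surjective
  obtain ⟨Q, rfl, -, hQ⟩ := lifts_and_natDegree_eq_and_monic
    ((mem_lifts P).2 (map_surjective g hg P)) hP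
  refine ⟨Q, hQ, ?_⟩
  rw [eval₂_map] at hPt
  exact hPt

namespace ValuationSubring

variable {O : ValuationSubring F}

theorem valuation_algebraMap_eq_one (hk : ∀ c : k, algebraMap k F c ∈ O) {c : k} (hc : c ≠ 0) :
    O.valuation (algebraMap k F c) = 1 := by
  refine le_antisymm ((O.valuation_le_one_iff _).2 (hk c)) ?_
  have h := (O.valuation_le_one_iff _).2 (hk c⁻¹)
  rw [map_inv₀, map_inv₀] at h
  have h0 : O.valuation (algebraMap k F c) ≠ 0 := by simpa using hc
  exact (inv_le_one₀ (zero_lt_iff.2 h0)).1 h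

theorem valuation_eq_one_of_sub_lt (hk : ∀ c : k, algebraMap k F c ∈ O) {c : k} (hc : c ≠ 0)
    {f : F} (hf : O.valuation (f - algebraMap k F c) < 1) : O.valuation f = 1 := by
  have h1 := valuation_algebraMap_eq_one hk hc
  rw [← h1] at hf
  have := O.valuation.map_add_eq_of_lt_right hf
  rwa [sub_add_cancel, h1] at this

theorem eq_of_sub_lt (hk : ∀ c : k, algebraMap k F c ∈ O) {f : F} {a b : k}
    (ha : O.valuation (f - algebraMap k F a) < 1) (hb : O.valuation (f - algebraMap k F b) < 1) :
    a = b := by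
  by_contra hab
  have h1 := valuation_algebraMap_eq_one hk (sub_ne_zero.2 hab)
  have h2 := O.valuation.map_sub_lt hb ha
  rw [map_sub] at h1
  rw [show f - algebraMap k F b - (f - algebraMap k F a) =
    algebraMap k F a - algebraMap k F b by ring, h1] at h2
  exact h2.false

theorem valuation_sub_lt_of_aeval [IsAlgClosed k] (hk : ∀ c : k, algebraMap k F c ∈ O)
    {P : k[X]} (hP : P ≠ 0) {z : F} (hz : O.valuation (aeval z P) < 1) :
    ∃ a, P.eval a = 0 ∧ O.valuation (z - algebraMap k F a) < 1 := by
  have h1 (s : Multiset k) : O.valuation (s.map fun a => z - algebraMap k F a).prod < 1 →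
      ∃ a ∈ s, O.valuation (z - algebraMap k F a) < 1 := by
    induction s using Multiset.induction_on with
    | empty => simp
    | cons a s ih =>
      intro h
      rw [Multiset.map_cons, Multiset.prod_cons, map_mul] at h
      by_cases ha : O.valuation (z - algebraMap k F a) < 1
      · exact ⟨a, Multiset.mem_cons_self a s, ha⟩
      · obtain ⟨b, hb, hb'⟩ := ih (lt_of_le_of_lt (le_mul_of_one_le_left' (not_lt.1 ha)) h)
        exact ⟨b, Multiset.mem_cons_of_mem hb, hb'⟩
  have hs := (IsAlgClosed.splits P).eq_prod_roots
  rw [hs, map_mul, aeval_C, map_mul,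
    valuation_algebraMap_eq_one hk (leadingCoeff_ne_zero.2 hP), one_mul, map_multiset_prod,
    Multiset.map_map] at hz
  obtain ⟨a, ha, ha'⟩ := h1 P.roots (by simpa using hz)
  exact ⟨a, (mem_roots hP).1 ha, ha'⟩

theorem aeval_mem (hk : ∀ c : k, algebraMap k F c ∈ O) {z : F} (hz : z ∈ O) (P : k[X]) :
    aeval z P ∈ O := by
  induction P using Polynomial.induction_on' with
  | add f g hf hg => rw [map_add]; exact O.add_mem _ _ hf hg
  | monomial n c =>
    rw [aeval_monomial]
    exact O.mul_mem _ _ (hk c) (pow_mem hz n)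

theorem mem_of_pow_mem {f : F} {n : ℕ} (hn : n ≠ 0) (hf : f ^ n ∈ O) : f ∈ O := by
  rw [← O.valuation_le_one_iff, map_pow] at hf
  rw [← O.valuation_le_one_iff]
  exact (pow_le_one_iff hn).1 hf

end ValuationSubring

/-- A valuation ring over `k` centred at the affine point `(a, b)`. -/
structure IsCentered (O : ValuationSubring F) (x y : F) (a b : k) : Prop where
  algebraMap_mem : ∀ c : k, algebraMap k F c ∈ O
  x_lt : O.valuation (x - algebraMap k F a) < 1
  y_lt : O.valuation (y - algebraMap k F b) < 1

variable {x y : F} {O : ValuationSubring F} {a b : k}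

theorem IsCentered.pow_eq (h : IsGenPair k q m x y)
    (hO : IsCentered O x y a b) : b ^ m = a ^ q - a := by
  have hk := hO.algebraMap_mem
  have key (z : F) (c : k) (hz : O.valuation (z - algebraMap k F c) < 1) (P : k[X]) :
      O.valuation (aeval z P - algebraMap k F (P.eval c)) < 1 := by
    obtain ⟨Q, hQ⟩ : X - C c ∣ P - C (P.eval c) := by
      rw [dvd_iff_isRoot]; simp
    have h1 := congrArg (aeval z) hQ
    simp only [map_sub, map_mul, aeval_X, aeval_C] at h1
    rw [h1, map_mul]
    have hzO : z ∈ O := by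
      have := add_mem ((O.valuation_le_one_iff _).1 hz.le) (hk c)
      rwa [sub_add_cancel] at this
    exact mul_lt_one_of_lt_of_le hz
      ((O.valuation_le_one_iff _).2 (ValuationSubring.aeval_mem hk hzO Q))
  have h1 := key y b hO.y_lt (X ^ m)
  have h2 := key x a hO.x_lt (X ^ q - X)
  simp only [map_sub, map_pow, aeval_X, eval_sub, eval_pow, eval_X] at h1 h2
  rw [h.pow_eq] at h1
  refine ValuationSubring.eq_of_sub_lt (f := x ^ q - x) hk ?_ ?_
  · simpa using h1
  · simpa using h2

theorem IsGenPair.exists_isCentered [IsAlgClosed k] (hE : ExponentData p n q m)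
    (h : IsGenPair k q m x y) (hk : ∀ c : k, algebraMap k F c ∈ O) (hO : O ≠ ⊤) (hx : x ∈ O) :
    ∃ a b : k, IsCentered O x y a b := by
  have hm : m ≠ 0 := by have := hE.three_le; omega
  have hyO : y ∈ O := by
    refine ValuationSubring.mem_of_pow_mem hm ?_
    rw [h.pow_eq]
    exact sub_mem (pow_mem hx q) hx
  have hex : ∃ P : k[X], P ≠ 0 ∧ O.valuation (aeval x P) < 1 := by
    by_contra! hcon
    refine hO (top_unique fun f _ => ?_)
    obtain ⟨Q, P, hQ, hf⟩ := h.exists_mul_eq_sum hE f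
    have h1 : O.valuation (aeval x Q * f) ≤ 1 := by
      rw [O.valuation_le_one_iff, hf]
      exact sum_mem fun j _ => mul_mem (ValuationSubring.aeval_mem hk hx _) (pow_mem hyO j)
    rw [map_mul] at h1
    rw [← O.valuation_le_one_iff]
    exact (le_mul_of_one_le_left' (hcon Q hQ)).trans h1
  obtain ⟨P, hP, hPx⟩ := hex
  obtain ⟨a, -, ha⟩ := ValuationSubring.valuation_sub_lt_of_aeval hk hP hPx
  have hy : O.valuation (aeval y (X ^ m - C (a ^ q - a))) < 1 := by
    obtain ⟨Q, hQ⟩ : X - C a ∣ X ^ q - X - C (a ^ q - a) := by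
      rw [dvd_iff_isRoot]; simp
    have h1 := congrArg (aeval x) hQ
    simp only [map_sub, map_mul, map_pow, aeval_X, aeval_C] at h1 ⊢
    rw [h.pow_eq, h1, map_mul]
    exact mul_lt_one_of_lt_of_le ha
      ((O.valuation_le_one_iff _).2 (ValuationSubring.aeval_mem hk hx Q))
  obtain ⟨b, -, hb⟩ := ValuationSubring.valuation_sub_lt_of_aeval hk
    (X_pow_sub_C_ne_zero (Nat.pos_of_ne_zero hm) _) hy
  exact ⟨a, b, hk, ha, hb⟩

/-- The expansion of an element of the coordinate ring at an affine point. -/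
theorem exists_expansion (x y : F) (a b : k) {f : F} (hf : f ∈ Algebra.adjoin k {x, y}) :
    ∃ c : k, ∃ f₁ ∈ Algebra.adjoin k {x, y}, ∃ f₂ ∈ Algebra.adjoin k {x, y},
      f = algebraMap k F c + (x - algebraMap k F a) * f₁ + (y - algebraMap k F b) * f₂ := by
  have hx : x ∈ Algebra.adjoin k {x, y} := Algebra.subset_adjoin (by simp)
  have hy : y ∈ Algebra.adjoin k {x, y} := Algebra.subset_adjoin (by simp)
  have hc (c : k) : algebraMap k F c ∈ Algebra.adjoin k {x, y} := Subalgebra.algebraMap_mem _ c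
  induction hf using Algebra.adjoin_induction with
  | mem z hz =>
    rcases hz with rfl | rfl
    · exact ⟨a, 1, one_mem _, 0, zero_mem _, by ring⟩
    · exact ⟨b, 0, zero_mem _, 1, one_mem _, by ring⟩
  | algebraMap c => exact ⟨c, 0, zero_mem _, 0, zero_mem _, by ring⟩
  | add f g _ _ hf hg =>
    obtain ⟨c, f₁, h1, f₂, h2, e⟩ := hf
    obtain ⟨d, g₁, h3, g₂, h4, e'⟩ := hg
    refine ⟨c + d, f₁ + g₁, add_mem h1 h3, f₂ + g₂, add_mem h2 h4, ?_⟩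
    rw [e, e', map_add]
    ring
  | mul f g hf' hg' hf hg =>
    obtain ⟨c, f₁, h1, f₂, h2, e⟩ := hf
    obtain ⟨d, g₁, h3, g₂, h4, e'⟩ := hg
    refine ⟨c * d, algebraMap k F c * g₁ + f₁ * g, add_mem (mul_mem (hc c) h3) (mul_mem h1 hg'),
      algebraMap k F c * g₂ + f₂ * g, add_mem (mul_mem (hc c) h4) (mul_mem h2 hg'), ?_⟩
    rw [e, map_mul]
    linear_combination algebraMap k F c * e'

theorem IsCentered.x_mem (hO : IsCentered O x y a b) : x ∈ O := by
  have := add_mem ((O.valuation_le_one_iff _).1 hO.x_lt.le) (hO.algebraMap_mem a)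
  rwa [sub_add_cancel] at this

theorem IsCentered.y_mem (hO : IsCentered O x y a b) : y ∈ O := by
  have := add_mem ((O.valuation_le_one_iff _).1 hO.y_lt.le) (hO.algebraMap_mem b)
  rwa [sub_add_cancel] at this

theorem IsCentered.mem_of_mem_adjoin (hO : IsCentered O x y a b) {f : F}
    (hf : f ∈ Algebra.adjoin k {x, y}) : f ∈ O := by
  induction hf using Algebra.adjoin_induction with
  | mem z hz =>
    rcases hz with rfl | rfl
    exacts [hO.x_mem, hO.y_mem]
  | algebraMap c => exact hO.algebraMap_mem c
  | add f g _ _ hf hg => exact add_mem hf hg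
  | mul f g _ _ hf hg => exact mul_mem hf hg

theorem IsCentered.valuation_mul_sub_add (hO : IsCentered O x y a b) {f₁ f₂ : F}
    (h₁ : f₁ ∈ Algebra.adjoin k {x, y}) (h₂ : f₂ ∈ Algebra.adjoin k {x, y}) :
    O.valuation ((x - algebraMap k F a) * f₁ + (y - algebraMap k F b) * f₂) < 1 := by
  refine O.valuation.map_add_lt ?_ ?_ <;> rw [map_mul]
  · exact mul_lt_one_of_lt_of_le hO.x_lt
      ((O.valuation_le_one_iff _).2 (hO.mem_of_mem_adjoin h₁))
  · exact mul_lt_one_of_lt_of_le hO.y_lt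
      ((O.valuation_le_one_iff _).2 (hO.mem_of_mem_adjoin h₂))

/-- `x - a` is a unit times a power of the local parameter `y - b`. -/
theorem IsGenPair.exists_sub_eq [CharP k p] [Fact p.Prime] [CharP F p] (hE : ExponentData p n q m)
    (h : IsGenPair k q m x y) (hab : b ^ m = a ^ q - a) :
    ∃ (v : ℕ) (w : F), v ≠ 0 ∧ (b ≠ 0 → v = 1) ∧ (b = 0 → v = m) ∧
      x - algebraMap k F a = (y - algebraMap k F b) ^ v * w ∧
      (∀ O : ValuationSubring F, IsCentered O x y a b → O.valuation w = 1) ∧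
      ∃ g : F, (∀ O : ValuationSubring F, IsCentered O x y a b → O.valuation g = 1) ∧
        g ∈ Algebra.adjoin k {x, y} ∧ w * g ∈ Algebra.adjoin k {x, y} := by
  have hm : m ≠ 0 := by have := hE.three_le; omega
  have hq := hE.one_lt
  have hxA : x ∈ Algebra.adjoin k {x, y} := Algebra.subset_adjoin (by simp)
  have hyA : y ∈ Algebra.adjoin k {x, y} := Algebra.subset_adjoin (by simp)
  have hc (c : k) : algebraMap k F c ∈ Algebra.adjoin k {x, y} := Subalgebra.algebraMap_mem _ c
  set ξ := x - algebraMap k F a with hξ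
  set η := y - algebraMap k F b with hη
  have hξA : ξ ∈ Algebra.adjoin k {x, y} := sub_mem hxA (hc a)
  have hg0 : ξ ^ (q - 1) - 1 ≠ 0 := by
    intro h0
    apply h.transcendental
    refine ⟨(X - C a) ^ (q - 1) - 1, fun h1 => ?_, by simpa using h0⟩
    have h2 := congrArg natDegree h1
    rw [← C_1, natDegree_sub_C, natDegree_pow, natDegree_X_sub_C, natDegree_zero] at h2
    omega
  have hgA : ξ ^ (q - 1) - 1 ∈ Algebra.adjoin k {x, y} := sub_mem (pow_mem hξA _) (one_mem _)
  have hg (O : ValuationSubring F) (hO : IsCentered O x y a b) :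
      O.valuation (ξ ^ (q - 1) - 1) = 1 := by
    refine ValuationSubring.valuation_eq_one_of_sub_lt hO.algebraMap_mem (c := -1) (by simp) ?_
    rw [map_neg, map_one, sub_neg_eq_add, sub_add_cancel, map_pow]
    exact pow_lt_one₀ zero_le hO.x_lt (by omega)
  have hid : ξ * (ξ ^ (q - 1) - 1) = y ^ m - algebraMap k F b ^ m := by
    rw [h.pow_eq, ← map_pow, hab, mul_sub, ← pow_succ', Nat.sub_add_cancel hq.le, hξ,
      hE.sub_pow, map_sub, map_pow]
    ring
  have hEA : ∑ i ∈ Finset.range m, y ^ i * algebraMap k F b ^ (m - 1 - i) ∈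
      Algebra.adjoin k {x, y} :=
    sum_mem fun i _ => mul_mem (pow_mem hyA _) (pow_mem (hc b) _)
  have hgeom := (Commute.all y (algebraMap k F b)).mul_geom_sum₂ m
  rcases eq_or_ne b 0 with hb | hb
  · refine ⟨m, (ξ ^ (q - 1) - 1)⁻¹, hm, fun h0 => absurd hb h0, fun _ => rfl, ?_, ?_, ?_⟩
    · rw [hη, hb, map_zero, sub_zero, ← div_eq_mul_inv, eq_div_iff hg0, hid, hb, map_zero,
        zero_pow hm, sub_zero]
    · intro O hO
      rw [map_inv₀, hg O hO, inv_one]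
    · refine ⟨_, hg, hgA, ?_⟩
      rw [inv_mul_cancel₀ hg0]
      exact one_mem _
  · refine ⟨1, (∑ i ∈ Finset.range m, y ^ i * algebraMap k F b ^ (m - 1 - i)) *
      (ξ ^ (q - 1) - 1)⁻¹, one_ne_zero, fun _ => rfl, fun h0 => absurd h0 hb, ?_, ?_, ?_⟩
    · rw [pow_one, ← mul_assoc, ← div_eq_mul_inv, eq_div_iff hg0, hid, hgeom]
    · intro O hO
      rw [map_mul, map_inv₀, hg O hO, inv_one, mul_one]
      refine ValuationSubring.valuation_eq_one_of_sub_lt hO.algebraMap_mem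
        (c := m * b ^ (m - 1)) (mul_ne_zero (hE.cast_m_ne_zero k) (pow_ne_zero _ hb)) ?_
      obtain ⟨P, hP⟩ : X - C b ∣ ∑ i ∈ Finset.range m, (X : k[X]) ^ i * C b ^ (m - 1 - i)
          - C (m * b ^ (m - 1)) := by
        rw [dvd_iff_isRoot, IsRoot, eval_sub, eval_finsetSum, eval_C, sub_eq_zero]
        rw [Finset.sum_congr rfl (g := fun _ => b ^ (m - 1))]
        · simp
        · intro i hi
          have := Finset.mem_range.1 hi
          simp only [eval_mul, eval_pow, eval_X, eval_C, ← pow_add]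
          congr 1
          omega
      have h1 := congrArg (aeval y) hP
      simp only [map_sub, map_mul, aeval_X, aeval_C, map_sum, map_pow] at h1
      simp only [map_mul, map_pow, map_natCast] at h1 ⊢
      rw [h1, map_mul]
      exact mul_lt_one_of_lt_of_le hO.y_lt ((O.valuation_le_one_iff _).2
        (ValuationSubring.aeval_mem hO.algebraMap_mem hO.y_mem P))
    · refine ⟨_, hg, hgA, ?_⟩
      rw [inv_mul_cancel_right₀ hg0]
      exact hEA

end

section
variable {p n q m : ℕ} {k F : Type*} [Field k] [Field F] [Algebra k F]
variable {x y : F} {O : ValuationSubring F} {a b : k}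

theorem IsGenPair.sub_ne_zero (h : IsGenPair k q m x y) (a : k) : x - algebraMap k F a ≠ 0 := by
  intro h0
  apply h.transcendental
  rw [_root_.sub_eq_zero.1 h0]
  exact isAlgebraic_algebraMap a

theorem IsGenPair.y_sub_ne_zero (hE : ExponentData p n q m) (h : IsGenPair k q m x y) (b : k) :
    y - algebraMap k F b ≠ 0 := by
  intro h0
  have h1 := h.pow_eq
  have hq := hE.one_lt
  rw [_root_.sub_eq_zero.1 h0, ← map_pow] at h1
  refine h.transcendental ⟨X ^ q - X - C (b ^ m), fun h2 => ?_, by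
    rw [map_sub, map_sub, map_pow, aeval_X, aeval_C, h1, sub_self]⟩
  have h3 := congrArg (fun P => coeff P 1) h2
  simp [coeff_X_pow, hq.ne, -map_pow] at h3

theorem IsCentered.valuation_aeval_eq_one (hO : IsCentered O x y a b) {P : k[X]}
    (hP : P.eval a ≠ 0) : O.valuation (aeval x P) = 1 := by
  refine ValuationSubring.valuation_eq_one_of_sub_lt hO.algebraMap_mem hP ?_
  obtain ⟨Q, hQ⟩ : X - C a ∣ P - C (P.eval a) := by
    rw [dvd_iff_isRoot]; simp
  have h1 := congrArg (aeval x) hQ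
  simp only [map_sub, map_mul, aeval_X, aeval_C] at h1
  rw [h1, map_mul]
  exact mul_lt_one_of_lt_of_le hO.x_lt
    ((O.valuation_le_one_iff _).2 (ValuationSubring.aeval_mem hO.algebraMap_mem hO.x_mem Q))

/-- An element is a power of the local parameter times a unit, uniformly in the valuation ring. -/
def IsParamMulUnit (x y : F) (a b : k) (f : F) : Prop :=
  ∃ (i : ℤ) (g : F), f = (y - algebraMap k F b) ^ i * g ∧
    ∀ O : ValuationSubring F, IsCentered O x y a b → O.valuation g = 1

theorem IsParamMulUnit.mul (hη : y - algebraMap k F b ≠ 0) {f g : F}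
    (hf : IsParamMulUnit x y a b f) (hg : IsParamMulUnit x y a b g) :
    IsParamMulUnit x y a b (f * g) := by
  obtain ⟨i, f', rfl, hf⟩ := hf
  obtain ⟨j, g', rfl, hg⟩ := hg
  refine ⟨i + j, f' * g', ?_, fun O hO => by rw [map_mul, hf O hO, hg O hO, one_mul]⟩
  rw [zpow_add₀ hη]
  ring

theorem IsParamMulUnit.inv {f : F} (hf : IsParamMulUnit x y a b f) :
    IsParamMulUnit x y a b f⁻¹ := by
  obtain ⟨i, f', rfl, hf⟩ := hf
  refine ⟨-i, f'⁻¹, by rw [mul_inv, zpow_neg], fun O hO => by rw [map_inv₀, hf O hO, inv_one]⟩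

theorem IsGenPair.isParamMulUnit_or [CharP k p] [Fact p.Prime] [CharP F p]
    (hE : ExponentData p n q m) (h : IsGenPair k q m x y) (hab : b ^ m = a ^ q - a) {f : F}
    (hf : f ∈ Algebra.adjoin k {x, y}) (N : ℕ) :
    IsParamMulUnit x y a b f ∨ ∃ f' ∈ Algebra.adjoin k {x, y}, ∃ g ∈ Algebra.adjoin k {x, y},
      (∀ O : ValuationSubring F, IsCentered O x y a b → O.valuation g = 1) ∧
      g * f = (y - algebraMap k F b) ^ N * f' := by
  have hη := h.y_sub_ne_zero hE b
  have hyA : y ∈ Algebra.adjoin k {x, y} := Algebra.subset_adjoin (by simp)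
  have hc (c : k) : algebraMap k F c ∈ Algebra.adjoin k {x, y} := Subalgebra.algebraMap_mem _ c
  obtain ⟨v, w, hv, -, -, hvw, hw, g₀, hg₀, hg₀A, hwg₀⟩ := h.exists_sub_eq hE hab
  induction N with
  | zero => exact Or.inr ⟨f, hf, 1, one_mem _, by simp, by simp⟩
  | succ N ih =>
    rcases ih with ih | ⟨f', hf', g, hgA, hg, he⟩
    · exact Or.inl ih
    obtain ⟨c, f₁, h₁, f₂, h₂, hfe⟩ := exists_expansion x y a b hf'
    by_cases hc0 : c = 0
    · right
      refine ⟨(y - algebraMap k F b) ^ (v - 1) * (w * g₀) * f₁ + g₀ * f₂, ?_, g₀ * g,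
        mul_mem hg₀A hgA, fun O hO => by rw [map_mul, hg₀ O hO, hg O hO, one_mul], ?_⟩
      · exact add_mem (mul_mem (mul_mem (pow_mem (sub_mem hyA (hc b)) _) hwg₀) h₁) (mul_mem hg₀A h₂)
      · have h3 : (y - algebraMap k F b) ^ (N + 1) * (y - algebraMap k F b) ^ (v - 1) =
            (y - algebraMap k F b) ^ N * (y - algebraMap k F b) ^ v := by
          rw [← pow_add, ← pow_add]
          congr 1
          omega
        rw [mul_assoc, he, hfe, hc0, map_zero, hvw]
        linear_combination (-w * g₀ * f₁) * h3
    · left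
      have hg0 (O : ValuationSubring F) (hO : IsCentered O x y a b) : O.valuation (g⁻¹ * f') = 1 := by
        rw [map_mul, map_inv₀, hg O hO, inv_one, one_mul]
        refine ValuationSubring.valuation_eq_one_of_sub_lt hO.algebraMap_mem hc0 ?_
        rw [hfe, add_assoc, add_sub_cancel_left]
        exact hO.valuation_mul_sub_add h₁ h₂
      by_cases hgz : g = 0
      · refine ⟨0, f, by simp, fun O hO => ?_⟩
        have := hg O hO
        simp [hgz] at this
      · refine ⟨N, g⁻¹ * f', ?_, hg0⟩
        rw [zpow_natCast]
        field_simp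
        linear_combination he

theorem IsGenPair.isParamMulUnit_aeval [CharP k p] [Fact p.Prime] [CharP F p]
    (hE : ExponentData p n q m) (h : IsGenPair k q m x y) (hab : b ^ m = a ^ q - a) {P : k[X]}
    (hP : P ≠ 0) : IsParamMulUnit x y a b (aeval x P) := by
  have hη := h.y_sub_ne_zero hE b
  obtain ⟨v, w, hv, -, -, hvw, hw, -⟩ := h.exists_sub_eq hE hab
  obtain ⟨Q, hQ, hnd⟩ := exists_eq_pow_rootMultiplicity_mul_and_not_dvd P hP a
  rw [dvd_iff_isRoot, IsRoot] at hnd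
  refine ⟨v * P.rootMultiplicity a, w ^ P.rootMultiplicity a * aeval x Q, ?_, fun O hO => ?_⟩
  · conv_lhs => rw [hQ]
    simp only [map_sub, map_mul, map_pow, aeval_X, aeval_C]
    rw [hvw, ← Nat.cast_mul, zpow_natCast]
    ring
  · rw [map_mul, map_pow, hw O hO, one_pow, one_mul, hO.valuation_aeval_eq_one hnd]

theorem IsGenPair.isParamMulUnit [CharP k p] [Fact p.Prime] [CharP F p]
    (hE : ExponentData p n q m) (h : IsGenPair k q m x y) (hO : IsCentered O x y a b) {f : F}
    (hf0 : f ≠ 0) : IsParamMulUnit x y a b f := by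
  have hη := h.y_sub_ne_zero hE b
  have hab := hO.pow_eq h
  have hxA : x ∈ Algebra.adjoin k {x, y} := Algebra.subset_adjoin (by simp)
  have hyA : y ∈ Algebra.adjoin k {x, y} := Algebra.subset_adjoin (by simp)
  have hPA (P : k[X]) : aeval x P ∈ Algebra.adjoin k {x, y} :=
    Algebra.adjoin_mono (by simp) (aeval_mem_adjoin_singleton k x)
  have hsA (P : ℕ → k[X]) : ∑ j ∈ Finset.range m, aeval x (P j) * y ^ j ∈
      Algebra.adjoin k {x, y} :=
    sum_mem fun j _ => mul_mem (hPA _) (pow_mem hyA j)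
  have hQ0 {Q : k[X]} (hQ : Q ≠ 0) : aeval x Q ≠ 0 := fun h0 =>
    hQ (transcendental_iff.1 h.transcendental _ h0)
  have main {f : F} (hfA : f ∈ Algebra.adjoin k {x, y}) (hf0 : f ≠ 0) :
      IsParamMulUnit x y a b f := by
    obtain ⟨Q, P, hQ, hfP⟩ := h.exists_mul_eq_sum hE f⁻¹
    obtain ⟨i, u, hu, hu1⟩ := h.isParamMulUnit_aeval hE hab hQ
    obtain h1 | ⟨f', hf', g, hgA, hg, he⟩ := h.isParamMulUnit_or hE hab hfA (i.toNat + 1)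
    · exact h1
    exfalso
    have h1 : aeval x Q = f * ∑ j ∈ Finset.range m, aeval x (P j) * y ^ j := by
      rw [← hfP]
      field_simp
    have h2 : O.valuation (g * aeval x Q) ≤ O.valuation ((y - algebraMap k F b) ^ (i.toNat + 1)) := by
      rw [h1, ← mul_assoc, he, mul_assoc, map_mul]
      refine mul_le_of_le_one_right' ?_
      rw [O.valuation_le_one_iff]
      exact mul_mem (hO.mem_of_mem_adjoin hf') (hO.mem_of_mem_adjoin (hsA P))
    rw [map_mul, hg O hO, one_mul, hu, map_mul, hu1 O hO, mul_one, map_zpow₀, map_pow] at h2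
    have hv0 : O.valuation (y - algebraMap k F b) ≠ 0 := by simpa using hη
    have h3 : O.valuation (y - algebraMap k F b) ^ ((i.toNat + 1 : ℕ) : ℤ) <
        O.valuation (y - algebraMap k F b) ^ i :=
      zpow_lt_zpow_right_of_lt_one₀ (zero_lt_iff.2 hv0) hO.y_lt (by omega)
    rw [zpow_natCast] at h3
    exact absurd h2 (not_le.2 h3)
  obtain ⟨Q, P, hQ, hfP⟩ := h.exists_mul_eq_sum hE f
  have h1 : f = (aeval x Q)⁻¹ * ∑ j ∈ Finset.range m, aeval x (P j) * y ^ j := by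
    rw [← hfP, inv_mul_cancel_left₀ (hQ0 hQ)]
  rw [h1]
  refine (main (hPA Q) (hQ0 hQ)).inv.mul hη (main (hsA P) ?_)
  rw [← hfP]
  exact mul_ne_zero (hQ0 hQ) hf0

theorem IsCentered.unique [CharP k p] [Fact p.Prime] [CharP F p] (hE : ExponentData p n q m)
    (h : IsGenPair k q m x y) {O₁ O₂ : ValuationSubring F} (h₁ : IsCentered O₁ x y a b)
    (h₂ : IsCentered O₂ x y a b) : O₁ = O₂ := by
  have hη := h.y_sub_ne_zero hE b
  have key {O₁ O₂ : ValuationSubring F} (h₁ : IsCentered O₁ x y a b)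
      (h₂ : IsCentered O₂ x y a b) : O₁ ≤ O₂ := by
    intro f hf
    rcases eq_or_ne f 0 with rfl | hf0
    · exact zero_mem _
    obtain ⟨i, g, rfl, hg⟩ := h.isParamMulUnit hE h₁ hf0
    rw [← ValuationSubring.valuation_le_one_iff, map_mul, map_zpow₀, hg _ h₁, mul_one] at hf
    rw [← ValuationSubring.valuation_le_one_iff, map_mul, map_zpow₀, hg _ h₂, mul_one]
    have hv1 : O₁.valuation (y - algebraMap k F b) ≠ 0 := by simpa using hη
    have hi : 0 ≤ i := by
      by_contra! hi
      have := one_lt_zpow_of_neg₀ (zero_lt_iff.2 hv1) h₁.y_lt hi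
      exact absurd hf (not_le.2 this)
    lift i to ℕ using hi
    rw [zpow_natCast]
    exact pow_le_one₀ zero_le h₂.y_lt.le
  exact le_antisymm (key h₁ h₂) (key h₂ h₁)

/-- The maximal ideal is generated by the local parameter. -/
theorem IsCentered.valuation_le [CharP k p] [Fact p.Prime] [CharP F p] (hE : ExponentData p n q m)
    (h : IsGenPair k q m x y) (hO : IsCentered O x y a b) {f : F} (hf : O.valuation f < 1) :
    O.valuation f ≤ O.valuation (y - algebraMap k F b) := by
  have hη := h.y_sub_ne_zero hE b
  rcases eq_or_ne f 0 with rfl | hf0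
  · simp
  obtain ⟨i, g, rfl, hg⟩ := h.isParamMulUnit hE hO hf0
  rw [map_mul, map_zpow₀, hg _ hO, mul_one] at hf ⊢
  have hv : O.valuation (y - algebraMap k F b) ≠ 0 := by simpa using hη
  have hi : 1 ≤ i := by
    by_contra! hi
    have := one_le_zpow_of_nonpos₀ (zero_lt_iff.2 hv) hO.y_lt.le (by omega : i ≤ 0)
    exact absurd hf (not_lt.2 this)
  calc _ ≤ O.valuation (y - algebraMap k F b) ^ (1 : ℤ) :=
        zpow_le_zpow_right_of_le_one₀ (zero_lt_iff.2 hv) hO.y_lt.le hi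
    _ = _ := zpow_one _

theorem IsCentered.valuation_sub_eq [CharP k p] [Fact p.Prime] [CharP F p]
    (hE : ExponentData p n q m) (h : IsGenPair k q m x y) (hO : IsCentered O x y a b) :
    O.valuation (x - algebraMap k F a) =
      O.valuation (y - algebraMap k F b) ^ (open Classical in if b = 0 then m else 1) := by
  obtain ⟨v, w, hv, h1, h2, hvw, hw, -⟩ := h.exists_sub_eq hE (hO.pow_eq h)
  rw [hvw, map_mul, hw O hO, mul_one, map_pow]
  split_ifs with hb
  · rw [h2 hb]
  · rw [h1 hb]

theorem IsGenPair.exists_isCentered_of_point [IsAlgClosed k] (hE : ExponentData p n q m)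
    (h : IsGenPair k q m x y) (a : k) :
    ∃ (O : ValuationSubring F) (b : k), IsCentered O x y a b := by
  have ht : ¬ IsIntegral k (x - algebraMap k F a)⁻¹ := by
    intro hi
    have h1 : IsAlgebraic k x := by
      have := (hi.isAlgebraic.inv).add (isAlgebraic_algebraMap a)
      rwa [inv_inv, sub_add_cancel] at this
    exact h.transcendental h1
  obtain ⟨O, hk, hO⟩ := exists_valuationSubring_notMem ht
  have hx : O.valuation (x - algebraMap k F a) < 1 := by
    rw [← O.valuation_le_one_iff, not_le, map_inv₀] at hO
    exact (one_lt_inv₀ (zero_lt_iff.2 (by simpa using h.sub_ne_zero a))).1 hO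
  have hxO : x ∈ O := by
    have := add_mem ((O.valuation_le_one_iff _).1 hx.le) (hk a)
    rwa [sub_add_cancel] at this
  have hT : O ≠ ⊤ := by
    rintro rfl
    exact hO trivial
  obtain ⟨a', b, hO'⟩ := h.exists_isCentered hE hk hT hxO
  obtain rfl : a = a' := ValuationSubring.eq_of_sub_lt hk hx hO'.x_lt
  exact ⟨O, b, hO'⟩

end

section
variable {p n q m : ℕ} {k F : Type*} [Field k] [Field F] [Algebra k F]
variable {x y : F} {O : ValuationSubring F}

theorem IsGenPair.linear_ne_zero (h : IsGenPair k q m x y) {γ δ : k} (hγδ : γ ≠ 0 ∨ δ ≠ 0) :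
    algebraMap k F γ * x + algebraMap k F δ ≠ 0 := by
  intro h0
  have h1 := transcendental_iff.1 h.transcendental (C γ * X + C δ) (by simpa using h0)
  have h2 := congrArg (fun P => coeff P 1) h1
  have h3 := congrArg (fun P => coeff P 0) h1
  simp at h2 h3
  tauto

/-- The action of `GL₂(𝔽_q)` on generating pairs. -/
theorem IsGenPair.mobius [Fact p.Prime] [CharP F p] (hE : ExponentData p n q m)
    (h : IsGenPair k q m x y) {α β γ δ e : k} (hα : α ^ q = α) (hβ : β ^ q = β) (hγ : γ ^ q = γ)
    (hδ : δ ^ q = δ) (hΔ : α * δ - β * γ ≠ 0) (he : e ^ m = α * δ - β * γ) :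
    IsGenPair k q m
      ((algebraMap k F α * x + algebraMap k F β) / (algebraMap k F γ * x + algebraMap k F δ))
      (algebraMap k F e * y / (algebraMap k F γ * x + algebraMap k F δ) ^ 2) := by
  have hm : m ≠ 0 := by have := hE.three_le; omega
  have hD : algebraMap k F γ * x + algebraMap k F δ ≠ 0 := h.linear_ne_zero (by
    by_contra! hc
    simp [hc.1, hc.2] at hΔ)
  have hΔ' : algebraMap k F α * algebraMap k F δ - algebraMap k F β * algebraMap k F γ ≠ 0 := by
    rwa [← map_mul, ← map_mul, ← map_sub, Ne, FaithfulSMul.algebraMap_eq_zero_iff]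
  have he0 : algebraMap k F e ≠ 0 := by
    rw [Ne, FaithfulSMul.algebraMap_eq_zero_iff]
    rintro rfl
    rw [zero_pow hm] at he
    exact hΔ he.symm
  have he' : algebraMap k F e ^ m =
      algebraMap k F α * algebraMap k F δ - algebraMap k F β * algebraMap k F γ := by
    rw [← map_mul, ← map_mul, ← map_sub, ← map_pow, he]
  have frob {c : k} (hc : c ^ q = c) : algebraMap k F c ^ q = algebraMap k F c := by
    rw [← map_pow, hc]
  have hp : (algebraMap k F e * y / (algebraMap k F γ * x + algebraMap k F δ) ^ 2) ^ m =
      ((algebraMap k F α * x + algebraMap k F β) / (algebraMap k F γ * x + algebraMap k F δ)) ^ q -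
      (algebraMap k F α * x + algebraMap k F β) / (algebraMap k F γ * x + algebraMap k F δ) := by
    have hD2 : ((algebraMap k F γ * x + algebraMap k F δ) ^ 2) ^ m =
        (algebraMap k F γ * x ^ q + algebraMap k F δ) *
          (algebraMap k F γ * x + algebraMap k F δ) := by
      rw [← pow_mul, hE.two_mul, pow_succ, hE.add_pow, mul_pow, frob hγ, frob hδ]
    have hDq : (algebraMap k F γ * x + algebraMap k F δ) ^ q =
        algebraMap k F γ * x ^ q + algebraMap k F δ := by
      rw [hE.add_pow, mul_pow, frob hγ, frob hδ]
    have hDq0 : algebraMap k F γ * x ^ q + algebraMap k F δ ≠ 0 := by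
      rw [← hDq]
      exact pow_ne_zero _ hD
    rw [div_pow, mul_pow, he', h.pow_eq, hD2, div_pow, hDq, hE.add_pow, mul_pow, frob hα, frob hβ]
    field_simp
    ring
  refine h.of_mem_adjoin hm hp ?_ ?_
  all_goals
    set x' := (algebraMap k F α * x + algebraMap k F β) /
      (algebraMap k F γ * x + algebraMap k F δ) with hx'
    set y' := algebraMap k F e * y / (algebraMap k F γ * x + algebraMap k F δ) ^ 2 with hy'
    have hx'' : x' ∈ adjoin k {x', y'} := subset_adjoin _ _ (by simp)
    have hy'' : y' ∈ adjoin k {x', y'} := subset_adjoin _ _ (by simp)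
    have hc (c : k) : algebraMap k F c ∈ adjoin k {x', y'} :=
      IntermediateField.algebraMap_mem _ c
    have hxx : x = (algebraMap k F δ * x' - algebraMap k F β) /
        (algebraMap k F α - algebraMap k F γ * x') := by
      have hxD : x' * (algebraMap k F γ * x + algebraMap k F δ) =
          algebraMap k F α * x + algebraMap k F β := div_mul_cancel₀ _ hD
      rw [eq_div_iff]
      · linear_combination -hxD
      · intro h0
        apply hΔ'
        linear_combination (algebraMap k F γ * x + algebraMap k F δ) * h0 + algebraMap k F γ * hxD
    have hxA : x ∈ adjoin k {x', y'} := by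
      rw [hxx]
      exact div_mem (sub_mem (mul_mem (hc _) hx'') (hc _)) (sub_mem (hc _) (mul_mem (hc _) hx''))
  · exact hxA
  · have hyy : y = y' * (algebraMap k F γ * x + algebraMap k F δ) ^ 2 / algebraMap k F e := by
      rw [hy']
      field_simp
    rw [hyy]
    exact div_mem (mul_mem hy'' (pow_mem (add_mem (mul_mem (hc _) hxA) (hc _)) 2)) (hc _)

theorem IsGenPair.inv_sub [Fact p.Prime] [CharP F p] (hE : ExponentData p n q m)
    (h : IsGenPair k q m x y) {a ε : k} (ha : a ^ q = a) (hε : ε ^ m = -1) :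
    IsGenPair k q m (x - algebraMap k F a)⁻¹
      (algebraMap k F ε * y / (x - algebraMap k F a) ^ 2) := by
  have hq := hE.one_lt
  have hna : (-a) ^ q = -a := by
    have : CharP k p := (algebraMap k F).charP (algebraMap k F).injective p
    rw [hE.neg_pow, ha]
  have := h.mobius hE (α := 0) (β := 1) (γ := 1) (δ := -a) (e := ε)
    (zero_pow (by omega)) (one_pow q) (one_pow q) hna (by simp) (by simp [hε])
  simpa [← sub_eq_add_neg] using this

theorem IsGenPair.inv [Fact p.Prime] [CharP F p] (hE : ExponentData p n q m)
    (h : IsGenPair k q m x y) {ε : k} (hε : ε ^ m = -1) :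
    IsGenPair k q m x⁻¹ (algebraMap k F ε * y / x ^ 2) := by
  have := h.inv_sub hE (a := 0) (zero_pow (by have := hE.one_lt; omega)) hε
  simpa using this

/-- A valuation ring over `k` at which `x` has a pole. -/
structure IsAtInfty (k : Type*) {F : Type*} [Field k] [Field F] [Algebra k F]
    (O : ValuationSubring F) (x : F) : Prop where
  algebraMap_mem : ∀ c : k, algebraMap k F c ∈ O
  notMem : x ∉ O

theorem exists_pow_eq_neg_one [IsAlgClosed k] (hE : ExponentData p n q m) :
    ∃ ε : k, ε ^ m = -1 :=
  IsAlgClosed.exists_pow_nat_eq _ (by have := hE.three_le; omega)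

theorem IsAtInfty.isCentered [Fact p.Prime] [CharP F p] (hE : ExponentData p n q m)
    (h : IsGenPair k q m x y) (hO : IsAtInfty k O x) {ε : k} (hε : ε ^ m = -1) :
    IsCentered O x⁻¹ (algebraMap k F ε * y / x ^ 2) (0 : k) 0 := by
  have hm : m ≠ 0 := by have := hE.three_le; omega
  have h1 : O.valuation x⁻¹ < 1 := by
    have := hO.notMem
    rw [← O.valuation_le_one_iff, not_le] at this
    rw [map_inv₀]
    exact inv_lt_one_of_one_lt₀ this
  refine ⟨hO.algebraMap_mem, by simpa using h1, ?_⟩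
  have h2 := (h.inv hE hε).pow_eq
  have h3 : O.valuation ((algebraMap k F ε * y / x ^ 2) ^ m) < 1 := by
    rw [h2]
    refine O.valuation.map_sub_lt ?_ h1
    rw [map_pow]
    exact pow_lt_one₀ zero_le h1 (by have := hE.one_lt; omega)
  rw [map_pow] at h3
  rw [map_zero, sub_zero]
  exact (pow_lt_one_iff hm).1 h3

theorem IsAtInfty.unique [IsAlgClosed k] [CharP k p] [Fact p.Prime] [CharP F p]
    (hE : ExponentData p n q m) (h : IsGenPair k q m x y) {O₁ O₂ : ValuationSubring F}
    (h₁ : IsAtInfty k O₁ x) (h₂ : IsAtInfty k O₂ x) : O₁ = O₂ := by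
  obtain ⟨ε, hε⟩ := exists_pow_eq_neg_one (k := k) hE
  exact (h₁.isCentered hE h hε).unique hE (h.inv hE hε) (h₂.isCentered hE h hε)

theorem IsGenPair.exists_isAtInfty (h : IsGenPair k q m x y) :
    ∃ O : ValuationSubring F, IsAtInfty k O x := by
  obtain ⟨O, hk, hO⟩ := exists_valuationSubring_notMem (k := k) (t := x)
    fun hi => h.transcendental hi.isAlgebraic
  exact ⟨O, hk, hO⟩

/-- The pole orders of `x` and `y` at infinity in terms of the local parameter `y / x ^ 2`. -/
theorem IsAtInfty.valuation_eq [IsAlgClosed k] [CharP k p] [Fact p.Prime] [CharP F p]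
    (hE : ExponentData p n q m) (h : IsGenPair k q m x y) (hO : IsAtInfty k O x) :
    O.valuation (y / x ^ 2) < 1 ∧ O.valuation x * O.valuation (y / x ^ 2) ^ m = 1 ∧
      O.valuation y * O.valuation (y / x ^ 2) ^ q = 1 ∧
      ∀ f, O.valuation f < 1 → O.valuation f ≤ O.valuation (y / x ^ 2) := by
  obtain ⟨ε, hε⟩ := exists_pow_eq_neg_one (k := k) hE
  have hm : m ≠ 0 := by have := hE.three_le; omega
  have hε0 : ε ≠ 0 := by rintro rfl; simp [hm] at hε
  have hc := hO.isCentered hE h hε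
  have hv : O.valuation (algebraMap k F ε * y / x ^ 2) = O.valuation (y / x ^ 2) := by
    rw [mul_div_assoc, map_mul, ValuationSubring.valuation_algebraMap_eq_one hO.algebraMap_mem hε0,
      one_mul]
  have h1 := hc.y_lt
  have h2 := hc.valuation_sub_eq hE (h.inv hE hε)
  have h3 := fun f => hc.valuation_le hE (h.inv hE hε) (f := f)
  rw [if_pos rfl] at h2
  simp only [map_zero, sub_zero, hv] at h1 h2 h3
  have hx0 : x ≠ 0 := by simpa using h.sub_ne_zero 0
  have hvx : O.valuation x ≠ 0 := by simpa using hx0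
  have h4 : O.valuation x * O.valuation (y / x ^ 2) ^ m = 1 := by
    rw [← h2, map_inv₀, mul_inv_cancel₀ hvx]
  refine ⟨h1, h4, ?_, h3⟩
  have h5 : O.valuation y = O.valuation (y / x ^ 2) * O.valuation x ^ 2 := by
    rw [← map_pow, ← map_mul, div_mul_cancel₀ _ (pow_ne_zero 2 hx0)]
  calc O.valuation y * O.valuation (y / x ^ 2) ^ q
      = (O.valuation x * O.valuation (y / x ^ 2) ^ m) ^ 2 := by
        rw [h5, mul_pow, ← pow_mul, mul_comm m 2, hE.two_mul,
          pow_succ (O.valuation (y / x ^ 2)) q]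
        ac_rfl
    _ = 1 := by rw [h4, one_pow]

/-- The regular functions on the affine curve. -/
def IsFinite (k : Type*) {F : Type*} [Field k] [Field F] [Algebra k F] (x f : F) : Prop :=
  ∀ O : ValuationSubring F, (∀ c : k, algebraMap k F c ∈ O) → x ∈ O → f ∈ O

theorem IsGenPair.exists_aeval_eq [IsAlgClosed k] [CharP k p] [Fact p.Prime] [CharP F p]
    (hE : ExponentData p n q m) (h : IsGenPair k q m x y) {c : F} (hc : c ∈ k⟮x⟯) {j : ℕ}
    (hj : j < m) (hf : IsFinite k x (c * y ^ j)) : ∃ P : k[X], c = aeval x P := by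
  have main (d : ℕ) : ∀ r s : k[X], s ≠ 0 → s.natDegree = d → aeval x s * c = aeval x r →
      ∃ P : k[X], c = aeval x P := by
    induction d with
    | zero =>
      intro r s hs hd hrs
      obtain ⟨t, rfl⟩ := natDegree_eq_zero.1 hd
      have ht : t ≠ 0 := by rintro rfl; simp at hs
      refine ⟨C t⁻¹ * r, ?_⟩
      rw [map_mul, ← hrs, aeval_C, aeval_C, ← mul_assoc, ← map_mul, inv_mul_cancel₀ ht, map_one,
        one_mul]
    | succ d ih =>
      intro r s hs hd hrs
      obtain ⟨a, ha⟩ := IsAlgClosed.exists_root s (by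
        rw [degree_eq_natDegree hs, hd]
        exact_mod_cast Nat.succ_ne_zero d)
      obtain ⟨s', rfl⟩ := dvd_iff_isRoot.2 ha
      have hs' : s' ≠ 0 := right_ne_zero_of_mul hs
      rw [natDegree_mul (X_sub_C_ne_zero a) hs', natDegree_X_sub_C] at hd
      have hxa : x - algebraMap k F a ≠ 0 := h.sub_ne_zero a
      by_cases hr : r.IsRoot a
      · obtain ⟨r', rfl⟩ := dvd_iff_isRoot.2 hr
        refine ih r' s' hs' (by omega) ?_
        simp only [map_mul, map_sub, aeval_X, aeval_C, mul_assoc] at hrs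
        exact mul_left_cancel₀ hxa hrs
      · exfalso
        obtain ⟨O, b, hO⟩ := h.exists_isCentered_of_point hE a
        have h1 := hO.valuation_aeval_eq_one hr
        have h2 := (O.valuation_le_one_iff _).2 (hf O hO.algebraMap_mem hO.x_mem)
        have h3 : O.valuation (aeval x ((X - C a) * s')) ≤ O.valuation (x - algebraMap k F a) := by
          rw [map_mul, map_mul, map_sub, aeval_X, aeval_C]
          exact mul_le_of_le_one_right' ((O.valuation_le_one_iff _).2
            (ValuationSubring.aeval_mem hO.algebraMap_mem hO.x_mem s'))
        have h4 : O.valuation (y ^ j) ≤ O.valuation (x - algebraMap k F a) := by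
          calc O.valuation (y ^ j)
              = O.valuation (aeval x ((X - C a) * s')) * O.valuation (c * y ^ j) := by
                rw [← map_mul, ← mul_assoc, hrs, map_mul, h1, one_mul]
            _ ≤ O.valuation (aeval x ((X - C a) * s')) := mul_le_of_le_one_right' h2
            _ ≤ _ := h3
        have hlt := hO.x_lt
        rw [hO.valuation_sub_eq hE h] at h4 hlt
        have hη : O.valuation (y - algebraMap k F b) ≠ 0 := by simpa using h.y_sub_ne_zero hE b
        by_cases hb : b = 0
        · subst hb
          rw [if_pos rfl] at h4
          have hy := hO.y_lt
          simp only [map_zero, sub_zero, map_pow] at h4 hy hη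
          exact absurd h4 (not_le.2 (pow_lt_pow_right_of_lt_one₀ (zero_lt_iff.2 hη) hy hj))
        · have hy := ValuationSubring.valuation_eq_one_of_sub_lt hO.algebraMap_mem hb hO.y_lt
          rw [map_pow, hy, one_pow] at h4
          exact absurd h4 (not_le.2 hlt)
  obtain ⟨r, s, hrs⟩ := (mem_adjoin_simple_iff k c).1 hc
  by_cases hs : s = 0
  · exact ⟨0, by simp [hrs, hs]⟩
  · refine main _ r s hs rfl ?_
    rw [hrs, mul_div_cancel₀]
    exact fun h0 => hs (transcendental_iff.1 h.transcendental _ h0)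

/-- Regular functions of bounded pole order at infinity. -/
theorem IsGenPair.exists_sum_of_isFinite [IsAlgClosed k] [CharP k p] [Fact p.Prime] [CharP F p]
    (hE : ExponentData p n q m) (h : IsGenPair k q m x y) (hO : IsAtInfty k O x) {f : F}
    (hf : IsFinite k x f) {r : ℕ} (hfr : f / x ^ r ∈ O) :
    ∃ P : ℕ → k[X], f = ∑ j ∈ Finset.range m, aeval x (P j) * y ^ j ∧
      ∀ j < m, P j ≠ 0 → m * (P j).natDegree + q * j ≤ m * r := by
  obtain ⟨c, hc, hfc⟩ := h.exists_coeffs hE f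
  have hcomap (ρ : F ≃ₐ[k] F) (hρ : ρ x = x) : O.comap (ρ : F →+* F) = O := by
    refine IsAtInfty.unique (k := k) hE h ⟨fun c => ?_, ?_⟩ hO
    · rw [ValuationSubring.mem_comap]
      simpa using hO.algebraMap_mem c
    · rw [ValuationSubring.mem_comap]
      simpa [hρ] using hO.notMem
  let M : Submodule k F :=
    { carrier := {f | IsFinite k x f ∧ f / x ^ r ∈ O}
      zero_mem' := ⟨fun O _ _ => zero_mem O, by rw [zero_div]; exact zero_mem O⟩
      add_mem' := fun {f g} hf hg => ⟨fun O h1 h2 => add_mem (hf.1 O h1 h2) (hg.1 O h1 h2), by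
        rw [add_div]; exact add_mem hf.2 hg.2⟩
      smul_mem' := fun c f hf => ⟨fun O h1 h2 => by
        rw [Algebra.smul_def]; exact mul_mem (h1 c) (hf.1 O h1 h2), by
        rw [Algebra.smul_def, mul_div_assoc]; exact mul_mem (hO.algebraMap_mem c) hf.2⟩ }
  have hM : ∀ (ρ : F ≃ₐ[k] F) (ζ : k), ρ x = x → ζ ^ m = 1 → ρ y = algebraMap k F ζ * y →
      ∀ f ∈ M, ρ f ∈ M := by
    rintro ρ ζ hρ - - f ⟨h1, h2⟩
    refine ⟨fun O' hk hxO' => ?_, ?_⟩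
    · refine h1 (O'.comap (ρ : F →+* F)) (fun c => ?_) ?_
      · rw [ValuationSubring.mem_comap]
        simpa using hk c
      · rw [ValuationSubring.mem_comap]
        simpa [hρ] using hxO'
    · rw [← hcomap ρ hρ, ValuationSubring.mem_comap] at h2
      simpa [hρ] using h2
  have hterm (j : ℕ) (hj : j < m) : c j * y ^ j ∈ M :=
    h.term_mem_of_sum_mem hE M hM c hc (by rw [← hfc]; exact ⟨hf, hfr⟩) hj
  have hP (j : ℕ) : ∃ P : k[X], j < m → c j = aeval x P := by
    by_cases hj : j < m
    · obtain ⟨P, hP⟩ := h.exists_aeval_eq hE (hc j) hj (hterm j hj).1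
      exact ⟨P, fun _ => hP⟩
    · exact ⟨0, fun h' => absurd h' hj⟩
  choose P hP using hP
  refine ⟨P, ?_, fun j hj hPj => ?_⟩
  · rw [hfc]
    exact Finset.sum_congr rfl fun j hj => by rw [hP j (Finset.mem_range.1 hj)]
  · obtain ⟨hT, hxT, hyT, -⟩ := hO.valuation_eq hE h
    have h1 := (O.valuation_le_one_iff _).2 (hterm j hj).2
    have hx1 : 1 < O.valuation x := by
      rw [← not_le, O.valuation_le_one_iff]
      exact hO.notMem
    have : O.valuation.IsTrivialOn k :=
      ⟨fun a ha => ValuationSubring.valuation_algebraMap_eq_one hO.algebraMap_mem ha⟩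
    rw [hP j hj, map_div₀, map_mul, map_pow, map_pow,
      valuation_aeval_eq_valuation_X_pow_natDegree_of_one_lt_valuation_X _ hx1 hPj] at h1
    set T := O.valuation (y / x ^ 2)
    have hT0 : 0 < T := by
      rw [zero_lt_iff]
      rintro h0
      rw [h0, zero_pow (by omega), mul_zero] at hxT
      exact zero_ne_one hxT
    have h2 := (div_le_one₀ (pow_pos (zero_lt_one.trans hx1) r)).1 h1
    have h3 : T ^ (m * r) ≤ T ^ (m * (P j).natDegree + q * j) := by
      calc T ^ (m * r) = (O.valuation x ^ (P j).natDegree * O.valuation y ^ j) *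
            T ^ (m * (P j).natDegree + q * j) * T ^ (m * r) := by
            have : (O.valuation x ^ (P j).natDegree * O.valuation y ^ j) *
              T ^ (m * (P j).natDegree + q * j) = (O.valuation x * T ^ m) ^ (P j).natDegree *
                (O.valuation y * T ^ q) ^ j := by
              rw [pow_add, pow_mul, pow_mul, mul_pow, mul_pow]
              ac_rfl
            rw [this, hxT, hyT, one_pow, one_pow, one_mul, one_mul]
        _ ≤ O.valuation x ^ r * T ^ (m * (P j).natDegree + q * j) * T ^ (m * r) := by gcongr
        _ = (O.valuation x * T ^ m) ^ r * T ^ (m * (P j).natDegree + q * j) := by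
            rw [mul_pow, ← pow_mul]
            exact mul_right_comm _ _ _
        _ = _ := by rw [hxT, one_pow, one_mul]
    exact (pow_le_pow_iff_right_of_lt_one₀ hT0 hT).1 h3

theorem IsGenPair.exists_linear [IsAlgClosed k] [CharP k p] [Fact p.Prime] [CharP F p]
    (hE : ExponentData p n q m) (h : IsGenPair k q m x y) (hO : IsAtInfty k O x) {f : F}
    (hf : IsFinite k x f) (hfr : f / x ∈ O) :
    ∃ α β : k, f = algebraMap k F α * x + algebraMap k F β := by
  have h3 := hE.three_le
  have h2 := hE.two_mul
  obtain ⟨P, hfP, hP⟩ := h.exists_sum_of_isFinite hE hO hf (r := 1) (by rwa [pow_one])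
  have h0 (j : ℕ) (hj : j < m) (hj0 : j ≠ 0) : P j = 0 := by
    by_contra hc
    have h4 := hP j hj hc
    have : 1 ≤ j := by omega
    nlinarith
  have hd : (P 0).natDegree ≤ 1 := by
    by_cases hP0 : P 0 = 0
    · simp [hP0]
    · have := hP 0 (by omega) hP0
      nlinarith
  refine ⟨(P 0).coeff 1, (P 0).coeff 0, ?_⟩
  rw [hfP, Finset.sum_eq_single_of_mem 0 (Finset.mem_range.2 (by omega)), pow_zero, mul_one]
  · conv_lhs => rw [eq_X_add_C_of_natDegree_le_one hd]
    simp
  · intro j hj hj0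
    rw [h0 j (Finset.mem_range.1 hj) hj0, map_zero, zero_mul]

theorem IsGenPair.exists_quadratic [IsAlgClosed k] [CharP k p] [Fact p.Prime] [CharP F p]
    (hE : ExponentData p n q m) (h : IsGenPair k q m x y) (hO : IsAtInfty k O x) {f : F}
    (hf : IsFinite k x f) (hfr : f / x ^ 2 ∈ O) :
    ∃ (P : k[X]) (e : k), P.natDegree ≤ 2 ∧ f = aeval x P + algebraMap k F e * y := by
  have h3 := hE.three_le
  have h2 := hE.two_mul
  obtain ⟨P, hfP, hP⟩ := h.exists_sum_of_isFinite hE hO hf hfr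
  have h0 (j : ℕ) (hj : j < m) (hj0 : 2 ≤ j) : P j = 0 := by
    by_contra hc
    have h4 := hP j hj hc
    nlinarith
  have hd : (P 0).natDegree ≤ 2 := by
    by_cases hP0 : P 0 = 0
    · simp [hP0]
    · have := hP 0 (by omega) hP0
      nlinarith
  have hd1 : (P 1).natDegree = 0 := by
    by_cases hP0 : P 1 = 0
    · simp [hP0]
    · have := hP 1 (by omega) hP0
      by_contra hc
      have : 1 ≤ (P 1).natDegree := by omega
      nlinarith
  obtain ⟨e, he⟩ := natDegree_eq_zero.1 hd1
  refine ⟨P 0, e, hd, ?_⟩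
  rw [hfP, ← Finset.sum_subset (s₁ := Finset.range 2) (fun j hj => by
    rw [Finset.mem_range] at hj ⊢; omega), Finset.sum_range_succ, Finset.sum_range_one, ← he]
  · simp
  · intro j hj hj0
    rw [h0 j (Finset.mem_range.1 hj) (by rw [Finset.mem_range] at hj0; omega), map_zero,
      zero_mul]

end

section
variable {p n q m : ℕ} {k F : Type*} [Field k] [Field F] [Algebra k F]
variable {x y z s : F} {O : ValuationSubring F}

theorem IsGenPair.mem_of_mem (hE : ExponentData p n q m) (h : IsGenPair k q m x y)
    (hx : x ∈ O) : y ∈ O := by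
  refine ValuationSubring.mem_of_pow_mem (n := m) (by have := hE.three_le; omega) ?_
  rw [h.pow_eq]
  exact sub_mem (pow_mem hx q) hx

theorem IsGenPair.notMem_adjoin_simple [IsAlgClosed k] [CharP k p] (hE : ExponentData p n q m)
    (h : IsGenPair k q m x y) : y ∉ k⟮x⟯ := by
  intro hy
  obtain ⟨ζ, hζ⟩ := exists_isPrimitiveRoot (k := k) hE
  obtain ⟨ρ, hρx, hρy⟩ := h.exists_rotation hE hζ.pow_eq_one
  rw [ρ.apply_eq_of_mem_adjoin hρx hy] at hρy
  have h1 : algebraMap k F ζ = 1 := by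
    have := mul_right_cancel₀ (h.ne_zero hE) ((one_mul y).trans hρy)
    exact this.symm
  rw [map_eq_one_iff _ (algebraMap k F).injective] at h1
  have h2 := hζ.eq_orderOf
  rw [h1, orderOf_one] at h2
  have := hE.three_le
  omega

/-- Two generating pairs with the same place at infinity. -/
theorem IsGenPair.eq_of_isAtInfty [IsAlgClosed k] [CharP k p] [Fact p.Prime] [CharP F p]
    (hE : ExponentData p n q m) (h : IsGenPair k q m x y) (h' : IsGenPair k q m z s)
    (hO : IsAtInfty k O x) (hO' : IsAtInfty k O z) :
    ∃ α β e : k, α ≠ 0 ∧ α ^ q = α ∧ β ^ q = β ∧ e ^ m = α ∧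
      z = algebraMap k F α * x + algebraMap k F β ∧ s = algebraMap k F e * y := by
  have h3 := hE.three_le
  have h2m := hE.two_mul
  have hq := hE.one_lt
  obtain ⟨hT, hxT, hyT, hle⟩ := hO.valuation_eq hE h
  obtain ⟨hT', hzT, hsT, hle'⟩ := hO'.valuation_eq hE h'
  have hTT : O.valuation (s / z ^ 2) = O.valuation (y / x ^ 2) := le_antisymm (hle _ hT') (hle' _ hT)
  rw [hTT] at hzT hsT
  have hz0 : z ≠ 0 := by simpa using h'.sub_ne_zero 0
  have hx0 : x ≠ 0 := by simpa using h.sub_ne_zero 0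
  have hvzx : O.valuation z = O.valuation x := by
    have h0 : O.valuation (y / x ^ 2) ^ m ≠ 0 := right_ne_zero_of_mul_eq_one hxT
    exact mul_right_cancel₀ h0 (hzT.trans hxT.symm)
  have hvsy : O.valuation s = O.valuation y := by
    have h0 : O.valuation (y / x ^ 2) ^ q ≠ 0 := right_ne_zero_of_mul_eq_one hyT
    exact mul_right_cancel₀ h0 (hsT.trans hyT.symm)
  have hzf : IsFinite k x z := by
    intro O' hk hx
    by_contra hz
    have := IsAtInfty.unique hE h' ⟨hk, hz⟩ hO'
    rw [this] at hx
    exact hO.notMem hx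
  have hsf : IsFinite k x s := fun O' hk hx => h'.mem_of_mem hE (hzf O' hk hx)
  obtain ⟨α, β, hz⟩ := h.exists_linear hE hO hzf (by
    rw [← O.valuation_le_one_iff, map_div₀, hvzx, div_self (by simpa using hx0)])
  obtain ⟨Q, e, hQ, hs⟩ := h.exists_quadratic hE hO hsf (by
    rw [← O.valuation_le_one_iff, map_div₀, hvsy, ← map_div₀]
    exact hT.le)
  have hα : α ≠ 0 := by
    rintro rfl
    apply h'.transcendental
    rw [hz, map_zero, zero_mul, zero_add]
    exact isAlgebraic_algebraMap β
  have hc (c : k) : algebraMap k F c ∈ k⟮x⟯ := IntermediateField.algebraMap_mem _ c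
  have he : e ≠ 0 := by
    rintro rfl
    apply h.notMem_adjoin_simple hE
    have h1 : adjoin k {z, s} ≤ k⟮x⟯ := by
      rw [adjoin_le_iff]
      rintro w (rfl | rfl)
      · rw [hz]
        exact add_mem (mul_mem (hc _) (mem_adjoin_simple_self k x)) (hc _)
      · rw [hs, map_zero, zero_mul, add_zero]
        exact aeval_mem_adjoin_simple x Q
    rw [h'.adjoin_eq] at h1
    exact h1 (by trivial)
  let R : k[X] := C (e ^ m) * (X ^ q - X) - ((C α * X + C β) ^ q - (C α * X + C β))
  let P : ℕ → k[X] := fun j => C (e ^ j * (m.choose j : k)) * Q ^ (m - j) + if j = 0 then R else 0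
  have hsum : ∑ j ∈ Finset.range m, aeval x (P j) * y ^ j = 0 := by
    have h1 : s ^ m = ∑ j ∈ Finset.range (m + 1),
        aeval x (C (e ^ j * (m.choose j : k)) * Q ^ (m - j)) * y ^ j := by
      rw [hs, add_comm, add_pow]
      refine Finset.sum_congr rfl fun j _ => ?_
      simp only [map_mul, map_pow, aeval_C, map_natCast]
      ring
    rw [Finset.sum_range_succ, Nat.choose_self, Nat.sub_self, pow_zero, mul_one, Nat.cast_one,
      mul_one, aeval_C, h'.pow_eq, h.pow_eq, hz] at h1
    simp only [P, map_add, add_mul, Finset.sum_add_distrib]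
    rw [Finset.sum_eq_single_of_mem (f := fun j => aeval x (if j = 0 then R else 0) * y ^ j) 0
      (Finset.mem_range.2 (by omega)) (fun j _ hj => by rw [if_neg hj, map_zero, zero_mul])]
    simp only [if_pos, pow_zero, mul_one, R, map_sub, map_mul, map_pow, map_add, aeval_C, aeval_X]
    simp only [map_mul, map_pow, aeval_C, map_natCast] at h1 ⊢
    linear_combination -h1
  have hP (j : ℕ) (hj : j < m) : P j = 0 := h.term_eq_zero_of_sum hE P hsum hj
  have hQ0 : Q = 0 := by
    have h1 := hP (m - 1) (by omega)
    simp only [P] at h1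
    rw [if_neg (by omega), add_zero, mul_eq_zero, C_eq_zero, mul_eq_zero,
      or_iff_right (pow_ne_zero _ he), ← Nat.choose_symm (by omega), Nat.sub_sub_self (by omega),
      Nat.choose_one_right, or_iff_right (hE.cast_m_ne_zero k), pow_one] at h1
    exact h1
  have hR : R = 0 := by
    have h1 := hP 0 (by omega)
    simp only [P] at h1
    rwa [if_pos trivial, hQ0, zero_pow (by omega), mul_zero, zero_add] at h1
  have hRe : R = C (e ^ m - α ^ q) * X ^ q - C (e ^ m - α) * X - C (β ^ q - β) := by
    simp only [R]
    rw [hE.add_pow, mul_pow]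
    simp only [map_sub, map_pow]
    ring
  rw [hRe] at hR
  have c0 := congrArg (fun P => coeff P 0) hR
  have c1 := congrArg (fun P => coeff P 1) hR
  have cq := congrArg (fun P => coeff P q) hR
  simp only [coeff_sub, coeff_C_mul, coeff_X_pow, coeff_X, coeff_C, coeff_zero,
    if_neg hq.ne, if_neg (show ¬ q = 0 by omega), if_neg (show ¬ 0 = q by omega)]
    at c0 c1 cq
  simp only [if_true, mul_one, mul_zero, sub_zero, zero_sub, one_ne_zero, if_false, neg_eq_zero,
    sub_eq_zero] at c0 c1 cq
  refine ⟨α, β, e, hα, cq.symm.trans c1, ?_, c1, hz, ?_⟩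
  · simpa using c0
  · rw [hs, hQ0, map_zero, zero_add]

theorem exists_aeval_eq_of_natDegree_le_two {P : k[X]} (hP : P.natDegree ≤ 2) (x : F) :
    aeval x P = algebraMap k F (P.coeff 2) * x ^ 2 + algebraMap k F (P.coeff 1) * x +
      algebraMap k F (P.coeff 0) := by
  conv_lhs => rw [P.as_sum_range_C_mul_X_pow' (n := 3) (by omega)]
  simp [Finset.sum_range_succ]
  ring

/-- The osculating function at an affine point outside the ramification locus. -/
theorem IsGenPair.osculating_eq [CharP k p] [Fact p.Prime] [CharP F p] (hE : ExponentData p n q m)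
    (h : IsGenPair k q m x y) {a b : k} (hab : b ^ m = a ^ q - a) :
    (x - algebraMap k F a) ^ 2 - 2 * algebraMap k F (b ^ m) * (x - algebraMap k F a) -
        algebraMap k F (b ^ q) * (y - algebraMap k F b) =
      (y - algebraMap k F b) ^ q * y -
        (x - algebraMap k F a) ^ q * (2 * (algebraMap k F (a ^ q) - x)) -
        (x - algebraMap k F a) ^ q * (x - algebraMap k F a) ^ q := by
  have h1 : y ^ q * y = (x ^ q - x) ^ 2 := by
    rw [← h.pow_eq, ← pow_mul, ← pow_succ, ← hE.two_mul, mul_comm]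
  have h2 : b ^ q * b = (a ^ q - a) ^ 2 := by
    rw [← hab, ← pow_mul, ← pow_succ, ← hE.two_mul, mul_comm]
  have h3 := congrArg (algebraMap k F) h2
  rw [hE.sub_pow, hE.sub_pow, hab]
  simp only [map_mul, map_sub, map_pow] at h3 ⊢
  linear_combination -h1 + h3

theorem valuation_pow_mul_le {f g : F} {t : O.ValueGroup} {i : ℕ} (hf : O.valuation f ≤ t)
    (hg : g ∈ O) : O.valuation (f ^ i * g) ≤ t ^ i := by
  rw [map_mul, map_pow]
  exact (mul_le_of_le_one_right' ((O.valuation_le_one_iff _).2 hg)).trans (pow_le_pow_left₀ zero_le hf i)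

/-- The pole of the first function of a generating pair is not an affine point
outside the ramification locus. -/
theorem IsGenPair.eq_zero_of_isAtInfty [IsAlgClosed k] [CharP k p] [Fact p.Prime] [CharP F p]
    (hE : ExponentData p n q m) (h : IsGenPair k q m x y) (h' : IsGenPair k q m z s)
    (hO' : IsAtInfty k O z) {a b : k} (hO : IsCentered O x y a b) : b = 0 := by
  by_contra hb
  have h3 := hE.three_le
  have h2m := hE.two_mul
  have hq := hE.one_lt
  have hk := hO.algebraMap_mem
  have hab := hO.pow_eq h
  have hbF : algebraMap k F b ≠ 0 := by simpa using hb
  set ξ := x - algebraMap k F a with hξ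
  set η := y - algebraMap k F b with hη
  set T := O.valuation η with hT
  have hT0 : T ≠ 0 := by simpa [hT] using h.y_sub_ne_zero hE b
  have hT1 : T < 1 := hO.y_lt
  have hξT : O.valuation ξ = T := by
    have := hO.valuation_sub_eq hE h
    rwa [if_neg hb, pow_one] at this
  have hpow {i j : ℕ} (hij : i < j) : T ^ j < T ^ i :=
    pow_lt_pow_right_of_lt_one₀ (zero_lt_iff.2 hT0) hT1 hij
  have hunif {c d : F} {a' b' : k} (hcd : IsGenPair k q m c d) (hc : IsCentered O c d a' b') :
      O.valuation (d - algebraMap k F b') = T :=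
    le_antisymm (hO.valuation_le hE h hc.y_lt) (hc.valuation_le hE hcd hT1)
  set f := ξ ^ 2 - 2 * algebraMap k F (b ^ m) * ξ - algebraMap k F (b ^ q) * η with hf
  have h2O : (2 : F) ∈ O := by simp
  have hfT : O.valuation f ≤ T ^ q := by
    rw [hf, hξ, hη, h.osculating_eq hE hab]
    have hxO := hO.x_mem
    refine O.valuation.map_sub_le (O.valuation.map_sub_le ?_ ?_) ?_
    · exact valuation_pow_mul_le le_rfl hO.y_mem
    · exact valuation_pow_mul_le hξT.le (mul_mem h2O (sub_mem (hk _) hxO))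
    · exact valuation_pow_mul_le hξT.le (pow_mem (sub_mem hxO (hk _)) q)
  obtain ⟨hT', hzT, -, hle'⟩ := hO'.valuation_eq hE h'
  have hTT : O.valuation (s / z ^ 2) = T := le_antisymm (hO.valuation_le hE h hT') (hle' _ hT1)
  rw [hTT] at hzT
  have hfz : O.valuation (f * z) ≤ T ^ 2 := by
    rw [map_mul]
    calc O.valuation f * O.valuation z ≤ T ^ q * O.valuation z := by gcongr
      _ = O.valuation z * T ^ m * T ^ (m - 1) := by
        rw [mul_assoc, ← pow_add, mul_comm]
        congr 2
        omega
      _ = T ^ (m - 1) := by rw [hzT, one_mul]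
      _ ≤ T ^ 2 := (pow_le_pow_iff_right_of_lt_one₀ (zero_lt_iff.2 hT0) hT1).2 (by omega)
  have hfO {O' : ValuationSubring F} (hk' : ∀ c : k, algebraMap k F c ∈ O') (hx' : x ∈ O') :
      f ∈ O' := by
    have hy' := h.mem_of_mem hE hx'
    have h2' : (2 : F) ∈ O' := by simp
    exact sub_mem (sub_mem (pow_mem (sub_mem hx' (hk' _)) 2)
      (mul_mem (mul_mem h2' (hk' _)) (sub_mem hx' (hk' _)))) (mul_mem (hk' _) (sub_mem hy' (hk' _)))
  have hfin : IsFinite k x (f * z) := by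
    intro O' hk' hx'
    by_cases hz : z ∈ O'
    · exact mul_mem (hfO hk' hx') hz
    · rw [IsAtInfty.unique hE h' ⟨hk', hz⟩ hO', ← O.valuation_le_one_iff]
      exact hfz.trans (pow_le_one₀ zero_le hT1.le)
  obtain ⟨O', hO'x⟩ := h.exists_isAtInfty
  have hx0 : x ≠ 0 := by simpa using h.sub_ne_zero 0
  have hpole : f * z / x ^ 2 ∈ O' := by
    have hk' := hO'x.algebraMap_mem
    have hz : z ∈ O' := by
      by_contra hz
      have := IsAtInfty.unique hE h' ⟨hk', hz⟩ hO'
      exact hO'x.notMem (this ▸ hO.x_mem)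
    have hxi : x⁻¹ ∈ O' := (O'.mem_or_inv_mem x).resolve_left hO'x.notMem
    have hyi : y / x ^ 2 ∈ O' := (O'.valuation_le_one_iff _).1 (hO'x.valuation_eq hE h).1.le
    have h2' : (2 : F) ∈ O' := by simp
    have he : f * z / x ^ 2 = ((1 - algebraMap k F a * x⁻¹) ^ 2 -
        2 * algebraMap k F (b ^ m) * (x⁻¹ * (1 - algebraMap k F a * x⁻¹)) -
        algebraMap k F (b ^ q) * (y / x ^ 2 - algebraMap k F b * x⁻¹ ^ 2)) * z := by
      rw [hf, hξ, hη]
      field_simp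
    rw [he]
    have h1 : 1 - algebraMap k F a * x⁻¹ ∈ O' := sub_mem (one_mem _) (mul_mem (hk' _) hxi)
    exact mul_mem (sub_mem (sub_mem (pow_mem h1 2) (mul_mem (mul_mem h2' (hk' _)) (mul_mem hxi h1)))
      (mul_mem (hk' _) (sub_mem hyi (mul_mem (hk' _) (pow_mem hxi 2))))) hz
  obtain ⟨P, e, hP, hPe⟩ := h.exists_quadratic hE hO'x hfin hpole
  rw [exists_aeval_eq_of_natDegree_le_two hP] at hPe
  obtain ⟨κ, κ₁, κ₀, l, hexp⟩ : ∃ κ κ₁ κ₀ l : k, f * z = algebraMap k F κ * ξ ^ 2 +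
      algebraMap k F κ₁ * ξ + algebraMap k F κ₀ + algebraMap k F l * f := by
    have hbq : algebraMap k F (b ^ q) ≠ 0 := by simpa using fun h0 => absurd h0 hb
    refine ⟨P.coeff 2 + e / b ^ q, 2 * P.coeff 2 * a + P.coeff 1 - 2 * (e / b ^ q) * b ^ m,
      P.coeff 2 * a ^ 2 + P.coeff 1 * a + P.coeff 0 + e * b, -e / b ^ q, ?_⟩
    rw [hPe, hf, hξ, hη]
    have hd : e / b ^ q * b ^ q = e := div_mul_cancel₀ _ (pow_ne_zero _ hb)
    have hd' : algebraMap k F (e / b ^ q) * algebraMap k F (b ^ q) = algebraMap k F e := by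
      rw [← map_mul, hd]
    rw [neg_div]
    simp only [map_add, map_sub, map_neg, map_mul, map_ofNat, map_pow (algebraMap k F) a] at hd' ⊢
    linear_combination (algebraMap k F b - y) * hd'
  have hξ1 : O.valuation ξ < 1 := hO.x_lt
  have hfl : O.valuation (algebraMap k F l * f) ≤ T ^ 2 := by
    rw [map_mul]
    calc _ ≤ O.valuation f := mul_le_of_le_one_left' ((O.valuation_le_one_iff _).2 (hk l))
      _ ≤ T ^ q := hfT
      _ ≤ T ^ 2 := (pow_le_pow_iff_right_of_lt_one₀ (zero_lt_iff.2 hT0) hT1).2 (by omega)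
  have hκξ : O.valuation (algebraMap k F κ * ξ ^ 2) ≤ T ^ 2 := by
    rw [mul_comm]
    exact valuation_pow_mul_le hξT.le (hk κ)
  have hlin : O.valuation (algebraMap k F κ₁ * ξ + algebraMap k F κ₀) ≤ T ^ 2 := by
    have : algebraMap k F κ₁ * ξ + algebraMap k F κ₀ =
        f * z - algebraMap k F κ * ξ ^ 2 - algebraMap k F l * f := by
      rw [hexp]
      ring
    rw [this]
    exact O.valuation.map_sub_le (O.valuation.map_sub_le hfz hκξ) hfl
  have hT21 : T ^ 2 < 1 := pow_lt_one₀ zero_le hT1 two_ne_zero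
  have hκ₀ : κ₀ = 0 := by
    by_contra h0
    have h1 := ValuationSubring.valuation_eq_one_of_sub_lt hk h0
      (f := algebraMap k F κ₁ * ξ + algebraMap k F κ₀) (by
        rw [add_sub_cancel_right, mul_comm, map_mul]
        exact mul_lt_one_of_lt_of_le hξ1 ((O.valuation_le_one_iff _).2 (hk κ₁)))
    rw [h1] at hlin
    exact absurd hlin (not_le.2 hT21)
  have hκ₁ : κ₁ = 0 := by
    by_contra h0
    rw [hκ₀, map_zero, add_zero, map_mul, ValuationSubring.valuation_algebraMap_eq_one hk h0,
      one_mul, hξT] at hlin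
    have := hpow (i := 1) (j := 2) (by norm_num)
    rw [pow_one] at this
    exact absurd hlin (not_le.2 this)
  rw [hκ₀, hκ₁, map_zero, zero_mul, add_zero, add_zero] at hexp
  have hfz' : f * (z - algebraMap k F l) = algebraMap k F κ * ξ ^ 2 := by
    linear_combination hexp
  have hf0 : f ≠ 0 := by
    intro h0
    apply h.notMem_adjoin_simple hE
    have hc (c : k) : algebraMap k F c ∈ k⟮x⟯ := IntermediateField.algebraMap_mem _ c
    have hξm : ξ ∈ k⟮x⟯ := sub_mem (mem_adjoin_simple_self k x) (hc a)
    have hbq : algebraMap k F (b ^ q) ≠ 0 := by simpa using fun h0 => absurd h0 hb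
    have hy : y = (ξ ^ 2 - algebraMap k F (2 * b ^ m) * ξ) / algebraMap k F (b ^ q) +
        algebraMap k F b := by
      rw [← sub_eq_iff_eq_add, eq_div_iff hbq, map_mul, map_ofNat]
      rw [hf] at h0
      linear_combination -h0
    rw [hy]
    exact add_mem (div_mem (sub_mem (pow_mem hξm 2) (mul_mem (hc _) hξm)) (hc _)) (hc _)
  have hκ : κ ≠ 0 := by
    rintro rfl
    rw [map_zero, zero_mul, mul_eq_zero, or_iff_right hf0] at hfz'
    exact h'.sub_ne_zero l hfz'
  obtain ⟨ζ, hζ⟩ := exists_isPrimitiveRoot (k := k) hE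
  obtain ⟨ρ, hρx, hρy⟩ := h.exists_rotation hE hζ.pow_eq_one
  have hζ1 : ζ ≠ 1 := hζ.ne_one (by omega)
  have hρξ : ρ ξ = ξ := by rw [hξ, map_sub, hρx, ρ.commutes]
  have hρf : ρ f = ξ ^ 2 - 2 * algebraMap k F (b ^ m) * ξ -
      algebraMap k F (b ^ q) * (algebraMap k F ζ * y - algebraMap k F b) := by
    rw [hf]
    simp only [map_sub, map_mul, hρξ, AlgEquiv.commutes, map_pow ρ, map_ofNat]
    rw [hη, map_sub, hρy, ρ.commutes]
  have hρf1 : O.valuation (ρ f) = 1 := by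
    refine ValuationSubring.valuation_eq_one_of_sub_lt hk
      (c := -(b ^ q * ((ζ - 1) * b))) ?_ ?_
    · exact neg_ne_zero.2 (mul_ne_zero (pow_ne_zero _ hb) (mul_ne_zero (_root_.sub_ne_zero.2 hζ1) hb))
    · have : ρ f - algebraMap k F (-(b ^ q * ((ζ - 1) * b))) =
          ξ * (ξ - 2 * algebraMap k F (b ^ m)) - η * (algebraMap k F (b ^ q) * algebraMap k F ζ) := by
        rw [hρf, hη]
        simp only [map_neg, map_mul, map_sub, map_one]
        ring
      rw [this]
      have hξO : ξ ∈ O := (O.valuation_le_one_iff _).1 hξ1.le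
      refine O.valuation.map_sub_lt ?_ ?_ <;> rw [map_mul]
      · exact mul_lt_one_of_lt_of_le hξ1 ((O.valuation_le_one_iff _).2
          (sub_mem hξO (mul_mem h2O (hk _))))
      · exact mul_lt_one_of_lt_of_le hT1 ((O.valuation_le_one_iff _).2 (mul_mem (hk _) (hk _)))
  have hρz : O.valuation (ρ z - algebraMap k F l) = T ^ 2 := by
    have h1 := congrArg (fun t => O.valuation (ρ t)) hfz'
    simp only [map_mul, map_pow, map_sub, AlgEquiv.commutes, hρf1, one_mul, hρξ, hξT,
      ValuationSubring.valuation_algebraMap_eq_one hk hκ] at h1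
    exact h1
  have hρzO : ρ z ∈ O := by
    have := add_mem ((O.valuation_le_one_iff _).1 (hρz.trans_le hT21.le)) (hk l)
    rwa [sub_add_cancel] at this
  obtain ⟨a', b', hc⟩ := (h'.map ρ).exists_isCentered hE hk (by
    rintro rfl
    exact hO'.notMem trivial) hρzO
  obtain rfl : l = a' := ValuationSubring.eq_of_sub_lt hk (hρz.trans_lt hT21) hc.x_lt
  have h5 := hc.valuation_sub_eq hE (h'.map ρ)
  rw [hunif (h'.map ρ) hc, hρz] at h5
  split_ifs at h5
  · exact (hpow (i := 2) (j := m) (by omega)).ne' h5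
  · exact (hpow (i := 1) (j := 2) (by omega)).ne h5

/-- Any two generating pairs differ by an element of `GL₂(𝔽_q)`. -/
theorem IsGenPair.exists_mobius [IsAlgClosed k] [CharP k p] [Fact p.Prime] [CharP F p]
    (hE : ExponentData p n q m) (h : IsGenPair k q m x y) (h' : IsGenPair k q m z s) :
    ∃ α β γ δ e : k, α ^ q = α ∧ β ^ q = β ∧ γ ^ q = γ ∧ δ ^ q = δ ∧ α * δ - β * γ ≠ 0 ∧
      e ^ m = α * δ - β * γ ∧
      z = (algebraMap k F α * x + algebraMap k F β) / (algebraMap k F γ * x + algebraMap k F δ) ∧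
      s = algebraMap k F e * y / (algebraMap k F γ * x + algebraMap k F δ) ^ 2 := by
  have hq := hE.one_lt
  obtain ⟨O, hO⟩ := h'.exists_isAtInfty
  by_cases hx : x ∈ O
  · obtain ⟨a, b, hc⟩ := h.exists_isCentered hE hO.algebraMap_mem (by
      rintro rfl
      exact hO.notMem trivial) hx
    have hb := h.eq_zero_of_isAtInfty hE h' hO hc
    have ha : a ^ q = a := by
      have := hc.pow_eq h
      rw [hb, zero_pow (by have := hE.three_le; omega)] at this
      exact (sub_eq_zero.1 this.symm)
    obtain ⟨ε, hε⟩ := exists_pow_eq_neg_one (k := k) hE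
    have hX := h.inv_sub hE ha hε
    have hxa := h.sub_ne_zero a
    have hXO : IsAtInfty k O (x - algebraMap k F a)⁻¹ := by
      refine ⟨hO.algebraMap_mem, fun hmem => ?_⟩
      have h1 := (O.valuation_le_one_iff _).2 hmem
      rw [map_inv₀] at h1
      exact absurd h1 (not_le.2 ((one_lt_inv₀ (zero_lt_iff.2 (by simpa using hxa))).2 hc.x_lt))
    obtain ⟨α, β, e, hα, hαq, hβq, he, hz, hs⟩ := hX.eq_of_isAtInfty hE h' hXO hO
    refine ⟨β, α - β * a, 1, -a, e * ε, hβq, ?_, one_pow q, ?_, ?_, ?_, ?_, ?_⟩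
    · rw [hE.sub_pow, mul_pow, hαq, hβq, ha]
    · rw [hE.neg_pow, ha]
    · rw [show β * -a - (α - β * a) * 1 = -α by ring]
      exact neg_ne_zero.2 hα
    · rw [mul_pow, he, hε]
      ring
    · rw [hz]
      simp only [map_one, one_mul, map_neg, map_sub, map_mul, ← sub_eq_add_neg]
      field_simp
      ring
    · rw [hs]
      simp only [map_one, one_mul, map_neg, map_mul, ← sub_eq_add_neg]
      field_simp
  · obtain ⟨α, β, e, hα, hαq, hβq, he, hz, hs⟩ :=
      h.eq_of_isAtInfty hE h' ⟨hO.algebraMap_mem, hx⟩ hO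
    refine ⟨α, β, 0, 1, e, hαq, hβq, zero_pow (by omega), one_pow q, by simpa using hα, by simpa using he,
      by simpa using hz, by simpa using hs⟩

end

section
variable {p n q m : ℕ} {k F : Type*} [Field k] [Field F] [Algebra k F]

theorem isGalois_of_forall_root {E : Type*} [Field E] [Algebra E F] {z : F} (hz : E⟮z⟯ = ⊤)
    (f : E[X]) (hf : aeval z f = 0) (hd : aeval z (derivative f) ≠ 0)
    (hs : ∀ t : AlgebraicClosure F, aeval t f = 0 → t ∈ (algebraMap F (AlgebraicClosure F)).range) :
    IsGalois E F := by
  have hf0 : f ≠ 0 := by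
    rintro rfl
    simp at hd
  have hint : IsIntegral E z := isAlgebraic_iff_isIntegral.1 ⟨f, hf0, hf⟩
  obtain ⟨g, hg⟩ := minpoly.dvd E z hf
  have hsep : (minpoly E z).Separable := by
    rw [separable_iff_derivative_ne_zero (minpoly.irreducible hint)]
    intro h0
    apply hd
    rw [hg, derivative_mul, h0, zero_mul, zero_add, map_mul, minpoly.aeval, zero_mul]
  have hsplit : ((minpoly E z).map (algebraMap E F)).Splits := by
    refine Splits.of_splits_map_of_injective (algebraMap F (AlgebraicClosure F)).injective
      (IsAlgClosed.splits _) fun a ha => hs a ?_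
    rw [Polynomial.map_map, ← IsScalarTower.algebraMap_eq] at ha
    have h1 := (mem_roots'.1 ha).2
    rw [IsRoot, eval_map_algebraMap] at h1
    rw [hg, map_mul, h1, zero_mul]
  have : IsSplittingField E F (minpoly E z) := by
    refine ⟨hsplit, ?_⟩
    rw [← top_le_iff]
    have h1 : Algebra.adjoin E {z} = ⊤ := by
      rw [← adjoin_simple_toSubalgebra_of_isAlgebraic hint.isAlgebraic, hz, top_toSubalgebra]
    rw [← h1]
    refine Algebra.adjoin_mono ?_
    rw [Set.singleton_subset_iff, mem_rootSet]
    exact ⟨minpoly.ne_zero hint, minpoly.aeval E z⟩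
  exact IsGalois.of_separable_splitting_field hsep

theorem isGalois_of_aeval_eq_mul (E : IntermediateField k F) {z w : F} (hz : E⟮z⟯ = ⊤) (hw : w ∈ E)
    (P Q : k[X]) (hPQ : aeval z P = w * aeval z Q)
    (hd : aeval z (derivative P) ≠ w * aeval z (derivative Q))
    (hs : ∀ t : AlgebraicClosure F,
      aeval t P = algebraMap F (AlgebraicClosure F) w * aeval t Q →
        t ∈ (algebraMap F (AlgebraicClosure F)).range) :
    IsGalois E F := by
  let w' : E := ⟨w, hw⟩
  have h1 : algebraMap E F w' = w := rfl
  refine isGalois_of_forall_root hz (P.map (algebraMap k E) - C w' * Q.map (algebraMap k E))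
    ?_ ?_ fun t ht => hs t ?_
  · simp only [map_sub, map_mul, aeval_C, aeval_map_algebraMap, h1]
    rw [hPQ, sub_self]
  · simp only [derivative_C_mul, derivative_map, map_sub, map_mul, aeval_C,
      aeval_map_algebraMap, h1]
    exact sub_ne_zero.2 hd
  · simp only [map_sub, map_mul, aeval_C, aeval_map_algebraMap] at ht
    exact sub_eq_zero.1 ht

theorem IsIntegral.mem_range_of_isAlgClosed [IsAlgClosed k] {R : Type*} [CommRing R] [IsDomain R]
    [Algebra k R] {t : R} (ht : IsIntegral k t) : ∃ c : k, t = algebraMap k R c := by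
  obtain ⟨c, hc⟩ := minpoly.mem_range_of_degree_eq_one k t
    (IsAlgClosed.degree_eq_one_of_irreducible k (minpoly.irreducible ht))
  exact ⟨c, hc.symm⟩

theorem exists_algebraMap_eq_of_pow_eq_one [IsAlgClosed k] {R : Type*} [CommRing R] [IsDomain R]
    [Algebra k R] {t : R} {N : ℕ} (hN : 0 < N) (ht : t ^ N = 1) :
    ∃ c : k, t = algebraMap k R c ∧ c ^ N = 1 := by
  have : IsIntegral k t := IsIntegral.of_pow hN (by rw [ht]; exact isIntegral_one)
  obtain ⟨c, hc⟩ := this.mem_range_of_isAlgClosed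
  refine ⟨c, hc, (algebraMap k R).injective ?_⟩
  rw [map_pow, ← hc, ht, map_one]

theorem exists_algebraMap_eq_of_pow_eq_self [IsAlgClosed k] {R : Type*} [CommRing R] [IsDomain R]
    [Algebra k R] {t : R} {N : ℕ} (hN : 1 < N) (ht : t ^ N = t) :
    ∃ c : k, t = algebraMap k R c := by
  by_cases h0 : t = 0
  · exact ⟨0, by simp [h0]⟩
  · obtain ⟨N, rfl⟩ : ∃ M, N = M + 1 := ⟨N - 1, by omega⟩
    rw [pow_succ, mul_eq_right₀ h0] at ht
    obtain ⟨c, hc, -⟩ := exists_algebraMap_eq_of_pow_eq_one (k := k) (by omega) ht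
    exact ⟨c, hc⟩

/-- The function on the curve cut out by a linear form in the coordinates `(x : y : 1 : x²)`. -/
def formEval (x y : F) : (Fin 4 → k) →ₗ[k] F :=
  Fintype.linearCombination k ![x, y, 1, x ^ 2]

theorem formEval_apply (x y : F) (v : Fin 4 → k) :
    formEval x y v = algebraMap k F (v 0) * x + algebraMap k F (v 1) * y + algebraMap k F (v 2) +
      algebraMap k F (v 3) * x ^ 2 := by
  simp [formEval, Fintype.linearCombination_apply, Fin.sum_univ_four, Algebra.smul_def]

theorem IsGenPair.aeval_add_aeval_mul_eq_zero [IsAlgClosed k] [CharP k p]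
    (hE : ExponentData p n q m) {x y : F} (h : IsGenPair k q m x y) {P Q : k[X]}
    (h0 : aeval x P + aeval x Q * y = 0) : P = 0 ∧ Q = 0 := by
  have h3 := hE.three_le
  let R : ℕ → k[X] := fun j => if j = 0 then P else if j = 1 then Q else 0
  have hsum : ∑ j ∈ Finset.range m, aeval x (R j) * y ^ j = 0 := by
    rw [← Finset.sum_subset (Finset.range_mono (show 2 ≤ m by omega))]
    · simpa [Finset.sum_range_succ, R] using h0
    · intro j _ hj
      have : 1 < j := by simpa using hj
      simp [R, show j ≠ 0 by omega, show j ≠ 1 by omega]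
  have hP := h.term_eq_zero_of_sum hE R hsum (j := 0) (by omega)
  have hQ := h.term_eq_zero_of_sum hE R hsum (j := 1) (by omega)
  simp only [R, if_true, one_ne_zero, if_false] at hP hQ
  exact ⟨hP, hQ⟩

theorem coeffs_eq_zero_of_quadratic {A B D : k} (h : C A * X ^ 2 + C B * X + C D = 0) :
    A = 0 ∧ B = 0 ∧ D = 0 := by
  have h0 := congrArg (fun P => coeff P 0) h
  have h1 := congrArg (fun P => coeff P 1) h
  have h2 := congrArg (fun P => coeff P 2) h
  simp [coeff_X, coeff_C] at h0 h1 h2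
  exact ⟨h2, h1, h0⟩

theorem IsGenPair.formEval_injective [IsAlgClosed k] [CharP k p] (hE : ExponentData p n q m)
    {x y : F} (h : IsGenPair k q m x y) : Function.Injective (formEval (k := k) x y) := by
  rw [injective_iff_map_eq_zero]
  intro v hv
  rw [formEval_apply] at hv
  obtain ⟨h1, h2⟩ := h.aeval_add_aeval_mul_eq_zero hE
    (P := C (v 3) * X ^ 2 + C (v 0) * X + C (v 2)) (Q := C (v 1)) (by
      simp only [map_add, map_mul, aeval_C, map_pow, aeval_X]
      linear_combination hv)
  obtain ⟨h3, h0, h2'⟩ := coeffs_eq_zero_of_quadratic h1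
  rw [C_eq_zero] at h2
  ext i
  fin_cases i <;> assumption

theorem adjoin_div_le_of_mem_span {V : Type*} [AddCommGroup V] [Module k V] {φ : V →ₗ[k] F}
    (hφ : Function.Injective φ) {v₀ v₁ w₀ w₁ : V} (hv₁ : v₁ ≠ 0)
    (h₀ : w₀ ∈ Submodule.span k {v₀, v₁}) (h₁ : w₁ ∈ Submodule.span k {v₀, v₁}) :
    k⟮φ w₀ / φ w₁⟯ ≤ k⟮φ v₀ / φ v₁⟯ := by
  obtain ⟨a, b, rfl⟩ := Submodule.mem_span_pair.1 h₀
  obtain ⟨c, d, rfl⟩ := Submodule.mem_span_pair.1 h₁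
  have hne : φ v₁ ≠ 0 := (map_ne_zero_iff φ hφ).2 hv₁
  have hmem (a b : k) : φ (a • v₀ + b • v₁) / φ v₁ ∈ k⟮φ v₀ / φ v₁⟯ := by
    have : φ (a • v₀ + b • v₁) / φ v₁ = algebraMap k F a * (φ v₀ / φ v₁) + algebraMap k F b := by
      rw [map_add, map_smul, map_smul, Algebra.smul_def, Algebra.smul_def]
      field_simp
    rw [this]
    exact add_mem (mul_mem (IntermediateField.algebraMap_mem _ _) (mem_adjoin_simple_self k _))
      (IntermediateField.algebraMap_mem _ _)
  rw [adjoin_simple_le_iff, ← div_div_div_cancel_right₀ hne (φ (a • v₀ + b • v₁))]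
  exact div_mem (hmem a b) (hmem c d)

theorem adjoin_div_eq_of_span_eq {V : Type*} [AddCommGroup V] [Module k V] {φ : V →ₗ[k] F}
    (hφ : Function.Injective φ) {v₀ v₁ w₀ w₁ : V} (hv₁ : v₁ ≠ 0) (hw₁ : w₁ ≠ 0)
    (h : Submodule.span k {w₀, w₁} = Submodule.span k {v₀, v₁}) :
    k⟮φ w₀ / φ w₁⟯ = k⟮φ v₀ / φ v₁⟯ := by
  have hs {a b : V} : a ∈ Submodule.span k {a, b} ∧ b ∈ Submodule.span k {a, b} :=
    ⟨Submodule.subset_span (by simp), Submodule.subset_span (by simp)⟩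
  exact le_antisymm (adjoin_div_le_of_mem_span hφ hv₁ (h ▸ hs.1) (h ▸ hs.2))
    (adjoin_div_le_of_mem_span hφ hw₁ (h ▸ hs.1) (h ▸ hs.2))

theorem span_pair_combination_eq {V : Type*} [AddCommGroup V] [Module k V] {v₀ v₁ w₀ w₁ : V}
    {α β γ δ : k} (h₀ : w₀ = α • v₀ + β • v₁) (h₁ : w₁ = γ • v₀ + δ • v₁)
    (hΔ : α * δ - β * γ ≠ 0) : Submodule.span k {w₀, w₁} = Submodule.span k {v₀, v₁} := by
  have hs {a b : V} : a ∈ Submodule.span k {a, b} ∧ b ∈ Submodule.span k {a, b} :=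
    ⟨Submodule.subset_span (by simp), Submodule.subset_span (by simp)⟩
  refine le_antisymm ?_ ?_ <;> rw [Submodule.span_le, Set.pair_subset_iff] <;>
    simp only [SetLike.mem_coe, Submodule.mem_span_pair]
  · exact ⟨⟨α, β, h₀.symm⟩, ⟨γ, δ, h₁.symm⟩⟩
  · refine ⟨⟨(α * δ - β * γ)⁻¹ * δ, -((α * δ - β * γ)⁻¹ * β), ?_⟩,
      ⟨-((α * δ - β * γ)⁻¹ * γ), (α * δ - β * γ)⁻¹ * α, ?_⟩⟩
    · rw [h₀, h₁]
      match_scalars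
      · linear_combination inv_mul_cancel₀ hΔ
      · ring
    · rw [h₀, h₁]
      match_scalars
      · ring
      · linear_combination inv_mul_cancel₀ hΔ

theorem IsGenPair.adjoin_mobius_eq {x y : F} (h : IsGenPair k q m x y) {α β γ δ : k}
    (hΔ : α * δ - β * γ ≠ 0) :
    k⟮(algebraMap k F α * x + algebraMap k F β) / (algebraMap k F γ * x + algebraMap k F δ)⟯ =
      k⟮x⟯ := by
  have hD : algebraMap k F γ * x + algebraMap k F δ ≠ 0 := h.linear_ne_zero (by
    by_contra! hc
    simp [hc.1, hc.2] at hΔ)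
  have hc {E : IntermediateField k F} (c : k) : algebraMap k F c ∈ E :=
    IntermediateField.algebraMap_mem _ _
  set u := (algebraMap k F α * x + algebraMap k F β) / (algebraMap k F γ * x + algebraMap k F δ)
    with hu
  rw [eq_div_iff hD] at hu
  have hΔ' := (map_ne_zero (algebraMap k F)).2 hΔ
  refine le_antisymm ?_ ?_ <;> rw [adjoin_simple_le_iff]
  · have hx := mem_adjoin_simple_self k x
    exact div_mem (add_mem (mul_mem (hc _) hx) (hc _)) (add_mem (mul_mem (hc _) hx) (hc _))
  · have hu' := mem_adjoin_simple_self k u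
    have hne : algebraMap k F α - algebraMap k F γ * u ≠ 0 := by
      intro h0
      apply hΔ'
      simp only [map_sub, map_mul]
      linear_combination (algebraMap k F γ * x + algebraMap k F δ) * h0 + algebraMap k F γ * hu
    have : x = (algebraMap k F δ * u - algebraMap k F β) / (algebraMap k F α - algebraMap k F γ * u) := by
      rw [eq_div_iff hne]
      linear_combination -hu
    rw [this]
    exact div_mem (sub_mem (mul_mem (hc _) hu') (hc _)) (sub_mem (hc _) (mul_mem (hc _) hu'))

theorem IsGenPair.isGalois_adjoin_simple [IsAlgClosed k] [CharP k p] [CharP F p]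
    (hE : ExponentData p n q m) {x y : F} (h : IsGenPair k q m x y) : IsGalois k⟮x⟯ F := by
  have hm : m ≠ 0 := by have := hE.three_le; omega
  have hy := h.ne_zero hE
  have hx := mem_adjoin_simple_self k x
  refine isGalois_of_aeval_eq_mul _ h.adjoin_adjoin_eq (w := x ^ q - x)
    (sub_mem (pow_mem hx q) hx) (X ^ m) 1 (by simp [h.pow_eq]) ?_ fun t ht => ?_
  · simp [hy, hE.cast_m_ne_zero F, derivative_X_pow]
  · have hy' : algebraMap F (AlgebraicClosure F) y ≠ 0 := (_root_.map_ne_zero _).2 hy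
    have h1 : (t / algebraMap F (AlgebraicClosure F) y) ^ m = 1 := by
      rw [div_pow, ← map_pow, h.pow_eq, div_eq_one_iff_eq]
      · simpa using ht
      · rw [← h.pow_eq, map_pow]
        exact pow_ne_zero _ hy'
    obtain ⟨c, hc, -⟩ := exists_algebraMap_eq_of_pow_eq_one (k := k) (Nat.pos_of_ne_zero hm) h1
    rw [div_eq_iff hy', IsScalarTower.algebraMap_apply k F, ← map_mul] at hc
    exact ⟨_, hc.symm⟩

end

section
variable {p n q m : ℕ} {k F : Type*} [Field k] [Field F] [Algebra k F] {x y u : F}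
  {a₀ c₀ d₀ a₁ c₁ d₁ : k}

theorem exists_algEquiv_adjoin_simple (σ : F ≃ₐ[k] F) (hσ : σ u = u) :
    ∃ τ : F ≃ₐ[k⟮u⟯] F, ∀ f, τ f = σ f :=
  ⟨AlgEquiv.ofRingEquiv (f := σ.toRingEquiv)
    fun f => AlgEquiv.apply_eq_of_mem_adjoin σ hσ f.2, fun _ => rfl⟩

theorem IsGenPair.adjoin_eq_top (h : IsGenPair k q m x y) (E : IntermediateField k F) :
    adjoin E {x, y} = ⊤ := by
  rw [← top_le_iff]
  intro z _
  have h1 : adjoin k {x, y} ≤ (adjoin E {x, y}).restrictScalars k := by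
    rw [adjoin_le_iff]
    exact subset_adjoin E {x, y}
  rw [h.adjoin_eq] at h1
  exact h1 (x := z) trivial

theorem IsGenPair.finiteDimensional (h : IsGenPair k q m x y) (hm : 0 < m)
    (E : IntermediateField k F) (hx : IsIntegral E x) : FiniteDimensional E F := by
  have hy : IsIntegral E y := IsIntegral.of_pow hm (by
    rw [h.pow_eq]
    exact (hx.pow q).sub hx)
  have h1 : FiniteDimensional E (adjoin E {x, y}) :=
    finiteDimensional_adjoin fun z hz => by
      rcases hz with rfl | rfl <;> assumption
  rw [h.adjoin_eq_top E] at h1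
  exact topEquiv.toLinearEquiv.finiteDimensional

/-- A pencil of quadrics with a common root induces the projection to the `x`-line. -/
theorem IsGenPair.adjoin_eq_of_common_root (h : IsGenPair k q m x y)
    (hN : ¬ (c₀ * d₁ - d₀ * c₁ = 0 ∧ d₀ * a₁ - a₀ * d₁ = 0 ∧ a₀ * c₁ - c₀ * a₁ = 0))
    {a c d : k} (hne : (a, c, d) ≠ (0, 0, 0)) (hacd : a ^ 2 = c * d)
    (h₀ : a₀ * a + c₀ * c + d₀ * d = 0) (h₁ : a₁ * a + c₁ * c + d₁ * d = 0)
    (hu : u = (algebraMap k F a₀ * x + algebraMap k F c₀ + algebraMap k F d₀ * x ^ 2) /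
      (algebraMap k F a₁ * x + algebraMap k F c₁ + algebraMap k F d₁ * x ^ 2)) :
    k⟮u⟯ = k⟮x⟯ := by
  by_cases hc : c = 0
  · subst hc
    have ha : a = 0 := by simpa using hacd
    subst ha
    have hd : d ≠ 0 := by
      rintro rfl
      exact hne rfl
    have hd₀ : d₀ = 0 := by simpa [hd] using h₀
    have hd₁ : d₁ = 0 := by simpa [hd] using h₁
    subst hd₀ hd₁
    rw [hu]
    simp only [map_zero, zero_mul, add_zero]
    exact h.adjoin_mobius_eq fun h0 => hN (by simp [h0])
  · obtain ⟨r, rfl⟩ : ∃ r, a = c * r := ⟨a / c, by field_simp⟩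
    have hd : d = c * r ^ 2 := mul_left_cancel₀ hc (by rw [← hacd]; ring)
    subst hd
    have hc₀ : c₀ = -(a₀ * r + d₀ * r ^ 2) := mul_left_cancel₀ hc (by linear_combination h₀)
    have hc₁ : c₁ = -(a₁ * r + d₁ * r ^ 2) := mul_left_cancel₀ hc (by linear_combination h₁)
    have hx := h.sub_ne_zero r
    have hu' : u = (algebraMap k F d₀ * x + algebraMap k F (a₀ + d₀ * r)) /
        (algebraMap k F d₁ * x + algebraMap k F (a₁ + d₁ * r)) := by
      rw [hu, hc₀, hc₁, ← mul_div_mul_left _ (algebraMap k F d₁ * x + _) hx]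
      simp only [map_add, map_neg, map_mul, map_pow]
      congr 1 <;> ring
    rw [hu']
    refine h.adjoin_mobius_eq fun h0 => hN ?_
    subst hc₀ hc₁
    refine ⟨?_, ?_, ?_⟩
    · linear_combination r * h0
    · linear_combination h0
    · linear_combination r ^ 2 * h0

theorem pencil_identity {R : Type*} [CommRing R] (a₀ c₀ d₀ a₁ c₁ d₁ X Z : R) :
    (a₀ * X + c₀ + d₀ * X ^ 2) * (a₁ * Z + c₁ + d₁ * Z ^ 2) -
        (a₀ * Z + c₀ + d₀ * Z ^ 2) * (a₁ * X + c₁ + d₁ * X ^ 2) =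
      (X - Z) * ((a₀ * c₁ - c₀ * a₁) + (d₀ * a₁ - a₀ * d₁) * (X * Z) -
        (c₀ * d₁ - d₀ * c₁) * (X + Z)) := by
  ring

theorem IsGenPair.quadratic_eq_zero (h : IsGenPair k q m x y) {A B D : k}
    (h0 : algebraMap k F A * x ^ 2 + algebraMap k F B * x + algebraMap k F D = 0) :
    A = 0 ∧ B = 0 ∧ D = 0 :=
  coeffs_eq_zero_of_quadratic (transcendental_iff.1 h.transcendental _ (by simpa using h0))

variable {a c d : k}

/-- The involution exchanging the two members of a fibre of a base point free pencil. -/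
theorem IsGenPair.involution_ne (h : IsGenPair k q m x y) (h2 : (2 : k) ≠ 0)
    (hacd : a ^ 2 ≠ c * d) :
    (algebraMap k F a * x - algebraMap k F d) / (algebraMap k F c * x - algebraMap k F a) ≠ x := by
  intro h0
  have hD : algebraMap k F c * x - algebraMap k F a ≠ 0 := by
    have := h.linear_ne_zero (γ := c) (δ := -a) (by
      by_contra! hc
      apply hacd
      rw [hc.1, neg_eq_zero.1 hc.2]
      ring)
    rwa [map_neg, ← sub_eq_add_neg] at this
  rw [div_eq_iff hD] at h0
  obtain ⟨h1, h3, h4⟩ := h.quadratic_eq_zero (A := c) (B := -2 * a) (D := d) (by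
    simp only [map_mul, map_neg, map_ofNat]
    linear_combination -h0)
  apply hacd
  have ha : a = 0 := by simpa [h2] using h3
  rw [ha, h1]
  ring

theorem IsGenPair.pencil_denom_ne_zero (h : IsGenPair k q m x y)
    (hN : ¬ (c₀ * d₁ - d₀ * c₁ = 0 ∧ d₀ * a₁ - a₀ * d₁ = 0 ∧ a₀ * c₁ - c₀ * a₁ = 0)) :
    algebraMap k F a₁ * x + algebraMap k F c₁ + algebraMap k F d₁ * x ^ 2 ≠ 0 := by
  intro h0
  obtain ⟨h1, h2, h3⟩ := h.quadratic_eq_zero (A := d₁) (B := a₁) (D := c₁) (by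
    linear_combination h0)
  exact hN (by simp [h1, h2, h3])

theorem IsGenPair.pencil_notMem (h : IsGenPair k q m x y)
    (hN : ¬ (c₀ * d₁ - d₀ * c₁ = 0 ∧ d₀ * a₁ - a₀ * d₁ = 0 ∧ a₀ * c₁ - c₀ * a₁ = 0))
    (hu : u = (algebraMap k F a₀ * x + algebraMap k F c₀ + algebraMap k F d₀ * x ^ 2) /
      (algebraMap k F a₁ * x + algebraMap k F c₁ + algebraMap k F d₁ * x ^ 2)) (l : k) :
    u ≠ algebraMap k F l := by
  intro h0
  rw [hu, div_eq_iff (h.pencil_denom_ne_zero hN)] at h0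
  obtain ⟨h1, h2, h3⟩ := h.quadratic_eq_zero (A := d₀ - l * d₁) (B := a₀ - l * a₁)
    (D := c₀ - l * c₁) (by
      simp only [map_sub, map_mul]
      linear_combination h0)
  rw [sub_eq_zero] at h1 h2 h3
  apply hN
  rw [h1, h2, h3]
  refine ⟨?_, ?_, ?_⟩ <;> ring

/-- Functions of `x` are linear polynomials in `x` over the field of a pencil of quadrics. -/
theorem IsGenPair.exists_linear_of_mem (h : IsGenPair k q m x y)
    (hN : ¬ (c₀ * d₁ - d₀ * c₁ = 0 ∧ d₀ * a₁ - a₀ * d₁ = 0 ∧ a₀ * c₁ - c₀ * a₁ = 0))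
    (hu : u = (algebraMap k F a₀ * x + algebraMap k F c₀ + algebraMap k F d₀ * x ^ 2) /
      (algebraMap k F a₁ * x + algebraMap k F c₁ + algebraMap k F d₁ * x ^ 2))
    (hd : d₀ ≠ 0 ∨ d₁ ≠ 0) :
    IsIntegral k⟮u⟯ x ∧ ∀ f ∈ k⟮x⟯, ∃ s ∈ k⟮u⟯, ∃ t ∈ k⟮u⟯, f = s + t * x := by
  have hu' := hu
  rw [eq_div_iff (h.pencil_denom_ne_zero hN)] at hu'
  have hmem := mem_adjoin_simple_self k u
  have hc (c : k) : algebraMap k F c ∈ k⟮u⟯ := IntermediateField.algebraMap_mem _ _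
  have hne : algebraMap k F d₀ - u * algebraMap k F d₁ ≠ 0 := by
    intro h0
    have hd₁ : d₁ ≠ 0 := by
      rintro rfl
      simp only [map_zero, mul_zero, sub_zero, _root_.map_eq_zero] at h0
      simp [h0] at hd
    apply h.pencil_notMem hN hu (d₀ / d₁)
    have hd₁' : algebraMap k F d₁ ≠ 0 := (_root_.map_ne_zero _).2 hd₁
    rw [map_div₀, eq_div_iff hd₁']
    linear_combination -h0
  let B : k⟮u⟯ := ⟨(algebraMap k F a₀ - u * algebraMap k F a₁) /
    (algebraMap k F d₀ - u * algebraMap k F d₁),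
      div_mem (sub_mem (hc _) (mul_mem hmem (hc _))) (sub_mem (hc _) (mul_mem hmem (hc _)))⟩
  let D : k⟮u⟯ := ⟨(algebraMap k F c₀ - u * algebraMap k F c₁) /
    (algebraMap k F d₀ - u * algebraMap k F d₁),
      div_mem (sub_mem (hc _) (mul_mem hmem (hc _))) (sub_mem (hc _) (mul_mem hmem (hc _)))⟩
  let M : k⟮u⟯[X] := X ^ 2 + (C B * X + C D)
  have hlt : degree (C B * X + C D) < 2 :=
    lt_of_le_of_lt degree_linear_le (by exact_mod_cast one_lt_two)
  have hM : M.Monic := monic_X_pow_add hlt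
  have hdeg : M.natDegree = 2 := by
    have := natDegree_quadratic (b := B) (c := D) one_ne_zero
    rwa [C_1, one_mul, add_assoc] at this
  have hroot : aeval x M = 0 := by
    simp only [M, map_add, map_mul, map_pow, aeval_X, aeval_C]
    change x ^ 2 + ((algebraMap k F a₀ - u * algebraMap k F a₁) /
      (algebraMap k F d₀ - u * algebraMap k F d₁) * x + (algebraMap k F c₀ - u * algebraMap k F c₁) /
      (algebraMap k F d₀ - u * algebraMap k F d₁)) = 0
    field_simp
    linear_combination -hu'
  have hint : IsIntegral k⟮u⟯ x := ⟨M, hM, hroot⟩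
  refine ⟨hint, fun f hf => ?_⟩
  have hf' : f ∈ (k⟮u⟯)⟮x⟯ := by
    have h1 : k⟮x⟯ ≤ ((k⟮u⟯)⟮x⟯).restrictScalars k := by
      rw [adjoin_simple_le_iff]
      exact mem_adjoin_simple_self k⟮u⟯ x
    exact h1 hf
  rw [← mem_toSubalgebra, adjoin_simple_toSubalgebra_of_isAlgebraic hint.isAlgebraic,
    Algebra.adjoin_singleton_eq_range_aeval] at hf'
  obtain ⟨P, hP⟩ := hf'
  have hP : aeval x P = f := hP
  have h1 : aeval x (P %ₘ M) = f := by rw [aeval_modByMonic_eq_self_of_root hroot, hP]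
  have h3 : (P %ₘ M).natDegree ≤ 1 := by
    have := natDegree_modByMonic_lt P hM fun h0 => by simp [h0] at hdeg
    omega
  refine ⟨_, ((P %ₘ M).coeff 0).2, _, ((P %ₘ M).coeff 1).2, ?_⟩
  rw [← h1]
  conv_lhs => rw [eq_X_add_C_of_natDegree_le_one h3]
  simp only [map_add, map_mul, aeval_C, aeval_X]
  rw [add_comm]
  rfl

/-- A base point free pencil of quadrics in `x` defined over the field with `q` elements
induces a Galois extension. -/
theorem IsGenPair.isGalois_of_rational_pencil [IsAlgClosed k] [CharP k p] [Fact p.Prime] [CharP F p]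
    (hE : ExponentData p n q m) (h : IsGenPair k q m x y)
    (ha₀ : a₀ ^ q = a₀) (hc₀ : c₀ ^ q = c₀) (hd₀ : d₀ ^ q = d₀)
    (ha₁ : a₁ ^ q = a₁) (hc₁ : c₁ ^ q = c₁) (hd₁ : d₁ ^ q = d₁)
    (hN : (c₀ * d₁ - d₀ * c₁) ^ 2 ≠ (d₀ * a₁ - a₀ * d₁) * (a₀ * c₁ - c₀ * a₁))
    (hu : u = (algebraMap k F a₀ * x + algebraMap k F c₀ + algebraMap k F d₀ * x ^ 2) /
      (algebraMap k F a₁ * x + algebraMap k F c₁ + algebraMap k F d₁ * x ^ 2)) :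
    IsGalois k⟮u⟯ F := by
  have hm : 0 < m := by have := hE.three_le; omega
  have hN' : ¬ (c₀ * d₁ - d₀ * c₁ = 0 ∧ d₀ * a₁ - a₀ * d₁ = 0 ∧ a₀ * c₁ - c₀ * a₁ = 0) := by
    rintro ⟨h1, h2, h3⟩
    apply hN
    rw [h1, h2]
    ring
  set a := c₀ * d₁ - d₀ * c₁ with ha
  set c := d₀ * a₁ - a₀ * d₁ with hc
  set d := a₀ * c₁ - c₀ * a₁ with hd
  have haq : a ^ q = a := by rw [ha, hE.sub_pow, mul_pow, mul_pow, hc₀, hd₁, hd₀, hc₁]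
  have hcq : c ^ q = c := by rw [hc, hE.sub_pow, mul_pow, mul_pow, ha₀, hd₁, hd₀, ha₁]
  have hdq : d ^ q = d := by rw [hd, hE.sub_pow, mul_pow, mul_pow, hc₀, ha₁, ha₀, hc₁]
  have hΔ : a * -a - -d * c ≠ 0 := fun h0 => hN (by linear_combination -h0)
  obtain ⟨e, he⟩ := IsAlgClosed.exists_pow_nat_eq (a * -a - -d * c) hm
  obtain ⟨σ, hσx, -⟩ := h.exists_algEquiv hE
    (h.mobius hE haq (by rw [hE.neg_pow, hdq]) hcq (by rw [hE.neg_pow, haq]) hΔ he)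
  have hσx' : σ x = (algebraMap k F a * x - algebraMap k F d) /
      (algebraMap k F c * x - algebraMap k F a) := by
    rw [hσx, map_neg, map_neg, ← sub_eq_add_neg, ← sub_eq_add_neg]
  have hσne : σ x ≠ x := hσx' ▸ h.involution_ne (hE.two_ne_zero k) hN
  have hL₁ := h.pencil_denom_ne_zero hN'
  have hD : algebraMap k F c * x - algebraMap k F a ≠ 0 := by
    have := h.linear_ne_zero (γ := c) (δ := -a) (by
      by_contra! hc
      apply hN
      rw [hc.1, neg_eq_zero.1 hc.2]
      ring)
    rwa [map_neg, ← sub_eq_add_neg] at this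
  have hσu : σ u = u := by
    have hL₁' : algebraMap k F a₁ * σ x + algebraMap k F c₁ + algebraMap k F d₁ * σ x ^ 2 ≠ 0 := by
      have := (map_ne_zero_iff σ σ.injective).2 hL₁
      simpa using this
    rw [hu]
    simp only [map_div₀, map_add, map_mul, map_pow, AlgEquiv.commutes]
    rw [div_eq_div_iff hL₁' hL₁, ← sub_eq_zero, pencil_identity]
    refine mul_eq_zero_of_right _ ?_
    rw [eq_div_iff hD] at hσx'
    simp only [ha, hc, hd, map_sub, map_mul] at hσx'
    linear_combination hσx'
  obtain ⟨τ, hτ⟩ := exists_algEquiv_adjoin_simple σ hσu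
  obtain ⟨hint, hlin⟩ := h.exists_linear_of_mem hN' hu (by
    by_contra! h0
    apply hN
    rw [ha, hc, h0.1, h0.2]
    ring)
  have := h.finiteDimensional hm k⟮u⟯ hint
  have hgal := h.isGalois_adjoin_simple hE
  have hux : u ∈ k⟮x⟯ := by
    have hx := mem_adjoin_simple_self k x
    have hk (c : k) : algebraMap k F c ∈ k⟮x⟯ := IntermediateField.algebraMap_mem _ _
    rw [hu]
    exact div_mem (add_mem (add_mem (mul_mem (hk _) hx) (hk _)) (mul_mem (hk _) (pow_mem hx 2)))
      (add_mem (add_mem (mul_mem (hk _) hx) (hk _)) (mul_mem (hk _) (pow_mem hx 2)))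
  refine IsGalois.of_fixedField_eq_bot k⟮u⟯ F ?_
  rw [← le_bot_iff]
  intro f hf
  rw [mem_fixedField_iff] at hf
  have hfx : f ∈ k⟮x⟯ := by
    have h1 : f ∈ (⊥ : IntermediateField k⟮x⟯ F) := by
      rw [InfiniteGalois.mem_bot_iff_fixed]
      intro ρ
      obtain ⟨ρ', hρ'⟩ := exists_algEquiv_adjoin_simple (ρ.restrictScalars k)
        (show ρ u = u from ρ.commutes ⟨u, hux⟩)
      exact (hρ' f).symm.trans (hf ρ' trivial)
    obtain ⟨g, hg⟩ := mem_bot.1 h1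
    rw [← hg]
    exact g.2
  obtain ⟨s, hs, t, ht, rfl⟩ := hlin f hfx
  have h1 := hf τ trivial
  rw [map_add, map_mul, hτ, hτ, hτ, σ.apply_eq_of_mem_adjoin hσu hs,
    σ.apply_eq_of_mem_adjoin hσu ht, ← sub_eq_zero] at h1
  have h2 : t * (σ x - x) = 0 := by linear_combination h1
  rw [mul_eq_zero, or_iff_left (_root_.sub_ne_zero.2 hσne)] at h2
  rw [h2, zero_mul, add_zero, mem_bot]
  exact ⟨⟨s, hs⟩, rfl⟩

end

section
variable {p n q m : ℕ} {k F : Type*} [Field k] [Field F] [Algebra k F] {x y u : F}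
  {a₀ c₀ d₀ a₁ c₁ d₁ : k}

theorem mem_adjoin_simple_of_forall_fixed [IsGalois k⟮u⟯ F] {f : F}
    (hf : ∀ σ : F ≃ₐ[k] F, σ u = u → σ f = f) : f ∈ k⟮u⟯ := by
  have h1 : f ∈ (⊥ : IntermediateField k⟮u⟯ F) := by
    rw [InfiniteGalois.mem_bot_iff_fixed]
    exact fun σ => hf (σ.restrictScalars k) (σ.commutes ⟨u, mem_adjoin_simple_self k u⟩)
  obtain ⟨g, hg⟩ := mem_bot.1 h1
  exact hg ▸ g.2

/-- A line that admits a basis of forms with coefficients fixed by the `q`-power map. -/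
def IsRationalSpan (q : ℕ) {k ι : Type*} [Field k] (W : Submodule k (ι → k)) : Prop :=
  ∃ w₀ w₁ : ι → k, (∀ i, w₀ i ^ q = w₀ i) ∧ (∀ i, w₁ i ^ q = w₁ i) ∧ Submodule.span k {w₀, w₁} = W

theorem isRationalSpan_of_cross_product {s a c d : k} (hs : s ≠ 0)
    (ha : a ^ q = a) (hc : c ^ q = c) (hd : d ^ q = d)
    (haq : (-a) ^ q = -a) (hcq : (-c) ^ q = -c) (hdq : (-d) ^ q = -d) (hq : q ≠ 0)
    (hne : ¬ (a = 0 ∧ c = 0 ∧ d = 0))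
    (hsa : c₀ * d₁ - d₀ * c₁ = s * a) (hsc : d₀ * a₁ - a₀ * d₁ = s * c)
    (hsd : a₀ * c₁ - c₀ * a₁ = s * d) :
    IsRationalSpan q (Submodule.span k {![a₀, 0, c₀, d₀], ![a₁, 0, c₁, d₁]}) := by
  have e₁ : ![0, 0, d, -c] = (-(s⁻¹ * a₁)) • ![a₀, 0, c₀, d₀] + (s⁻¹ * a₀) • ![a₁, 0, c₁, d₁] := by
    ext i
    fin_cases i <;> simp
    · ring
    · field_simp
      linear_combination -hsd
    · field_simp
      linear_combination hsc
  have e₂ : ![-d, 0, 0, a] = (-(s⁻¹ * c₁)) • ![a₀, 0, c₀, d₀] + (s⁻¹ * c₀) • ![a₁, 0, c₁, d₁] := by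
    ext i
    fin_cases i <;> simp
    · field_simp
      linear_combination hsd
    · ring
    · field_simp
      linear_combination -hsa
  have e₃ : ![c, 0, -a, 0] = (-(s⁻¹ * d₁)) • ![a₀, 0, c₀, d₀] + (s⁻¹ * d₀) • ![a₁, 0, c₁, d₁] := by
    ext i
    fin_cases i <;> simp
    · field_simp
      linear_combination -hsc
    · field_simp
      linear_combination hsa
    · ring
  have f₁ : ∀ i, ![0, 0, d, -c] i ^ q = ![0, 0, d, -c] i := by
    intro i
    fin_cases i <;> simp [hd, hcq, hq]
  have f₂ : ∀ i, ![-d, 0, 0, a] i ^ q = ![-d, 0, 0, a] i := by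
    intro i
    fin_cases i <;> simp [hdq, ha, hq]
  have f₃ : ∀ i, ![c, 0, -a, 0] i ^ q = ![c, 0, -a, 0] i := by
    intro i
    fin_cases i <;> simp [hc, haq, hq]
  by_cases hd0 : d = 0
  · by_cases ha0 : a = 0
    · have hc0 : c ≠ 0 := fun h0 => hne ⟨ha0, h0, hd0⟩
      refine ⟨_, _, f₁, f₃, span_pair_combination_eq e₁ e₃ fun h0 => hc0 ?_⟩
      field_simp at h0
      refine mul_left_cancel₀ hs ?_
      linear_combination -hsc - h0
    · refine ⟨_, _, f₂, f₃, span_pair_combination_eq e₂ e₃ fun h0 => ha0 ?_⟩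
      field_simp at h0
      refine mul_left_cancel₀ hs ?_
      linear_combination -hsa + h0
  · refine ⟨_, _, f₁, f₂, span_pair_combination_eq e₁ e₂ fun h0 => hd0 ?_⟩
    field_simp at h0
    refine mul_left_cancel₀ hs ?_
    linear_combination -hsd + h0

theorem IsGenPair.notMem_of_pencil [IsAlgClosed k] [CharP k p] [Fact p.Prime]
    (hE : ExponentData p n q m) (h : IsGenPair k q m x y)
    (hN : (c₀ * d₁ - d₀ * c₁) ^ 2 ≠ (d₀ * a₁ - a₀ * d₁) * (a₀ * c₁ - c₀ * a₁))
    (hu : u = (algebraMap k F a₀ * x + algebraMap k F c₀ + algebraMap k F d₀ * x ^ 2) /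
      (algebraMap k F a₁ * x + algebraMap k F c₁ + algebraMap k F d₁ * x ^ 2)) :
    x ∉ k⟮u⟯ := by
  have hm : 0 < m := by have := hE.three_le; omega
  intro hxu
  have hN' : ¬ (c₀ * d₁ - d₀ * c₁ = 0 ∧ d₀ * a₁ - a₀ * d₁ = 0 ∧ a₀ * c₁ - c₀ * a₁ = 0) := by
    rintro ⟨h1, h2, h3⟩
    apply hN
    rw [h1, h2]
    ring
  set a := c₀ * d₁ - d₀ * c₁ with ha
  set c := d₀ * a₁ - a₀ * d₁ with hc
  set d := a₀ * c₁ - c₀ * a₁ with hd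
  have hΔ : a * -a - -d * c ≠ 0 := fun h0 => hN (by linear_combination -h0)
  have hL₁ := h.pencil_denom_ne_zero hN'
  have hD : algebraMap k F c * x - algebraMap k F a ≠ 0 := by
    have := h.linear_ne_zero (γ := c) (δ := -a) (by
      by_contra! hc
      apply hN
      rw [hc.1, neg_eq_zero.1 hc.2]
      ring)
    rwa [map_neg, ← sub_eq_add_neg] at this
  set z := (algebraMap k F a * x - algebraMap k F d) /
      (algebraMap k F c * x - algebraMap k F a) with hz
  have hzne : z ≠ x := h.involution_ne (hE.two_ne_zero k) hN
  have hadj : k⟮z⟯ = k⟮x⟯ := by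
    rw [← h.adjoin_mobius_eq hΔ, hz, map_neg, map_neg, ← sub_eq_add_neg, ← sub_eq_add_neg]
  have htr : Transcendental k z := by
    intro halg
    have := isAlgebraic_adjoin_simple halg.isIntegral
    have hx : x ∈ k⟮z⟯ := hadj ▸ mem_adjoin_simple_self k x
    exact h.transcendental ((Algebra.IsAlgebraic.isAlgebraic (R := k) (⟨x, hx⟩ : k⟮z⟯)).algHom
      k⟮z⟯.val)
  let L := AlgebraicClosure F
  have htr' : Transcendental k (algebraMap F L z) :=
    (transcendental_algebraMap_iff (algebraMap F L).injective).2 htr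
  obtain ⟨v, hv⟩ := IsAlgClosed.exists_pow_nat_eq (algebraMap F L z ^ q - algebraMap F L z) hm
  obtain ⟨ψ, hψ, -⟩ := h.exists_algHom hE htr' hv
  have hψu : ψ u = algebraMap F L u := by
    have hL₁' : algebraMap k F a₁ * z + algebraMap k F c₁ + algebraMap k F d₁ * z ^ 2 ≠ 0 := by
      intro h0
      apply (map_ne_zero_iff ψ ψ.injective).2 hL₁
      simp only [map_add, map_mul, map_pow, AlgHom.commutes, hψ]
      rw [IsScalarTower.algebraMap_eq k F L]
      simp only [RingHom.comp_apply, ← map_pow, ← map_mul, ← map_add, h0, map_zero]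
    have huz : u = (algebraMap k F a₀ * z + algebraMap k F c₀ + algebraMap k F d₀ * z ^ 2) /
        (algebraMap k F a₁ * z + algebraMap k F c₁ + algebraMap k F d₁ * z ^ 2) := by
      rw [hu, div_eq_div_iff hL₁ hL₁', ← sub_eq_zero, pencil_identity]
      refine mul_eq_zero_of_right _ ?_
      rw [eq_div_iff hD] at hz
      simp only [ha, hc, hd, map_sub, map_mul] at hz
      linear_combination hz
    conv_rhs => rw [huz]
    rw [hu]
    simp only [map_div₀, map_add, map_mul, map_pow, AlgHom.commutes, hψ]
    rw [IsScalarTower.algebraMap_eq k F L]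
    rfl
  obtain ⟨A, B, hAB⟩ := (mem_adjoin_simple_iff k x).1 hxu
  apply hzne
  apply (algebraMap F L).injective
  rw [← hψ]
  have h1 (P : k[X]) : ψ (aeval u P) = algebraMap F L (aeval u P) := by
    rw [← aeval_algHom_apply, hψu, aeval_algebraMap_apply]
  conv_lhs => rw [hAB]
  conv_rhs => rw [hAB]
  rw [map_div₀, map_div₀, h1, h1]

/-- A base point free pencil of quadrics in `x` which induces a Galois extension is defined
over the field with `q` elements. -/
theorem IsGenPair.isRationalSpan_of_isGalois [IsAlgClosed k] [CharP k p] [Fact p.Prime] [CharP F p]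
    (hE : ExponentData p n q m) (h : IsGenPair k q m x y)
    (hN : (c₀ * d₁ - d₀ * c₁) ^ 2 ≠ (d₀ * a₁ - a₀ * d₁) * (a₀ * c₁ - c₀ * a₁))
    (hu : u = (algebraMap k F a₀ * x + algebraMap k F c₀ + algebraMap k F d₀ * x ^ 2) /
      (algebraMap k F a₁ * x + algebraMap k F c₁ + algebraMap k F d₁ * x ^ 2))
    (hG : IsGalois k⟮u⟯ F) :
    IsRationalSpan q (Submodule.span k {![a₀, 0, c₀, d₀], ![a₁, 0, c₁, d₁]}) := by
  have hq := hE.one_lt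
  have hx := h.notMem_of_pencil hE hN hu
  have hN' : ¬ (c₀ * d₁ - d₀ * c₁ = 0 ∧ d₀ * a₁ - a₀ * d₁ = 0 ∧ a₀ * c₁ - c₀ * a₁ = 0) := by
    rintro ⟨h1, h2, h3⟩
    apply hN
    rw [h1, h2]
    ring
  obtain ⟨σ, hσu, hσ⟩ : ∃ σ : F ≃ₐ[k] F, σ u = u ∧ σ x ≠ x := by
    by_contra! hc
    exact hx (mem_adjoin_simple_of_forall_fixed hc)
  obtain ⟨α, β, γ, δ, -, hα, hβ, hγ, hδ, hΔ, -, hσx, -⟩ := h.exists_mobius hE (h.map σ)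
  have hD : algebraMap k F γ * x + algebraMap k F δ ≠ 0 := h.linear_ne_zero (by
    by_contra! hc
    simp [hc.1, hc.2] at hΔ)
  have hL₁ := h.pencil_denom_ne_zero hN'
  have hL₁' : algebraMap k F a₁ * σ x + algebraMap k F c₁ + algebraMap k F d₁ * σ x ^ 2 ≠ 0 := by
    have := (map_ne_zero_iff σ σ.injective).2 hL₁
    simpa using this
  have hσu' := hσu
  rw [hu] at hσu'
  simp only [map_div₀, map_add, map_mul, map_pow, AlgEquiv.commutes] at hσu'
  rw [div_eq_div_iff hL₁' hL₁, ← sub_eq_zero, pencil_identity, mul_eq_zero,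
    or_iff_right (_root_.sub_ne_zero.2 hσ)] at hσu'
  set a := c₀ * d₁ - d₀ * c₁ with ha
  set c := d₀ * a₁ - a₀ * d₁ with hc
  set d := a₀ * c₁ - c₀ * a₁ with hd
  obtain ⟨h1, h2, h3⟩ := h.quadratic_eq_zero (A := c * α - a * γ)
    (B := c * β - a * α + d * γ - a * δ) (D := d * δ - a * β) (by
      rw [eq_div_iff hD] at hσx
      have h0 : algebraMap k F d + algebraMap k F c * (σ x * x) - algebraMap k F a * (σ x + x) = 0 := by
        simp only [ha, hc, hd, map_sub, map_mul]
        linear_combination hσu'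
      simp only [map_sub, map_mul, map_add]
      linear_combination (algebraMap k F γ * x + algebraMap k F δ) * h0 -
        (algebraMap k F c * x - algebraMap k F a) * hσx)
  have hpow : ∀ t : k, t ^ q = t → (-t) ^ q = -t := fun t ht => by rw [hE.neg_pow, ht]
  by_cases hγ0 : γ = 0
  · have hα0 : α ≠ 0 := by
      rintro rfl
      simp [hγ0] at hΔ
    have hδ0 : δ ≠ 0 := by
      rintro rfl
      simp [hγ0] at hΔ
    have hc0 : c = 0 := by
      rw [hγ0, mul_zero, sub_zero, mul_eq_zero] at h1
      exact h1.resolve_right hα0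
    have ha0 : a ≠ 0 := by
      intro h0
      rw [h0, hc0] at hN
      simp at hN
    refine isRationalSpan_of_cross_product (s := a) (a := 1) (c := 0) (d := β / δ) ha0 (one_pow q)
      (zero_pow (by omega)) ?_ (hpow _ (one_pow q)) (hpow _ (zero_pow (by omega))) (hpow _ ?_)
      (by omega) (by simp) (by rw [mul_one]) (by rw [mul_zero, ← hc, hc0]) ?_
    · rw [div_pow, hβ, hδ]
    · rw [div_pow, hβ, hδ]
    · rw [← hd]
      field_simp
      linear_combination h3
  · have hdq : ((α * δ - β * γ + α ^ 2) / γ) ^ q = (α * δ - β * γ + α ^ 2) / γ := by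
      rw [div_pow, hE.add_pow, hE.sub_pow, mul_pow, mul_pow, hα, hβ, hγ, hδ, ← pow_mul, mul_comm 2 q,
        pow_mul, hα]
    have hcγ : c / γ ≠ 0 := by
      intro h0
      have hc0 : c = 0 := by simpa [hγ0] using h0
      have ha0 : a = 0 := by
        rw [hc0, zero_mul, zero_sub, neg_eq_zero, mul_eq_zero] at h1
        exact h1.resolve_right hγ0
      rw [ha0, hc0] at hN
      simp at hN
    have hca : a = c / γ * α := by
      field_simp
      linear_combination -h1
    refine isRationalSpan_of_cross_product (s := c / γ) (a := α) (c := γ)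
      (d := (α * δ - β * γ + α ^ 2) / γ) hcγ hα hγ hdq (hpow _ hα) (hpow _ hγ) (hpow _ hdq) (by omega)
      (fun h0 => hγ0 h0.2.1) hca ?_ ?_
    · rw [← hc]
      field_simp
    · rw [← hd]
      field_simp
      have hca' : a * γ = c * α := by linear_combination -h1
      linear_combination γ * h2 + (α + δ) * hca'

end

section
variable {K : Type*} [Field K]

/-- The binary quadratic form with coefficients `A`, `B`, `C` is an eigenvector, with eigenvalue
`e`, for the substitution of matrix `!![α, β; γ, δ]`. -/
structure IsEigenform (α β γ δ e A B C : K) : Prop where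
  eq₂ : A * α ^ 2 + B * (α * γ) + C * γ ^ 2 = e * A
  eq₁ : 2 * A * (α * β) + B * (α * δ + β * γ) + 2 * C * (γ * δ) = e * B
  eq₀ : A * β ^ 2 + B * (β * δ) + C * δ ^ 2 = e * C

variable {α β γ δ e A B C α' β' γ' δ' e' A' B' C' : K}

theorem IsEigenform.mul (h : IsEigenform α β γ δ e A B C) (h' : IsEigenform α' β' γ' δ' e' A B C) :
    IsEigenform (α * α' + β * γ') (α * β' + β * δ') (γ * α' + δ * γ') (γ * β' + δ * δ') (e * e') A B C := by
  obtain ⟨h2, h1, h0⟩ := h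
  obtain ⟨h2', h1', h0'⟩ := h'
  refine ⟨?_, ?_, ?_⟩
  · linear_combination α' ^ 2 * h2 + α' * γ' * h1 + γ' ^ 2 * h0 + e * h2'
  · linear_combination 2 * α' * β' * h2 + (α' * δ' + β' * γ') * h1 + 2 * γ' * δ' * h0 + e * h1'
  · linear_combination β' ^ 2 * h2 + β' * δ' * h1 + δ' ^ 2 * h0 + e * h0'

theorem eq_zero_of_two_by_two (hΔ : α * δ - β * γ ≠ 0) {v w : K} (h₁ : α * v + γ * w = 0)
    (h₂ : β * v + δ * w = 0) : v = 0 ∧ w = 0 :=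
  ⟨mul_left_cancel₀ hΔ (by linear_combination δ * h₁ - γ * h₂),
    mul_left_cancel₀ hΔ (by linear_combination α * h₂ - β * h₁)⟩

theorem IsEigenform.exists_eq_mul (h2 : (2 : K) ≠ 0) (hΔ : α * δ - β * γ ≠ 0)
    (hne : ¬ (γ = 0 ∧ δ - α = 0 ∧ β = 0)) (h : IsEigenform α β γ δ (α * δ - β * γ) A B C) :
    ∃ s, A = s * γ ∧ B = s * (δ - α) ∧ C = s * -β := by
  have hmid : A * (α * β) + B * (β * γ) + C * (γ * δ) = 0 :=
    mul_left_cancel₀ h2 (by linear_combination h.eq₁)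
  obtain ⟨w3, w2⟩ := eq_zero_of_two_by_two hΔ (v := B * γ - A * (δ - α)) (w := A * β + C * γ)
    (by linear_combination h.eq₂) (by linear_combination hmid)
  obtain ⟨-, w1⟩ := eq_zero_of_two_by_two hΔ (v := A * β + C * γ) (w := B * β + C * (δ - α))
    (by linear_combination hmid) (by linear_combination h.eq₀)
  by_cases hγ : γ = 0
  · subst hγ
    by_cases hβ : β = 0
    · subst hβ
      have hτ : δ - α ≠ 0 := fun h0 => hne ⟨rfl, h0, rfl⟩
      refine ⟨B / (δ - α), mul_left_cancel₀ hτ ?_, by field_simp, mul_left_cancel₀ hτ ?_⟩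
      · linear_combination -w3
      · linear_combination w1
    · refine ⟨-C / β, mul_left_cancel₀ hβ ?_, mul_left_cancel₀ hβ ?_, by field_simp⟩
      · linear_combination w2
      · field_simp
        linear_combination w1
  · refine ⟨A / γ, by field_simp, mul_left_cancel₀ hγ ?_, mul_left_cancel₀ hγ ?_⟩
    · field_simp
      linear_combination w3
    · field_simp
      linear_combination w2

/-- A nonzero eigenform with eigenvalue the negative of the determinant forces trace zero. -/
theorem IsEigenform.add_eq_zero (h2 : (2 : K) ≠ 0) (hΔ : α * δ - β * γ ≠ 0)
    (h : IsEigenform α β γ δ (-(α * δ - β * γ)) A B C) (hne : ¬ (A = 0 ∧ B = 0 ∧ C = 0)) :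
    α + δ = 0 := by
  by_contra ht
  apply hne
  have hdet : (!![α ^ 2 + (α * δ - β * γ), α * γ, γ ^ 2;
      2 * (α * β), α * δ + β * γ + (α * δ - β * γ), 2 * (γ * δ);
      β ^ 2, β * δ, δ ^ 2 + (α * δ - β * γ)] : Matrix (Fin 3) (Fin 3) K).det ≠ 0 := by
    have : (!![α ^ 2 + (α * δ - β * γ), α * γ, γ ^ 2;
      2 * (α * β), α * δ + β * γ + (α * δ - β * γ), 2 * (γ * δ);
      β ^ 2, β * δ, δ ^ 2 + (α * δ - β * γ)] : Matrix (Fin 3) (Fin 3) K).det =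
        2 * (α * δ - β * γ) ^ 2 * (α + δ) ^ 2 := by
      simp [Matrix.det_fin_three]
      ring
    rw [this]
    exact mul_ne_zero (mul_ne_zero h2 (pow_ne_zero _ hΔ)) (pow_ne_zero _ ht)
  have hv := Matrix.eq_zero_of_mulVec_eq_zero (v := ![A, B, C]) hdet (by
    ext i
    fin_cases i <;> simp [Matrix.mulVec, Fin.sum_univ_three, dotProduct]
    · linear_combination h.eq₂
    · linear_combination h.eq₁
    · linear_combination h.eq₀)
  exact ⟨by simpa using congrFun hv 0, by simpa using congrFun hv 1, by simpa using congrFun hv 2⟩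

theorem IsEigenform.disc_eq_zero (h : IsEigenform α β γ δ e A B C)
    (h' : IsEigenform α β γ δ e A' B' C') (he : e ≠ α * δ - β * γ) (he' : e ≠ -(α * δ - β * γ)) :
    B * B' - 2 * (A * C' + A' * C) = 0 := by
  have hk : e ^ 2 - (α * δ - β * γ) ^ 2 ≠ 0 := by
    intro h0
    rcases sq_eq_sq_iff_eq_or_eq_neg.1 (sub_eq_zero.1 h0) with h0 | h0
    exacts [he h0, he' h0]
  refine mul_left_cancel₀ hk ?_
  have e2 := h.eq₂
  have e1 := h.eq₁
  have e0 := h.eq₀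
  have e2' := h'.eq₂
  have e1' := h'.eq₁
  have e0' := h'.eq₀
  have : (e * B) * (e * B') - 2 * ((e * A) * (e * C') + (e * A') * (e * C)) =
      (α * δ - β * γ) ^ 2 * (B * B' - 2 * (A * C' + A' * C)) := by
    rw [← e2, ← e1, ← e0, ← e2', ← e1', ← e0']
    ring
  linear_combination this

theorem exists_eq_mul_of_disc (h2 : (2 : K) ≠ 0) (hne : ¬ (A = 0 ∧ B = 0 ∧ C = 0))
    (h : B * B - 2 * (A * C + A * C) = 0) (h' : B * B' - 2 * (A * C' + A' * C) = 0)
    (h'' : B' * B' - 2 * (A' * C' + A' * C') = 0) :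
    ∃ s, A' = s * A ∧ B' = s * B ∧ C' = s * C := by
  by_cases hA : A = 0
  · subst hA
    have hB : B = 0 := by simpa using h
    subst hB
    have hC : C ≠ 0 := fun h0 => hne ⟨rfl, rfl, h0⟩
    have hA' : A' = 0 := by simpa [hC, h2] using h'
    subst hA'
    have hB' : B' = 0 := by simpa using h''
    exact ⟨C' / C, by simp, by simp [hB'], by field_simp⟩
  · obtain ⟨s, rfl⟩ : ∃ s, A' = s * A := ⟨A' / A, by field_simp⟩
    have hB : B' = s * B := by
      rw [← sub_eq_zero, ← sq_eq_zero_iff]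
      linear_combination h'' - 2 * s * h' + s ^ 2 * h
    subst hB
    refine ⟨s, rfl, rfl, mul_left_cancel₀ (mul_ne_zero h2 hA) ?_⟩
    linear_combination s * h - h'

theorem exists_root_of_disc (h2 : (2 : K) ≠ 0) (hA : A ≠ 0)
    (h : B * B - 2 * (A * C + A * C) = 0) : ∃ r, B = A * (-2 * r) ∧ C = A * r ^ 2 := by
  refine ⟨-B / (2 * A), by field_simp, ?_⟩
  field_simp
  linear_combination -h

theorem IsEigenform.root (hA : A ≠ 0) (he : e ≠ 0) {r : K}
    (h : IsEigenform α β γ δ e A (A * (-2 * r)) (A * r ^ 2)) (h2 : (2 : K) ≠ 0) :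
    γ * r ^ 2 + (δ - α) * r - β = 0 := by
  have h1 : (α - r * γ) ^ 2 = e := mul_left_cancel₀ hA (by linear_combination h.eq₂)
  have h3 : (α - r * γ) * (β - r * δ) = -(e * r) :=
    mul_left_cancel₀ (mul_ne_zero h2 hA) (by linear_combination h.eq₁)
  have h4 : α - r * γ ≠ 0 := by
    intro h0
    rw [h0] at h1
    exact he (by rw [← h1]; ring)
  refine mul_left_cancel₀ h4 ?_
  linear_combination -h3 - r * h1

end

section
variable {p n q m : ℕ} {k F : Type*} [Field k] [Field F] [Algebra k F] {x y u : F}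
  {A₀ B₀ C₀ A₁ B₁ C₁ : k}

theorem IsGenPair.algEquiv_eq (h : IsGenPair k q m x y) {σ τ : F ≃ₐ[k] F} (hx : σ x = τ x)
    (hy : σ y = τ y) : σ = τ := by
  have h1 : adjoin k {x, y} ≤ IntermediateField.fixedField
      (Subgroup.zpowers (τ⁻¹ * σ)) := by
    rw [adjoin_le_iff]
    have hfix : ∀ z, σ z = τ z → z ∈ IntermediateField.fixedField
        (Subgroup.zpowers (τ⁻¹ * σ)) := by
      intro z hz
      rw [IntermediateField.mem_fixedField_iff]
      intro f hf
      have : Subgroup.zpowers (τ⁻¹ * σ) ≤ MulAction.stabilizer (F ≃ₐ[k] F) z := by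
        rw [Subgroup.zpowers_le, MulAction.mem_stabilizer_iff]
        change τ.symm (σ z) = z
        rw [hz, AlgEquiv.symm_apply_apply]
      exact this hf
    rintro z (rfl | rfl)
    exacts [hfix _ hx, hfix _ hy]
  rw [h.adjoin_eq] at h1
  ext z
  have := (IntermediateField.mem_fixedField_iff _ _).1 (h1 (x := z) trivial) _
    (Subgroup.mem_zpowers _)
  change τ.symm (σ z) = z at this
  rw [← this, AlgEquiv.apply_symm_apply, this]

/-- The automorphism `σ` acts on `x` and `y` through a linear fractional transformation with
coefficients fixed by the `q`-power map. -/
structure IsMobiusAction (q m : ℕ) (x y : F) (σ : F ≃ₐ[k] F) (α β γ δ e : k) : Prop where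
  pow_α : α ^ q = α
  pow_β : β ^ q = β
  pow_γ : γ ^ q = γ
  pow_δ : δ ^ q = δ
  det_ne_zero : α * δ - β * γ ≠ 0
  pow_e : e ^ m = α * δ - β * γ
  map_x : σ x = (algebraMap k F α * x + algebraMap k F β) / (algebraMap k F γ * x + algebraMap k F δ)
  map_y : σ y = algebraMap k F e * y / (algebraMap k F γ * x + algebraMap k F δ) ^ 2

variable {σ τ : F ≃ₐ[k] F} {α β γ δ e α' β' γ' δ' e' : k}

theorem IsMobiusAction.denom_ne_zero (hσ : IsMobiusAction q m x y σ α β γ δ e)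
    (h : IsGenPair k q m x y) : algebraMap k F γ * x + algebraMap k F δ ≠ 0 :=
  h.linear_ne_zero (by
    by_contra! hc
    exact hσ.det_ne_zero (by simp [hc.1, hc.2]))

theorem IsMobiusAction.e_ne_zero (hσ : IsMobiusAction q m x y σ α β γ δ e)
    (hm : m ≠ 0) : e ≠ 0 := by
  rintro rfl
  exact hσ.det_ne_zero (by rw [← hσ.pow_e, zero_pow hm])

theorem quadric_ne_zero (h : IsGenPair k q m x y) (hne : ¬ (A₁ = 0 ∧ B₁ = 0 ∧ C₁ = 0)) :
    algebraMap k F A₁ * x ^ 2 + algebraMap k F B₁ * x + algebraMap k F C₁ ≠ 0 :=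
  fun h0 => hne (h.quadratic_eq_zero h0)

/-- The substitution of a linear fractional transformation in a quadratic polynomial. -/
theorem quadric_subst {P Q A B C α β γ δ : F} {z : F} (hQ : Q ≠ 0) (hP : P = α * z + β)
    (hQ' : Q = γ * z + δ) :
    A * (P / Q) ^ 2 + B * (P / Q) + C =
      ((A * α ^ 2 + B * (α * γ) + C * γ ^ 2) * z ^ 2 +
        (2 * A * (α * β) + B * (α * δ + β * γ) + 2 * C * (γ * δ)) * z +
        (A * β ^ 2 + B * (β * δ) + C * δ ^ 2)) / Q ^ 2 := by
  rw [eq_div_iff (pow_ne_zero 2 hQ)]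
  have : (A * (P / Q) ^ 2 + B * (P / Q) + C) * Q ^ 2 = A * P ^ 2 + B * (P * Q) + C * Q ^ 2 := by
    field_simp
  rw [this, hP, hQ']
  ring

theorem IsMobiusAction.isEigenform [IsAlgClosed k] [CharP k p]
    (hE : ExponentData p n q m) (h : IsGenPair k q m x y)
    (hne : ¬ (A₁ = 0 ∧ B₁ = 0 ∧ C₁ = 0))
    (hu : u = (y + (algebraMap k F A₀ * x ^ 2 + algebraMap k F B₀ * x + algebraMap k F C₀)) /
      (algebraMap k F A₁ * x ^ 2 + algebraMap k F B₁ * x + algebraMap k F C₁))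
    (hσ : IsMobiusAction q m x y σ α β γ δ e) (hσu : σ u = u) :
    IsEigenform α β γ δ e A₀ B₀ C₀ ∧ IsEigenform α β γ δ e A₁ B₁ C₁ := by
  have hD := hσ.denom_ne_zero h
  have hQ := quadric_ne_zero h hne
  have hQ' := (map_ne_zero_iff σ σ.injective).2 hQ
  have hσu' := hσu
  rw [hu] at hσu'
  simp only [map_div₀, map_add, map_mul, map_pow, AlgEquiv.commutes] at hσu' hQ'
  rw [div_eq_div_iff hQ' hQ, hσ.map_x, hσ.map_y, quadric_subst hD rfl rfl, quadric_subst hD rfl rfl,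
    ← add_div, div_mul_eq_mul_div, mul_div_assoc', div_left_inj' (pow_ne_zero 2 hD)] at hσu'
  let P₀ : k[X] := C A₀ * X ^ 2 + C B₀ * X + C C₀
  let P₁ : k[X] := C A₁ * X ^ 2 + C B₁ * X + C C₁
  let R₀ : k[X] := C (A₀ * α ^ 2 + B₀ * (α * γ) + C₀ * γ ^ 2) * X ^ 2 +
    C (2 * A₀ * (α * β) + B₀ * (α * δ + β * γ) + 2 * C₀ * (γ * δ)) * X +
    C (A₀ * β ^ 2 + B₀ * (β * δ) + C₀ * δ ^ 2)
  let R₁ : k[X] := C (A₁ * α ^ 2 + B₁ * (α * γ) + C₁ * γ ^ 2) * X ^ 2 +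
    C (2 * A₁ * (α * β) + B₁ * (α * δ + β * γ) + 2 * C₁ * (γ * δ)) * X +
    C (A₁ * β ^ 2 + B₁ * (β * δ) + C₁ * δ ^ 2)
  obtain ⟨h1, h2⟩ := h.aeval_add_aeval_mul_eq_zero hE (P := R₀ * P₁ - P₀ * R₁)
    (Q := C e * P₁ - R₁) (by
      simp only [P₀, P₁, R₀, R₁, map_add, map_sub, map_mul, map_pow, aeval_X, aeval_C, map_ofNat]
      linear_combination hσu')
  have hP₁ : P₁ ≠ 0 := by
    intro h0
    apply hQ
    simpa [P₁] using congrArg (aeval x) h0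
  have h3 : R₀ - C e * P₀ = 0 := by
    refine mul_right_cancel₀ hP₁ ?_
    linear_combination h1 - P₀ * h2
  have h4 : R₁ - C e * P₁ = 0 := by linear_combination -h2
  have key : ∀ A B D A' B' D' : k, C A * X ^ 2 + C B * X + C D - C e * (C A' * X ^ 2 + C B' * X + C D') = 0 →
      A = e * A' ∧ B = e * B' ∧ D = e * D' := by
    intro A B D A' B' D' h0
    have := coeffs_eq_zero_of_quadratic (A := A - e * A') (B := B - e * B') (D := D - e * D') (by
      simp only [map_sub, map_mul]
      linear_combination h0)
    simpa only [sub_eq_zero] using this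
  obtain ⟨e1, e2, e3⟩ := key _ _ _ _ _ _ h3
  obtain ⟨f1, f2, f3⟩ := key _ _ _ _ _ _ h4
  exact ⟨⟨e1, e2, e3⟩, ⟨f1, f2, f3⟩⟩

/-- A nontrivial automorphism which has a nonzero eigenform is not given by a scalar matrix. -/
theorem IsMobiusAction.not_scalar (h : IsGenPair k q m x y) (hne : ¬ (A₁ = 0 ∧ B₁ = 0 ∧ C₁ = 0))
    (hσ : IsMobiusAction q m x y σ α β γ δ e) (h₁ : IsEigenform α β γ δ e A₁ B₁ C₁)
    (hσ1 : σ ≠ 1) : ¬ (γ = 0 ∧ δ - α = 0 ∧ β = 0) := by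
  rintro ⟨rfl, hδ, rfl⟩
  obtain rfl : α = δ := by linear_combination -hδ
  have hα : α ≠ 0 := fun h0 => hσ.det_ne_zero (by simp [h0])
  have he : e = α ^ 2 := by
    by_contra hc
    have hc' : α ^ 2 - e ≠ 0 := _root_.sub_ne_zero.2 (Ne.symm hc)
    exact hne ⟨mul_left_cancel₀ hc' (by linear_combination h₁.eq₂),
      mul_left_cancel₀ hc' (by linear_combination h₁.eq₁),
      mul_left_cancel₀ hc' (by linear_combination h₁.eq₀)⟩
  have hα' : algebraMap k F α ≠ 0 := by simpa using hα
  apply hσ1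
  apply h.algEquiv_eq
  · rw [hσ.map_x]
    simp [hα]
  · rw [hσ.map_y, he]
    simp [hα]

/-- Quadratic polynomials which, up to a scalar, are either fixed by the `q`-power map on
coefficients or the square of a linear polynomial with root fixed by the `q²`-power map only. -/
def IsSpecialQuadric (q : ℕ) (A B C : k) : Prop :=
  (∃ s a b c, a ^ q = a ∧ b ^ q = b ∧ c ^ q = c ∧ A = s * a ∧ B = s * b ∧ C = s * c) ∨
    ∃ s α, α ^ q ^ 2 = α ∧ α ^ q ≠ α ∧ A = s ∧ B = s * (-2 * α) ∧ C = s * α ^ 2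

/-- A quadratic polynomial with coefficients fixed by the `q`-power map has its roots in the
quadratic extension; the conjugate of a root that is not fixed is the other root. -/
theorem pow_pow_eq_of_root [CharP k p] [Fact p.Prime] (hE : ExponentData p n q m) {a b c r : k}
    (ha : a ^ q = a) (hb : b ^ q = b) (hc : c ^ q = c) (ha0 : a ≠ 0)
    (hr : a * r ^ 2 + b * r + c = 0) (hrq : r ^ q ≠ r) :
    a * (r + r ^ q) + b = 0 ∧ (r ^ q) ^ q = r := by
  have h1 : a * (r ^ q) ^ 2 + b * r ^ q + c = 0 := by
    have := congrArg (· ^ q) hr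
    simp only [hE.add_pow, mul_pow, ha, hb, hc, zero_pow (show q ≠ 0 by have := hE.one_lt; omega)] at this
    rw [← this]
    ring
  have h2 : a * (r + r ^ q) + b = 0 := by
    refine mul_left_cancel₀ (_root_.sub_ne_zero.2 hrq) ?_
    linear_combination h1 - hr
  refine ⟨h2, ?_⟩
  have h3 : a * (r ^ q + (r ^ q) ^ q) + b = 0 := by
    have := congrArg (· ^ q) h2
    simpa only [hE.add_pow, mul_pow, ha, hb, hc,
      zero_pow (show q ≠ 0 by have := hE.one_lt; omega)] using this
  refine mul_left_cancel₀ ha0 ?_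
  linear_combination h3 - h2

theorem IsMobiusAction.special [CharP k p] [Fact p.Prime]
    (hE : ExponentData p n q m) (hne : ¬ (A₁ = 0 ∧ B₁ = 0 ∧ C₁ = 0))
    (hσ : IsMobiusAction q m x y σ α β γ δ e) (h₀ : IsEigenform α β γ δ e A₀ B₀ C₀)
    (h₁ : IsEigenform α β γ δ e A₁ B₁ C₁) (hns : ¬ (γ = 0 ∧ δ - α = 0 ∧ β = 0))
    (hns' : ¬ (α + δ = 0 ∧ e = -(α * δ - β * γ))) :
    (∃ s, A₀ = s * A₁ ∧ B₀ = s * B₁ ∧ C₀ = s * C₁) ∧ IsSpecialQuadric q A₁ B₁ C₁ := by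
  have h2 := hE.two_ne_zero k
  have hq := hE.one_lt
  have he0 : e ≠ 0 := hσ.e_ne_zero (by have := hE.three_le; omega)
  have hδα : (δ - α) ^ q = δ - α := by rw [hE.sub_pow, hσ.pow_δ, hσ.pow_α]
  have hβ : (-β) ^ q = -β := by rw [hE.neg_pow, hσ.pow_β]
  by_cases he : e = α * δ - β * γ
  · subst he
    obtain ⟨s, rfl, rfl, rfl⟩ := h₁.exists_eq_mul h2 hσ.det_ne_zero hns
    obtain ⟨t, rfl, rfl, rfl⟩ := h₀.exists_eq_mul h2 hσ.det_ne_zero hns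
    have hs : s ≠ 0 := by
      rintro rfl
      simp at hne
    exact ⟨⟨t / s, by field_simp, by field_simp, by field_simp⟩,
      Or.inl ⟨s, _, _, _, hσ.pow_γ, hδα, hβ, rfl, rfl, rfl⟩⟩
  · have he' : e ≠ -(α * δ - β * γ) := by
      rintro rfl
      exact hns' ⟨h₁.add_eq_zero h2 hσ.det_ne_zero hne, rfl⟩
    refine ⟨exists_eq_mul_of_disc h2 hne (h₁.disc_eq_zero h₁ he he') (h₁.disc_eq_zero h₀ he he')
      (h₀.disc_eq_zero h₀ he he'), ?_⟩
    have hd := h₁.disc_eq_zero h₁ he he'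
    by_cases hA : A₁ = 0
    · have hB : B₁ = 0 := by simpa [hA] using hd
      exact Or.inl ⟨C₁, 0, 0, 1, zero_pow (by omega), zero_pow (by omega), one_pow q, by simp [hA],
        by simp [hB], by simp⟩
    · obtain ⟨r, rfl, rfl⟩ := exists_root_of_disc h2 hA hd
      have hr := IsEigenform.root hA he0 h₁ h2
      by_cases hrq : r ^ q = r
      · refine Or.inl ⟨A₁, 1, -2 * r, r ^ 2, one_pow q, ?_, ?_, by simp, rfl, rfl⟩
        · have h2q : (2 : k) ^ q = 2 := by rw [← one_add_one_eq_two, hE.add_pow, one_pow]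
          rw [mul_pow, hrq, hE.neg_pow, h2q]
        · rw [← pow_mul, mul_comm, pow_mul, hrq]
      · have hγ : γ ≠ 0 := by
          rintro rfl
          by_cases hδ0 : δ - α = 0
          · exact hns ⟨rfl, hδ0, by linear_combination r * hδ0 - hr⟩
          · apply hrq
            have : r = β / (δ - α) := by
              field_simp
              linear_combination hr
            rw [this, div_pow, hσ.pow_β, hδα]
        obtain ⟨-, h3⟩ := pow_pow_eq_of_root hE hσ.pow_γ hδα hβ hγ (by linear_combination hr) hrq
        exact Or.inr ⟨A₁, r, by rw [pow_two, pow_mul, h3], hrq, rfl, rfl, rfl⟩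

end

section
variable {p n q m : ℕ} {k F : Type*} [Field k] [Field F] [Algebra k F] {x y u : F}
  {A₀ B₀ C₀ A₁ B₁ C₁ : k}
variable {σ τ : F ≃ₐ[k] F} {α β γ δ e α' β' γ' δ' e' : k}

theorem IsMobiusAction.special_of_pair [CharP k p] [Fact p.Prime]
    (hE : ExponentData p n q m) (h : IsGenPair k q m x y) (hne : ¬ (A₁ = 0 ∧ B₁ = 0 ∧ C₁ = 0))
    (hσ : IsMobiusAction q m x y σ α β γ δ e) (hτ : IsMobiusAction q m x y τ α' β' γ' δ' e')
    (hs : α + δ = 0 ∧ e = -(α * δ - β * γ)) (ht : α' + δ' = 0 ∧ e' = -(α' * δ' - β' * γ'))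
    (h₀ : IsEigenform α β γ δ e A₀ B₀ C₀) (h₁ : IsEigenform α β γ δ e A₁ B₁ C₁)
    (h₀' : IsEigenform α' β' γ' δ' e' A₀ B₀ C₀) (h₁' : IsEigenform α' β' γ' δ' e' A₁ B₁ C₁)
    (hne' : σ ≠ τ) :
    (∃ s, A₀ = s * A₁ ∧ B₀ = s * B₁ ∧ C₀ = s * C₁) ∧ IsSpecialQuadric q A₁ B₁ C₁ := by
  have h2 := hE.two_ne_zero k
  have hΔ := hσ.det_ne_zero
  have hΔ' := hτ.det_ne_zero
  obtain ⟨hs, rfl⟩ := hs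
  obtain ⟨ht, rfl⟩ := ht
  obtain rfl : δ = -α := by linear_combination hs
  obtain rfl : δ' = -α' := by linear_combination ht
  have hdet : (α * α' + β * γ') * (γ * β' + -α * -α') - (α * β' + β * -α') * (γ * α' + -α * γ') =
      -(α * -α - β * γ) * -(α' * -α' - β' * γ') := by ring
  have m₀ := h₀.mul h₀'
  have m₁ := h₁.mul h₁'
  rw [← hdet] at m₀ m₁
  have hns : ¬ (γ * α' + -α * γ' = 0 ∧ (γ * β' + -α * -α') - (α * α' + β * γ') = 0 ∧
      α * β' + β * -α' = 0) := by
    rintro ⟨g1, g2, g3⟩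
    obtain ⟨t, rfl, rfl, rfl⟩ : ∃ t, α = t * α' ∧ β = t * β' ∧ γ = t * γ' := by
      obtain ⟨t, ht⟩ : ∃ t, t * (α' * -α' - β' * γ') = -(α * α' + β * γ') :=
        ⟨_, div_mul_cancel₀ _ hΔ'⟩
      refine ⟨t, mul_left_cancel₀ hΔ' ?_, mul_left_cancel₀ hΔ' ?_, mul_left_cancel₀ hΔ' ?_⟩
      · linear_combination -γ' * g3 - α' * ht
      · linear_combination α' * g3 - β' * ht
      · linear_combination -α' * g1 - γ' * g2 - γ' * ht
    have ht0 : t ≠ 0 := by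
      rintro rfl
      simp at hΔ
    have hD := hτ.denom_ne_zero h
    have hx : σ x = τ x := by
      rw [hσ.map_x, hτ.map_x]
      have : algebraMap k F t ≠ 0 := by simpa using ht0
      have e1 : algebraMap k F (t * γ') * x + algebraMap k F (-(t * α')) =
          algebraMap k F t * (algebraMap k F γ' * x + algebraMap k F (-α')) := by
        simp only [map_mul, map_neg]
        ring
      have e2 : algebraMap k F (t * α') * x + algebraMap k F (t * β') =
          algebraMap k F t * (algebraMap k F α' * x + algebraMap k F β') := by
        simp only [map_mul]
        ring
      rw [e1, e2, mul_div_mul_left _ _ this]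
    have hy : σ y = τ y := by
      rw [hσ.map_y, hτ.map_y]
      have : algebraMap k F t ≠ 0 := by simpa using ht0
      have e1 : algebraMap k F (t * γ') * x + algebraMap k F (-(t * α')) =
          algebraMap k F t * (algebraMap k F γ' * x + algebraMap k F (-α')) := by
        simp only [map_mul, map_neg]
        ring
      have e2 : -(t * α' * -(t * α') - t * β' * (t * γ')) = t ^ 2 * -(α' * -α' - β' * γ') := by ring
      rw [e1, e2, map_mul, map_pow, mul_pow, mul_assoc, mul_div_mul_left _ _ (pow_ne_zero 2 this)]
    exact hne' (h.algEquiv_eq hx hy)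
  have hΔΔ : (α * α' + β * γ') * (γ * β' + -α * -α') - (α * β' + β * -α') * (γ * α' + -α * γ') ≠ 0 := by
    rw [hdet]
    exact mul_ne_zero (neg_ne_zero.2 hΔ) (neg_ne_zero.2 hΔ')
  obtain ⟨s, rfl, rfl, rfl⟩ := m₁.exists_eq_mul h2 hΔΔ hns
  obtain ⟨t, rfl, rfl, rfl⟩ := m₀.exists_eq_mul h2 hΔΔ hns
  have hs0 : s ≠ 0 := by
    rintro rfl
    simp at hne
  refine ⟨⟨t / s, by field_simp, by field_simp, by field_simp⟩,
    Or.inl ⟨s, _, _, _, ?_, ?_, ?_, rfl, rfl, rfl⟩⟩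
  all_goals
    simp only [hE.add_pow, hE.sub_pow, hE.neg_pow, mul_pow, hσ.pow_α, hσ.pow_β, hσ.pow_γ,
      hτ.pow_α, hτ.pow_β, hτ.pow_γ]

/-- The Fermat equation has no nonconstant solutions in a rational function field. -/
theorem not_transcendental_of_pow_eq [IsAlgClosed k] {N : ℕ} (hN : 3 ≤ N) (hNk : (N : k) ≠ 0)
    {u S Y : F} (hu : Transcendental k u) (hS : S ∈ k⟮u⟯) (hY : Y ∈ k⟮u⟯) (hY0 : Y ≠ 0)
    (h : Y ^ N = S ^ N - 1) : IsAlgebraic k S := by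
  by_cases hS0 : S = 0
  · rw [hS0]
    exact isAlgebraic_zero
  obtain ⟨P, Q, rfl⟩ := (mem_adjoin_simple_iff k S).1 hS
  obtain ⟨P', Q', rfl⟩ := (mem_adjoin_simple_iff k Y).1 hY
  have hinj := transcendental_iff_injective.1 hu
  rw [← ne_eq, div_ne_zero_iff] at hS0
  rw [div_ne_zero_iff] at hY0
  have h0 {R : k[X]} (hR : aeval u R ≠ 0) : R ≠ 0 := by
    rintro rfl
    simp at hR
  have heq : (P' * Q) ^ N + (Q * Q') ^ N = (P * Q') ^ N := by
    apply hinj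
    rw [div_pow, div_pow, div_sub_one (pow_ne_zero _ hS0.2),
      div_eq_div_iff (pow_ne_zero _ hY0.2) (pow_ne_zero _ hS0.2)] at h
    simp only [map_add, map_mul, map_pow, mul_pow]
    linear_combination h
  obtain ⟨d, a', b', c', ⟨ha, hb, hc⟩, hua, hub, huc⟩ :=
    fermatLastTheoremWith'_polynomial hN hNk _ _ _ (mul_ne_zero (h0 hY0.1) (h0 hS0.2))
      (mul_ne_zero (h0 hS0.2) (h0 hY0.2)) (mul_ne_zero (h0 hS0.1) (h0 hY0.2)) heq
  obtain ⟨b, hb0, rfl⟩ := Polynomial.isUnit_iff.1 hub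
  obtain ⟨c, hc0, rfl⟩ := Polynomial.isUnit_iff.1 huc
  have hd : aeval u d ≠ 0 := by
    intro hd
    have := congrArg (aeval u) hb
    rw [map_mul, map_mul, hd, mul_zero] at this
    exact mul_ne_zero hS0.2 hY0.2 this
  have hbF : algebraMap k F b ≠ 0 := by simpa using hb0.ne_zero
  have : aeval u P / aeval u Q = algebraMap k F (c / b) := by
    have e1 := congrArg (aeval u) hb
    have e2 := congrArg (aeval u) hc
    simp only [map_mul, aeval_C] at e1 e2
    rw [map_div₀, div_eq_div_iff hS0.2 hbF]
    refine mul_right_cancel₀ (mul_ne_zero hd hY0.2) ?_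
    linear_combination algebraMap k F b * aeval u d * e2 - algebraMap k F c * aeval u d * e1
  rw [this]
  exact isAlgebraic_algebraMap _

end

section
variable {p n q m : ℕ} {k F : Type*} [Field k] [Field F] [Algebra k F] {x y u : F}
  {A₀ B₀ C₀ A₁ B₁ C₁ : k}
variable {σ τ : F ≃ₐ[k] F} {α β γ δ e : k}

/-- The quotient by the involution fixing two conjugate points over the quadratic extension is a
Fermat curve, so it is not rational. -/
theorem IsGenPair.false_of_mem_adjoin [IsAlgClosed k] [CharP k p] [Fact p.Prime]
    (hE : ExponentData p n q m) (h : IsGenPair k q m x y) {r : k} (hr : r ^ q ≠ r)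
    (hrr : (r ^ q) ^ q = r)
    (hT : ((x - algebraMap k F r) / (x - algebraMap k F (r ^ q))) ^ 2 ∈ k⟮u⟯)
    (hY : y / (x - algebraMap k F (r ^ q)) ^ 2 ∈ k⟮u⟯) : False := by
  have hFp : CharP F p := charP_of_injective_algebraMap (algebraMap k F).injective p
  have h3 := hE.three_le
  set r' := r ^ q with hr'
  have hx' := h.sub_ne_zero r'
  have hy0 := h.ne_zero hE
  obtain ⟨c, hc⟩ := IsAlgClosed.exists_pow_nat_eq (r' - r) (show 0 < m by omega)
  have hc0 : c ≠ 0 := by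
    rintro rfl
    rw [zero_pow (by omega)] at hc
    exact hr (sub_eq_zero.1 hc.symm)
  set S := ((x - algebraMap k F r) / (x - algebraMap k F r')) ^ 2 with hS
  have hSalg : IsAlgebraic k S := by
    by_cases hu : IsAlgebraic k u
    · have := isAlgebraic_adjoin_simple hu.isIntegral
      exact (Algebra.IsAlgebraic.isAlgebraic (R := k) (⟨S, hT⟩ : k⟮u⟯)).algHom k⟮u⟯.val
    · refine not_transcendental_of_pow_eq h3 (hE.cast_m_ne_zero k) hu hT
        (Y := algebraMap k F c * (y / (x - algebraMap k F r') ^ 2)) ?_ ?_ ?_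
      · exact mul_mem (k⟮u⟯.algebraMap_mem c) hY
      · exact mul_ne_zero (by simpa using hc0) (div_ne_zero hy0 (pow_ne_zero 2 hx'))
      · have e1 : (x - algebraMap k F r) ^ (2 * m) =
            (x ^ q - algebraMap k F r') * (x - algebraMap k F r) := by
          rw [hE.two_mul, pow_succ, hE.sub_pow, ← map_pow]
        have e2 : (x - algebraMap k F r') ^ (2 * m) =
            (x ^ q - algebraMap k F r) * (x - algebraMap k F r') := by
          rw [hE.two_mul, pow_succ, hE.sub_pow, ← map_pow, hrr]
        have hx2 := pow_ne_zero (2 * m) hx'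
        rw [hS, mul_pow, div_pow, ← pow_mul, ← pow_mul, div_pow, h.pow_eq, ← map_pow, hc,
          div_sub_one hx2, mul_div_assoc', e1, e2, map_sub]
        congr 1
        ring
  obtain ⟨s, hs⟩ := hSalg.isIntegral.mem_range_of_isAlgClosed
  rw [hS, div_pow, div_eq_iff (pow_ne_zero 2 hx')] at hs
  obtain ⟨g1, g2, -⟩ := h.quadratic_eq_zero (A := 1 - s) (B := -2 * r + 2 * s * r')
    (D := r ^ 2 - s * r' ^ 2) (by
      simp only [map_sub, map_add, map_mul, map_pow, map_neg, map_one, map_ofNat]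
      linear_combination hs)
  apply hr
  refine mul_left_cancel₀ (hE.two_ne_zero k) ?_
  linear_combination g2 + 2 * r' * g1

theorem IsGenPair.exists_ne_one_of_isGalois [IsAlgClosed k] [CharP k p] [Fact p.Prime]
    (hE : ExponentData p n q m) (h : IsGenPair k q m x y) [IsGalois k⟮u⟯ F] :
    ∃ σ : F ≃ₐ[k] F, σ u = u ∧ σ ≠ 1 := by
  have hq := hE.one_lt
  by_contra! hc
  obtain ⟨r, hr⟩ := IsAlgClosed.exists_pow_nat_eq (-1 : k) (show 0 < q - 1 by omega)
  have hrq : r ^ q = -r := by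
    rw [← Nat.sub_add_cancel (show 1 ≤ q by omega), pow_succ, hr, neg_one_mul]
  have hr0 : r ≠ 0 := by
    rintro rfl
    rw [zero_pow (by omega)] at hr
    simp at hr
  have hmem (f : F) : f ∈ k⟮u⟯ := mem_adjoin_simple_of_forall_fixed fun σ hσ => by
    rw [hc σ hσ, AlgEquiv.one_apply]
  refine h.false_of_mem_adjoin hE (r := r) ?_ ?_ (hmem _) (hmem _)
  · rw [hrq]
    intro h0
    exact mul_ne_zero (hE.two_ne_zero k) hr0 (by linear_combination -h0)
  · rw [hrq, hE.neg_pow, hrq, neg_neg]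

theorem IsMobiusAction.false_of_forall_eq [IsAlgClosed k] [CharP k p] [Fact p.Prime]
    (hE : ExponentData p n q m) (h : IsGenPair k q m x y) [IsGalois k⟮u⟯ F]
    (hσ : IsMobiusAction q m x y σ α β γ δ e) (ht : α + δ = 0 ∧ e = -(α * δ - β * γ))
    (hall : ∀ τ : F ≃ₐ[k] F, τ u = u → τ = 1 ∨ τ = σ) : False := by
  have hq := hE.one_lt
  have h2 := hE.two_ne_zero k
  have hD := hσ.denom_ne_zero h
  obtain ⟨hδ, he⟩ := ht
  obtain rfl : δ = -α := by linear_combination hδ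
  obtain ⟨l, hl⟩ := IsAlgClosed.exists_pow_nat_eq e (show 0 < 2 by omega)
  have hlq : l ^ q ≠ l := by
    intro h0
    have h1 := hσ.pow_e
    rw [← hl, ← pow_mul, hE.two_mul, pow_succ, h0, ← pow_two, hl] at h1
    apply mul_ne_zero h2 hσ.det_ne_zero
    linear_combination he - h1
  have hγ : γ ≠ 0 := by
    rintro rfl
    have : l ^ 2 = α ^ 2 := by
      rw [hl, he]
      ring
    rcases sq_eq_sq_iff_eq_or_eq_neg.1 this with rfl | rfl
    · exact hlq hσ.pow_α
    · exact hlq (by rw [hE.neg_pow, hσ.pow_α])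
  obtain ⟨r, hlr⟩ : ∃ r, l = γ * r - α := ⟨(l + α) / γ, by
    field_simp
    ring⟩
  have hrq : r ^ q ≠ r := by
    intro h0
    apply hlq
    rw [hlr, hE.sub_pow, mul_pow, hσ.pow_γ, hσ.pow_α, h0]
  have hroot : γ * r ^ 2 + (-α - α) * r + -β = 0 := by
    refine mul_left_cancel₀ hγ ?_
    rw [hlr] at hl
    linear_combination hl + he
  obtain ⟨g1, g2⟩ := pow_pow_eq_of_root hE hσ.pow_γ
    (by rw [hE.sub_pow, hE.neg_pow, hσ.pow_α]) (by rw [hE.neg_pow, hσ.pow_β]) hγ hroot hrq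
  have hmap : ∀ s, γ * s ^ 2 + (-α - α) * s + -β = 0 → σ (x - algebraMap k F s) =
      algebraMap k F (α - γ * s) * (x - algebraMap k F s) /
        (algebraMap k F γ * x + algebraMap k F (-α)) := by
    intro s hs
    rw [map_sub, AlgEquiv.commutes, hσ.map_x, div_sub' hD]
    congr 1
    have := congrArg (algebraMap k F) hs
    simp only [map_add, map_mul, map_sub, map_neg, map_pow, map_zero] at this ⊢
    linear_combination -this
  have hroot' : γ * (r ^ q) ^ 2 + (-α - α) * r ^ q + -β = 0 := by
    linear_combination hroot + (r ^ q - r) * g1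
  have hl0 : l ≠ 0 := by
    intro h0
    apply hlq
    rw [h0, zero_pow (by omega)]
  have el : α - γ * r = -l := by linear_combination hlr
  have el' : α - γ * r ^ q = l := by linear_combination -hlr - g1
  have hlF : algebraMap k F l ≠ 0 := by simpa using hl0
  have hx := h.sub_ne_zero r
  have hx' := h.sub_ne_zero (r ^ q)
  refine h.false_of_mem_adjoin (u := u) hE hrq g2 (mem_adjoin_simple_of_forall_fixed fun τ hτ => ?_)
    (mem_adjoin_simple_of_forall_fixed fun τ hτ => ?_)
  · rcases hall τ hτ with rfl | rfl
    · rfl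
    · rw [map_pow, map_div₀, hmap r hroot, hmap _ hroot', el, el', map_neg _ l]
      generalize algebraMap k F γ * x + algebraMap k F (-α) = D at hD ⊢
      field_simp
  · rcases hall τ hτ with rfl | rfl
    · rfl
    · rw [map_div₀, map_pow, hmap _ hroot', el', hσ.map_y, ← hl, map_pow]
      field_simp

/-- If the projection from a line missing the point `(0 : 1 : 0 : 0)` induces a Galois extension,
then the line lies in the plane `Y = 0` and is cut out on it by a special quadric. -/
theorem IsGenPair.special_of_isGalois [IsAlgClosed k] [CharP k p] [Fact p.Prime] [CharP F p]
    (hE : ExponentData p n q m) (h : IsGenPair k q m x y)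
    (hne : ¬ (A₁ = 0 ∧ B₁ = 0 ∧ C₁ = 0))
    (hu : u = (y + (algebraMap k F A₀ * x ^ 2 + algebraMap k F B₀ * x + algebraMap k F C₀)) /
      (algebraMap k F A₁ * x ^ 2 + algebraMap k F B₁ * x + algebraMap k F C₁))
    (hG : IsGalois k⟮u⟯ F) :
    (∃ s, A₀ = s * A₁ ∧ B₀ = s * B₁ ∧ C₀ = s * C₁) ∧ IsSpecialQuadric q A₁ B₁ C₁ := by
  have hact (σ : F ≃ₐ[k] F) : ∃ α β γ δ e, IsMobiusAction q m x y σ α β γ δ e := by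
    obtain ⟨α, β, γ, δ, e, h1, h2, h3, h4, h5, h6, h7, h8⟩ := h.exists_mobius hE (h.map σ)
    exact ⟨α, β, γ, δ, e, h1, h2, h3, h4, h5, h6, h7, h8⟩
  by_contra hcon
  have hinv {σ : F ≃ₐ[k] F} (hσu : σ u = u) (hσ1 : σ ≠ 1) {α β γ δ e : k}
      (hσ : IsMobiusAction q m x y σ α β γ δ e) : α + δ = 0 ∧ e = -(α * δ - β * γ) := by
    by_contra hns'
    obtain ⟨h₀, h₁⟩ := hσ.isEigenform hE h hne hu hσu
    exact hcon (hσ.special hE hne h₀ h₁ (hσ.not_scalar h hne h₁ hσ1) hns')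
  obtain ⟨σ, hσu, hσ1⟩ := h.exists_ne_one_of_isGalois (u := u) hE
  obtain ⟨α, β, γ, δ, e, hσ⟩ := hact σ
  have ht := hinv hσu hσ1 hσ
  refine hσ.false_of_forall_eq (u := u) hE h ht fun τ hτu => ?_
  by_contra! hτ
  obtain ⟨α', β', γ', δ', e', hτ'⟩ := hact τ
  have ht' := hinv hτu hτ.1 hτ'
  obtain ⟨h₀, h₁⟩ := hσ.isEigenform hE h hne hu hσu
  obtain ⟨h₀', h₁'⟩ := hτ'.isEigenform hE h hne hu hτu
  exact hcon (hσ.special_of_pair hE h hne hτ' ht ht' h₀ h₁ h₀' h₁' hτ.2.symm)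

end

section
variable {p n q m : ℕ} {k L : Type*} [Field k] [Field L] [Algebra k L] {x t : L}

theorem exists_eq_mul_of_fermat_eq [IsAlgClosed k] {N : ℕ} (hN : 0 < N) {a b a' b' : L}
    (hb : b ≠ 0) (ha' : a' ≠ 0) (hb' : b' ≠ 0)
    (h : (a ^ (2 * N) - b ^ (2 * N)) * (a' * b') ^ N =
      (a' ^ (2 * N) - b' ^ (2 * N)) * (a * b) ^ N) :
    ∃ c : k, a * b' = algebraMap k L c * (a' * b) ∨ a * a' = algebraMap k L c * (b * b') := by
  have h0 : ((a * b') ^ N - (a' * b) ^ N) * ((a * a') ^ N + (b * b') ^ N) = 0 := by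
    simp only [mul_pow, mul_comm 2 N, pow_mul] at h ⊢
    linear_combination h
  rcases mul_eq_zero.1 h0 with h1 | h1
  · have hab := mul_ne_zero ha' hb
    obtain ⟨c, hc, -⟩ := exists_algebraMap_eq_of_pow_eq_one (k := k) hN (t := a * b' / (a' * b)) (by
      rw [div_pow, div_eq_one_iff_eq (pow_ne_zero N hab)]
      linear_combination h1)
    exact ⟨c, Or.inl (by rw [← hc, div_mul_cancel₀ _ hab])⟩
  · have hbb := mul_ne_zero hb hb'
    obtain ⟨c, hc, -⟩ := exists_algebraMap_eq_of_pow_eq_one (k := k) (N := N * 2) (by omega)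
      (t := a * a' / (b * b')) (by
      rw [div_pow, div_eq_one_iff_eq (pow_ne_zero _ hbb), pow_mul, pow_mul,
        eq_neg_of_add_eq_zero_left h1, neg_sq])
    exact ⟨c, Or.inr (by rw [← hc, div_mul_cancel₀ _ hbb])⟩

theorem IntermediateField.mem_of_mul_eq {K : IntermediateField k L} {a b : L} (ha : a ∈ K)
    (hb : b ∈ K) (h : t * a = b) (hne : a = 0 → b ≠ 0) : t ∈ K := by
  have ha0 : a ≠ 0 := fun h0 => hne h0 (by rw [← h, h0, mul_zero])
  rw [eq_div_of_mul_eq ha0 h]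
  exact K.div_mem hb ha

theorem mem_of_fermat_eq_sub [IsAlgClosed k] {N : ℕ} (hN : 0 < N) {K : IntermediateField k L}
    (hx : x ∈ K) {r r' : k} (hr : r ≠ r')
    (hxr : x - algebraMap k L r ≠ 0) (hxr' : x - algebraMap k L r' ≠ 0)
    (htr : t - algebraMap k L r ≠ 0) (htr' : t - algebraMap k L r' ≠ 0)
    (h : ((x - algebraMap k L r) ^ (2 * N) - (x - algebraMap k L r') ^ (2 * N)) *
        ((t - algebraMap k L r) * (t - algebraMap k L r')) ^ N =
      ((t - algebraMap k L r) ^ (2 * N) - (t - algebraMap k L r') ^ (2 * N)) *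
        ((x - algebraMap k L r) * (x - algebraMap k L r')) ^ N) : t ∈ K := by
  have hrr : algebraMap k L r - algebraMap k L r' ≠ 0 := by
    rw [← map_sub]
    exact (_root_.map_ne_zero _).2 (sub_ne_zero.2 hr)
  have hK (c : k) : algebraMap k L c ∈ K := K.algebraMap_mem c
  obtain ⟨c, hc | hc⟩ := exists_eq_mul_of_fermat_eq (k := k) hN hxr' htr htr' h
  · refine IntermediateField.mem_of_mul_eq (K := K)
      (a := (x - algebraMap k L r) - algebraMap k L c * (x - algebraMap k L r'))
      (b := algebraMap k L r' * (x - algebraMap k L r) -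
        algebraMap k L c * algebraMap k L r * (x - algebraMap k L r')) ?_ ?_ ?_ ?_
    · exact sub_mem (sub_mem hx (hK _)) (mul_mem (hK _) (sub_mem hx (hK _)))
    · exact sub_mem (mul_mem (hK _) (sub_mem hx (hK _)))
        (mul_mem (mul_mem (hK _) (hK _)) (sub_mem hx (hK _)))
    · linear_combination hc
    · intro h1 h2
      refine mul_ne_zero hrr hxr ?_
      linear_combination algebraMap k L r * h1 - h2
  · refine IntermediateField.mem_of_mul_eq (K := K)
      (a := (x - algebraMap k L r) - algebraMap k L c * (x - algebraMap k L r'))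
      (b := algebraMap k L r * (x - algebraMap k L r) -
        algebraMap k L c * algebraMap k L r' * (x - algebraMap k L r')) ?_ ?_ ?_ ?_
    · exact sub_mem (sub_mem hx (hK _)) (mul_mem (hK _) (sub_mem hx (hK _)))
    · exact sub_mem (mul_mem (hK _) (sub_mem hx (hK _)))
        (mul_mem (mul_mem (hK _) (hK _)) (sub_mem hx (hK _)))
    · linear_combination hc
    · intro h1 h2
      refine mul_ne_zero hrr hxr ?_
      linear_combination h2 - algebraMap k L r' * h1

variable [IsAlgClosed k] [CharP L p] [Fact p.Prime] {K : IntermediateField k L} {r r' : k}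

theorem mem_of_eq_split_linear (hE : ExponentData p n q m) (hx : x ∈ K) (hr : r ^ q = r)
    (hxr : x - algebraMap k L r ≠ 0) (htr : t - algebraMap k L r ≠ 0)
    (h : (t ^ q - t) * (x - algebraMap k L r) ^ m = (x ^ q - x) * (t - algebraMap k L r) ^ m) :
    t ∈ K := by
  have h3 := hE.three_le
  have h2 := hE.two_mul
  have hK : algebraMap k L r ∈ K := K.algebraMap_mem r
  obtain ⟨N, rfl⟩ : ∃ N, m = N + 1 := ⟨m - 1, by omega⟩
  have hsub (z : L) : z ^ q - z = (z - algebraMap k L r) * ((z - algebraMap k L r) ^ (2 * N) - 1) := by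
    have : (z - algebraMap k L r) * (z - algebraMap k L r) ^ (2 * N) = (z - algebraMap k L r) ^ q := by
      rw [← pow_succ']
      congr 1
      omega
    rw [mul_sub, this, hE.sub_pow, ← map_pow, hr]
    ring
  rw [hsub, hsub, pow_succ, pow_succ] at h
  have h4 : ((x - algebraMap k L r) ^ (2 * N) - 1 ^ (2 * N)) * ((t - algebraMap k L r) * 1) ^ N =
      ((t - algebraMap k L r) ^ (2 * N) - 1 ^ (2 * N)) * ((x - algebraMap k L r) * 1) ^ N := by
    refine mul_left_cancel₀ (mul_ne_zero hxr htr) ?_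
    rw [mul_one, mul_one, one_pow]
    linear_combination -h
  have hxK := sub_mem hx hK
  obtain ⟨c, hc | hc⟩ := exists_eq_mul_of_fermat_eq (k := k) (by omega) one_ne_zero htr
    one_ne_zero h4
  · refine IntermediateField.mem_of_mul_eq (K := K) (a := algebraMap k L c)
      (b := (x - algebraMap k L r) + algebraMap k L c * algebraMap k L r) (K.algebraMap_mem c)
      (add_mem hxK (mul_mem (K.algebraMap_mem c) hK)) (by linear_combination -hc) fun h0 => ?_
    rwa [h0, zero_mul, add_zero]
  · refine IntermediateField.mem_of_mul_eq (K := K) (a := x - algebraMap k L r)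
      (b := algebraMap k L c + algebraMap k L r * (x - algebraMap k L r)) hxK
      (add_mem (K.algebraMap_mem c) (mul_mem hK hxK)) (by linear_combination hc)
      fun h0 => (hxr h0).elim

theorem mem_of_eq_split (hE : ExponentData p n q m) (hx : x ∈ K) (hr : r ^ q = r) (hr' : r' ^ q = r')
    (hrr : r ≠ r')
    (hxr : x - algebraMap k L r ≠ 0) (hxr' : x - algebraMap k L r' ≠ 0)
    (htr : t - algebraMap k L r ≠ 0) (htr' : t - algebraMap k L r' ≠ 0)
    (h : (t ^ q - t) * ((x - algebraMap k L r) * (x - algebraMap k L r')) ^ m =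
      (x ^ q - x) * ((t - algebraMap k L r) * (t - algebraMap k L r')) ^ m) :
    t ∈ K := by
  have h3 := hE.three_le
  have h2 := hE.two_mul
  obtain ⟨N, rfl⟩ : ∃ N, m = N + 1 := ⟨m - 1, by omega⟩
  refine mem_of_fermat_eq_sub (N := N) (by omega) hx hrr hxr hxr' htr htr' ?_
  have hsub (z : L) : (algebraMap k L r - algebraMap k L r') * (z ^ q - z) =
      (z - algebraMap k L r) * (z - algebraMap k L r') *
        ((z - algebraMap k L r) ^ (2 * N) - (z - algebraMap k L r') ^ (2 * N)) := by
    have e1 (s : k) (hs : s ^ q = s) : (z - algebraMap k L s) * (z - algebraMap k L s) ^ (2 * N) =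
        z ^ q - algebraMap k L s := by
      rw [← pow_succ', show 2 * N + 1 = q by omega, hE.sub_pow, ← map_pow, hs]
    linear_combination -(z - algebraMap k L r') * e1 r hr + (z - algebraMap k L r) * e1 r' hr'
  refine mul_left_cancel₀ (mul_ne_zero (mul_ne_zero hxr hxr') (mul_ne_zero htr htr')) ?_
  rw [pow_succ, pow_succ] at h
  linear_combination -(t - algebraMap k L r) * (t - algebraMap k L r') *
      ((t - algebraMap k L r) * (t - algebraMap k L r')) ^ N * hsub x +
    (x - algebraMap k L r) * (x - algebraMap k L r') *
      ((x - algebraMap k L r) * (x - algebraMap k L r')) ^ N * hsub t -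
    (algebraMap k L r - algebraMap k L r') * h

theorem mem_of_eq_nonsplit (hE : ExponentData p n q m) (hx : x ∈ K) (hr : r ^ q = r')
    (hr' : r' ^ q = r) (hrr : r ≠ r')
    (hxr : x - algebraMap k L r ≠ 0) (hxr' : x - algebraMap k L r' ≠ 0)
    (htr : t - algebraMap k L r ≠ 0) (htr' : t - algebraMap k L r' ≠ 0)
    (h : (t ^ q - t) * ((x - algebraMap k L r) * (x - algebraMap k L r')) ^ m =
      (x ^ q - x) * ((t - algebraMap k L r) * (t - algebraMap k L r')) ^ m) :
    t ∈ K := by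
  have h3 := hE.three_le
  refine mem_of_fermat_eq_sub (N := m) (by omega) hx hrr hxr hxr' htr htr' ?_
  have hsub (z : L) : (algebraMap k L r' - algebraMap k L r) * (z ^ q - z) =
      (z - algebraMap k L r) ^ (2 * m) - (z - algebraMap k L r') ^ (2 * m) := by
    rw [hE.two_mul, pow_succ, pow_succ, hE.sub_pow, hE.sub_pow, ← map_pow, ← map_pow, hr, hr']
    ring
  rw [← hsub, ← hsub]
  linear_combination -(algebraMap k L r' - algebraMap k L r) * h

theorem mem_of_eq_const (hE : ExponentData p n q m) (hx : x ∈ K)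
    (h : t ^ q - t = x ^ q - x) : t ∈ K := by
  obtain ⟨c, hc⟩ := exists_algebraMap_eq_of_pow_eq_self (k := k) hE.one_lt (t := t - x) (by
    rw [hE.sub_pow]
    linear_combination h)
  rw [sub_eq_iff_eq_add.1 hc]
  exact add_mem (K.algebraMap_mem c) hx

theorem mem_of_eq_double (hE : ExponentData p n q m) (hx : x ∈ K) (hr : (r ^ q) ^ q = r)
    (hxr : x - algebraMap k L r ≠ 0) (htr : t - algebraMap k L r ≠ 0)
    (h : (t ^ q - t) * ((x - algebraMap k L r) ^ 2) ^ m =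
      (x ^ q - x) * ((t - algebraMap k L r) ^ 2) ^ m) :
    t ∈ K := by
  have hK : algebraMap k L r ∈ K := K.algebraMap_mem r
  have hpow (z : L) : ((z - algebraMap k L r) ^ 2) ^ m =
      (z - algebraMap k L r) ^ q * (z - algebraMap k L r) := by
    rw [← pow_mul, hE.two_mul, pow_succ]
  set c := algebraMap k L (r ^ q) - algebraMap k L r with hc
  have hsub (z : L) : z ^ q - z = (z - algebraMap k L r) ^ q - (z - algebraMap k L r) + c := by
    rw [hE.sub_pow, ← map_pow, hc]
    ring
  rw [hpow, hpow, hsub t, hsub x] at h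
  suffices hinv : (t - algebraMap k L r)⁻¹ ∈ K by
    have := add_mem (inv_mem hinv) hK
    rwa [inv_inv, sub_add_cancel] at this
  have hX : (x - algebraMap k L r)⁻¹ ∈ K := inv_mem (sub_mem hx hK)
  set T := (t - algebraMap k L r)⁻¹ with hT
  set X := (x - algebraMap k L r)⁻¹ with hX'
  have h1 : T - T ^ q + c * (T ^ q * T) = X - X ^ q + c * (X ^ q * X) := by
    rw [hT, hX', inv_pow, inv_pow]
    have e1 := pow_ne_zero q htr
    have e2 := pow_ne_zero q hxr
    field_simp
    linear_combination h
  by_cases hc0 : c = 0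
  · rw [hc0, zero_mul, zero_mul] at h1
    exact mem_of_eq_const hE hX (by linear_combination -h1)
  · have hcq : c ^ q = -c := by
      rw [hc, hE.sub_pow, ← map_pow, ← map_pow, hr]
      ring
    have hcK : c⁻¹ ∈ K := inv_mem (sub_mem (K.algebraMap_mem _) hK)
    have h2 (z : L) : c * (z - c⁻¹) ^ (q + 1) = z - z ^ q + c * (z ^ q * z) - c⁻¹ := by
      rw [pow_succ, hE.sub_pow, inv_pow, hcq]
      field_simp
      ring
    have h4 : (T - c⁻¹) ^ (q + 1) = (X - c⁻¹) ^ (q + 1) := by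
      refine mul_left_cancel₀ hc0 ?_
      rw [h2, h2, h1]
    by_cases hX0 : X - c⁻¹ = 0
    · rw [hX0, zero_pow (by omega)] at h4
      rw [sub_eq_zero.1 (eq_zero_of_pow_eq_zero h4)]
      exact hcK
    · obtain ⟨s, hs, -⟩ := exists_algebraMap_eq_of_pow_eq_one (k := k) (N := q + 1) (by omega)
        (t := (T - c⁻¹) / (X - c⁻¹)) (by rw [div_pow, h4, div_self (pow_ne_zero _ hX0)])
      rw [div_eq_iff hX0, sub_eq_iff_eq_add] at hs
      rw [hs]
      exact add_mem (mul_mem (K.algebraMap_mem s) (sub_mem hX hcK)) hcK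

end

section
variable {p n q m : ℕ} {k L : Type*} [Field k] [Field L] [Algebra k L] {x t : L} {A B D : k}

theorem cancel_const_pow {μ X T a b : L} (hμ : μ ≠ 0)
    (h : a * (μ * X) ^ m = b * (μ * T) ^ m) : a * X ^ m = b * T ^ m := by
  refine mul_left_cancel₀ (pow_ne_zero m hμ) ?_
  rw [mul_pow, mul_pow] at h
  linear_combination h

theorem mem_of_rational_quadric [IsAlgClosed k] [CharP k p] [CharP L p] [Fact p.Prime]
    {K : IntermediateField k L} (hE : ExponentData p n q m) (hx : x ∈ K) {a b c : k}
    (ha : a ^ q = a) (hb : b ^ q = b) (hc : c ^ q = c)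
    (hxQ : algebraMap k L a * x ^ 2 + algebraMap k L b * x + algebraMap k L c ≠ 0)
    (htQ : algebraMap k L a * t ^ 2 + algebraMap k L b * t + algebraMap k L c ≠ 0)
    (h : (t ^ q - t) * (algebraMap k L a * x ^ 2 + algebraMap k L b * x + algebraMap k L c) ^ m =
      (x ^ q - x) * (algebraMap k L a * t ^ 2 + algebraMap k L b * t + algebraMap k L c) ^ m) :
    t ∈ K := by
  have h2 := hE.two_ne_zero k
  by_cases ha0 : a = 0
  · subst ha0
    by_cases hb0 : b = 0
    · subst hb0
      simp only [map_zero, zero_mul, zero_add] at hxQ h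
      exact mem_of_eq_const hE hx (mul_right_cancel₀ (pow_ne_zero m hxQ) h)
    · have hbL : algebraMap k L b ≠ 0 := by simpa using hb0
      obtain ⟨r, rfl⟩ : ∃ r, c = -(b * r) := ⟨-c / b, by field_simp⟩
      have hr : r ^ q = r := by
        rw [hE.neg_pow, mul_pow, hb] at hc
        refine mul_left_cancel₀ hb0 ?_
        linear_combination -hc
      have key (z : L) : algebraMap k L 0 * z ^ 2 + algebraMap k L b * z + algebraMap k L (-(b * r)) =
          algebraMap k L b * (z - algebraMap k L r) := by
        simp only [map_zero, map_neg, map_mul]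
        ring
      rw [key] at hxQ htQ
      rw [key x, key t] at h
      exact mem_of_eq_split_linear hE hx hr (right_ne_zero_of_mul hxQ) (right_ne_zero_of_mul htQ)
        (cancel_const_pow hbL h)
  · have haL : algebraMap k L a ≠ 0 := by simpa using ha0
    obtain ⟨d, hd⟩ := IsAlgClosed.exists_pow_nat_eq (b ^ 2 - 4 * a * c) (show 0 < 2 by omega)
    have h2a : 2 * a ≠ 0 := mul_ne_zero h2 ha0
    obtain ⟨r, hr⟩ : ∃ r, 2 * a * r = d - b := ⟨(d - b) / (2 * a), mul_div_cancel₀ _ h2a⟩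
    have hroot : a * r ^ 2 + b * r + c = 0 := by
      refine mul_left_cancel₀ (mul_ne_zero h2 h2a) ?_
      linear_combination (2 * a * r + d + b) * hr + hd
    obtain ⟨r', hr'⟩ : ∃ r', a * (r + r') + b = 0 := ⟨-b / a - r, by field_simp; ring⟩
    have key (z : L) : algebraMap k L a * z ^ 2 + algebraMap k L b * z + algebraMap k L c =
        algebraMap k L a * ((z - algebraMap k L r) * (z - algebraMap k L r')) := by
      have e1 := congrArg (algebraMap k L) hroot
      have e2 := congrArg (algebraMap k L) hr'
      simp only [map_add, map_mul, map_pow, map_zero] at e1 e2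
      linear_combination e1 + (z - algebraMap k L r) * e2
    rw [key] at hxQ htQ
    rw [key x, key t] at h
    have h' := cancel_const_pow haL h
    have hx1 := left_ne_zero_of_mul (right_ne_zero_of_mul hxQ)
    have hx2 := right_ne_zero_of_mul (right_ne_zero_of_mul hxQ)
    have ht1 := left_ne_zero_of_mul (right_ne_zero_of_mul htQ)
    have ht2 := right_ne_zero_of_mul (right_ne_zero_of_mul htQ)
    by_cases hrq : r ^ q = r
    · by_cases hrr : r = r'
      · subst hrr
        rw [← pow_two, ← pow_two] at h'
        exact mem_of_eq_double hE hx (by rw [hrq, hrq]) hx1 ht1 h'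
      · have hrq' : r' ^ q = r' := by
          have : r' = -(b / a) - r := by
            field_simp
            linear_combination hr'
          rw [this, hE.sub_pow, hE.neg_pow, div_pow, ha, hb, hrq]
        exact mem_of_eq_split hE hx hrq hrq' hrr hx1 hx2 ht1 ht2 h'
    · obtain ⟨g1, g2⟩ := pow_pow_eq_of_root hE ha hb hc ha0 hroot hrq
      obtain rfl : r' = r ^ q := by
        refine mul_left_cancel₀ ha0 ?_
        linear_combination hr' - g1
      exact mem_of_eq_nonsplit hE hx rfl g2 (Ne.symm hrq) hx1 hx2 ht1 ht2 h'

theorem mem_of_special_quadric [IsAlgClosed k] [CharP k p] [CharP L p] [Fact p.Prime]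
    {K : IntermediateField k L} (hE : ExponentData p n q m) (hx : x ∈ K)
    (hQ : IsSpecialQuadric q A B D)
    (hxQ : algebraMap k L A * x ^ 2 + algebraMap k L B * x + algebraMap k L D ≠ 0)
    (htQ : algebraMap k L A * t ^ 2 + algebraMap k L B * t + algebraMap k L D ≠ 0)
    (h : (t ^ q - t) * (algebraMap k L A * x ^ 2 + algebraMap k L B * x + algebraMap k L D) ^ m =
      (x ^ q - x) * (algebraMap k L A * t ^ 2 + algebraMap k L B * t + algebraMap k L D) ^ m) :
    t ∈ K := by
  rcases hQ with ⟨s, a, b, c, ha, hb, hc, rfl, rfl, rfl⟩ | ⟨s, r, hr, -, rfl, rfl, rfl⟩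
  · have key (z : L) : algebraMap k L (s * a) * z ^ 2 + algebraMap k L (s * b) * z +
        algebraMap k L (s * c) = algebraMap k L s *
          (algebraMap k L a * z ^ 2 + algebraMap k L b * z + algebraMap k L c) := by
      simp only [map_mul]
      ring
    rw [key] at hxQ htQ
    rw [key x, key t] at h
    exact mem_of_rational_quadric hE hx ha hb hc (right_ne_zero_of_mul hxQ)
      (right_ne_zero_of_mul htQ) (cancel_const_pow (left_ne_zero_of_mul hxQ) h)
  · have key (z : L) : algebraMap k L A * z ^ 2 + algebraMap k L (A * (-2 * r)) * z +
        algebraMap k L (A * r ^ 2) = algebraMap k L A * (z - algebraMap k L r) ^ 2 := by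
      simp only [map_mul, map_neg, map_pow, map_ofNat]
      ring
    rw [key] at hxQ htQ
    rw [key x, key t] at h
    refine mem_of_eq_double hE hx (by rwa [← pow_mul, ← pow_two])
      ((pow_ne_zero_iff two_ne_zero).1 (right_ne_zero_of_mul hxQ))
      ((pow_ne_zero_iff two_ne_zero).1 (right_ne_zero_of_mul htQ))
      (cancel_const_pow (left_ne_zero_of_mul hxQ) h)

variable {F : Type*} [Field F] [Algebra k F] {x y u : F}

theorem IsGenPair.derivative_ne [IsAlgClosed k] [CharP k p] [CharP F p]
    (hE : ExponentData p n q m) (h : IsGenPair k q m x y) (hne : ¬ (A = 0 ∧ B = 0 ∧ D = 0)) :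
    (x ^ q - x) * (2 * algebraMap k F A * x + algebraMap k F B) +
      2 * (algebraMap k F A * x ^ 2 + algebraMap k F B * x + algebraMap k F D) ≠ 0 := by
  have h3 := hE.three_le
  have h2 := hE.two_ne_zero k
  have hq := hE.two_mul
  intro h0
  have hR := transcendental_iff.1 h.transcendental
    (C (2 * A) * X ^ (q + 1) + C B * X ^ q + C B * X + C (2 * D)) (by
      simp only [map_add, map_mul, map_pow, aeval_X, aeval_C, map_ofNat]
      linear_combination h0)
  have e1 := congrArg (fun R => R.coeff (q + 1)) hR
  have e2 := congrArg (fun R => R.coeff q) hR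
  have e3 := congrArg (fun R => R.coeff 0) hR
  simp only [coeff_add, coeff_C_mul, coeff_X_pow, coeff_X, coeff_C, coeff_zero] at e1 e2 e3
  simp only [show ¬ (q + 1 = q) by omega, show ¬ (1 = q + 1) by omega, show ¬ (q + 1 = 0) by omega,
    show ¬ (q = q + 1) by omega, show ¬ (1 = q) by omega, show ¬ (q = 0) by omega,
    show ¬ (0 = q + 1) by omega, show ¬ (0 = q) by omega, one_ne_zero, if_true, if_false, mul_one,
    mul_zero, add_zero, zero_add] at e1 e2 e3
  exact hne ⟨(mul_eq_zero.1 e1).resolve_left h2, e2, (mul_eq_zero.1 e3).resolve_left h2⟩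

/-- The projection from a line in the plane `Y = 0` cut out by a special quadric induces a Galois
extension. -/
theorem IsGenPair.isGalois_of_special [IsAlgClosed k] [CharP k p] [Fact p.Prime] [CharP F p]
    (hE : ExponentData p n q m) (h : IsGenPair k q m x y) (hne : ¬ (A = 0 ∧ B = 0 ∧ D = 0))
    (hQ : IsSpecialQuadric q A B D)
    (hu : u = y / (algebraMap k F A * x ^ 2 + algebraMap k F B * x + algebraMap k F D)) :
    IsGalois k⟮u⟯ F := by
  have h3 := hE.three_le
  have hxQ := quadric_ne_zero h hne
  have hm := hE.two_mul_cast F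
  have hum : u ^ m * (algebraMap k F A * x ^ 2 + algebraMap k F B * x + algebraMap k F D) ^ m =
      x ^ q - x := by
    rw [hu, ← mul_pow, div_mul_cancel₀ _ hxQ, h.pow_eq]
  refine isGalois_of_aeval_eq_mul k⟮u⟯ (z := x) (w := u ^ m) ?_
    (pow_mem (mem_adjoin_simple_self k u) m) (X ^ q - X) ((C A * X ^ 2 + C B * X + C D) ^ m) ?_ ?_ ?_
  · rw [← top_le_iff, ← h.adjoin_eq_top k⟮u⟯, adjoin_le_iff]
    have hx : x ∈ (k⟮u⟯)⟮x⟯ := mem_adjoin_simple_self _ x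
    have hk (c : k) : algebraMap k F c ∈ (k⟮u⟯)⟮x⟯ :=
      (k⟮u⟯⟮x⟯).algebraMap_mem ⟨_, k⟮u⟯.algebraMap_mem c⟩
    have hu' : u ∈ (k⟮u⟯)⟮x⟯ := (k⟮u⟯⟮x⟯).algebraMap_mem ⟨u, mem_adjoin_simple_self k u⟩
    rintro z (rfl | rfl)
    · exact hx
    · rw [eq_div_iff hxQ] at hu
      change z ∈ (k⟮u⟯)⟮x⟯
      rw [← hu]
      exact mul_mem hu' (add_mem (add_mem (mul_mem (hk _) (pow_mem hx 2)) (mul_mem (hk _) hx)) (hk _))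
  · simp only [map_add, map_sub, map_mul, map_pow, aeval_X, aeval_C]
    exact hum.symm
  · intro hd
    apply h.derivative_ne hE hne
    obtain ⟨N, rfl⟩ : ∃ N, m = N + 1 := ⟨m - 1, by omega⟩
    have hqF := hE.cast_q F
    simp only [derivative_X, derivative_pow,
      derivative_mul, derivative_C, map_add, map_sub, map_mul, map_pow, aeval_X, aeval_C, map_one,
      map_natCast, hqF, zero_mul, mul_one, zero_add, add_zero, zero_sub, Nat.add_sub_cancel,
      Nat.cast_ofNat, map_ofNat] at hd
    rw [← hum]
    rw [pow_succ _ N]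
    linear_combination -2 * (algebraMap k F A * x ^ 2 + algebraMap k F B * x + algebraMap k F D) * hd -
      (algebraMap k F A * x ^ 2 + algebraMap k F B * x + algebraMap k F D) ^ (N + 1) * u ^ (N + 1) *
        (2 * algebraMap k F A * x + algebraMap k F B) * hm
  · intro t ht
    let Ω := AlgebraicClosure F
    have hΩ : CharP Ω p := charP_of_injective_algebraMap (algebraMap F Ω).injective p
    have hkΩ (c : k) : algebraMap F Ω (algebraMap k F c) = algebraMap k Ω c :=
      (IsScalarTower.algebraMap_apply k F Ω c).symm
    simp only [map_add, map_sub, map_mul, map_pow, aeval_X, aeval_C] at ht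
    let K : IntermediateField k Ω := (IsScalarTower.toAlgHom k F Ω).fieldRange
    suffices hK : t ∈ K from hK
    by_cases htQ : algebraMap k Ω A * t ^ 2 + algebraMap k Ω B * t + algebraMap k Ω D = 0
    · rw [htQ, zero_pow (by omega), mul_zero] at ht
      obtain ⟨c, rfl⟩ := exists_algebraMap_eq_of_pow_eq_self (k := k) hE.one_lt (sub_eq_zero.1 ht)
      exact K.algebraMap_mem c
    · have hxQ' := (map_ne_zero_iff (algebraMap F Ω) (algebraMap F Ω).injective).2 hxQ
      have hum' := congrArg (algebraMap F Ω) hum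
      simp only [map_add, map_sub, map_mul, map_pow, hkΩ] at hxQ' hum'
      refine mem_of_special_quadric (K := K) (x := algebraMap F Ω x) hE ⟨x, rfl⟩ hQ hxQ' htQ ?_
      rw [ht, ← hum']
      ring

end

section
variable {p n q m : ℕ} {k F : Type*} [Field k] [Field F] [Algebra k F] {x y u : F}

theorem linearIndependent_of_span_pair_eq {V : Type*} [AddCommGroup V] [Module k V]
    {v₀ v₁ w₀ w₁ : V} (hv : LinearIndependent k ![v₀, v₁])
    (h : Submodule.span k {w₀, w₁} = Submodule.span k {v₀, v₁}) :
    LinearIndependent k ![w₀, w₁] := by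
  rw [linearIndependent_iff_card_eq_finrank_span, Set.finrank] at hv ⊢
  rwa [Matrix.range_cons, Matrix.range_cons, Matrix.range_empty, Set.union_empty,
    Set.singleton_union, h, ← Set.singleton_union, ← Set.union_empty {v₁},
    ← Matrix.range_empty ![], ← Matrix.range_cons, ← Matrix.range_cons]

theorem cross_product_ne_zero {a₀ c₀ d₀ a₁ c₁ d₁ : k}
    (h : LinearIndependent k ![![a₀, 0, c₀, d₀], ![a₁, 0, c₁, d₁]]) :
    ¬ (c₀ * d₁ - d₀ * c₁ = 0 ∧ d₀ * a₁ - a₀ * d₁ = 0 ∧ a₀ * c₁ - c₀ * a₁ = 0) := by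
  rintro ⟨h1, h2, h3⟩
  rw [LinearIndependent.pair_iff] at h
  have key (s t : k) (e0 : s * a₀ + t * a₁ = 0) (e2 : s * c₀ + t * c₁ = 0)
      (e3 : s * d₀ + t * d₁ = 0) : s = 0 ∧ t = 0 := by
    refine h s t ?_
    ext i
    fin_cases i <;> simp [e0, e2, e3]
  obtain ⟨-, hc⟩ := key c₁ (-c₀) (by linear_combination h3) (by ring) (by linear_combination -h1)
  obtain ⟨-, hd⟩ := key d₁ (-d₀) (by linear_combination -h2) (by linear_combination h1) (by ring)
  obtain ⟨-, ha⟩ := key a₁ (-a₀) (by ring) (by linear_combination -h3) (by linear_combination h2)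
  rw [neg_eq_zero] at ha hc hd
  exact one_ne_zero (key 1 0 (by simp [ha]) (by simp [hc]) (by simp [hd])).1

theorem mem_span_pair_apply_eq_zero {ι : Type*} {w₀ w₁ v : ι → k} {i : ι} (h₀ : w₀ i = 0)
    (h₁ : w₁ i = 0) (hv : v ∈ Submodule.span k {w₀, w₁}) : v i = 0 := by
  obtain ⟨s, t, rfl⟩ := Submodule.mem_span_pair.1 hv
  simp [h₀, h₁]

/-- Lines through `(0 : 1 : 0 : 0)`. -/
theorem IsGenPair.isGalois_iff_of_mem_line [IsAlgClosed k] [CharP k p] [Fact p.Prime] [CharP F p]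
    (hE : ExponentData p n q m) (h : IsGenPair k q m x y) {a₀ c₀ d₀ a₁ c₁ d₁ : k}
    (hlin : LinearIndependent k ![![a₀, 0, c₀, d₀], ![a₁, 0, c₁, d₁]])
    (hu : u = formEval x y ![a₀, 0, c₀, d₀] / formEval x y ![a₁, 0, c₁, d₁]) :
    IsGalois k⟮u⟯ F ↔
      (∃ a c d : k, (a, c, d) ≠ (0, 0, 0) ∧ a ^ 2 = c * d ∧
          a₀ * a + c₀ * c + d₀ * d = 0 ∧ a₁ * a + c₁ * c + d₁ * d = 0) ∨
      ¬ (∃ a c d : k, (a, c, d) ≠ (0, 0, 0) ∧ a ^ 2 = c * d ∧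
          a₀ * a + c₀ * c + d₀ * d = 0 ∧ a₁ * a + c₁ * c + d₁ * d = 0) ∧
        IsRationalSpan q (Submodule.span k {![a₀, 0, c₀, d₀], ![a₁, 0, c₁, d₁]}) := by
  have hform (a c d : k) : formEval x y ![a, 0, c, d] =
      algebraMap k F a * x + algebraMap k F c + algebraMap k F d * x ^ 2 := by
    simp [formEval_apply]
  have hN := cross_product_ne_zero hlin
  have hu' := hu
  rw [hform, hform] at hu'
  by_cases hI : ∃ a c d : k, (a, c, d) ≠ (0, 0, 0) ∧ a ^ 2 = c * d ∧
      a₀ * a + c₀ * c + d₀ * d = 0 ∧ a₁ * a + c₁ * c + d₁ * d = 0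
  · simp only [hI, true_or, iff_true]
    obtain ⟨a, c, d, hne, hacd, h₀, h₁⟩ := hI
    rw [h.adjoin_eq_of_common_root hN hne hacd h₀ h₁ hu']
    exact h.isGalois_adjoin_simple hE
  simp only [hI, false_or, not_false_eq_true, true_and]
  constructor
  · refine h.isRationalSpan_of_isGalois hE (fun hcd => hI ⟨_, _, _, ?_, hcd, by ring, by ring⟩) hu'
    simpa only [ne_eq, Prod.mk.injEq] using hN
  · rintro ⟨w₀, w₁, hw₀, hw₁, hspan⟩
    have hlin' := linearIndependent_of_span_pair_eq hlin hspan
    have hz {w : Fin 4 → k} (hw : w ∈ Submodule.span k {w₀, w₁}) :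
        w = ![w 0, 0, w 2, w 3] := by
      rw [hspan] at hw
      have := mem_span_pair_apply_eq_zero (i := 1) rfl rfl hw
      ext i
      fin_cases i <;> simp [this]
    have e₀ := hz (Submodule.subset_span (Set.mem_insert _ _))
    have e₁ := hz (Submodule.subset_span (Set.mem_insert_of_mem _ rfl))
    have hN' := hlin'
    rw [e₀, e₁] at hN'
    replace hN' := cross_product_ne_zero hN'
    have hv₁ : ![a₁, 0, c₁, d₁] ≠ 0 := hlin.ne_zero 1
    have hw₁0 : w₁ ≠ 0 := hlin'.ne_zero 1
    rw [hu, ← adjoin_div_eq_of_span_eq (h.formEval_injective hE) hv₁ hw₁0 hspan]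
    refine h.isGalois_of_rational_pencil hE (hw₀ 0) (hw₀ 2) (hw₀ 3) (hw₁ 0) (hw₁ 2) (hw₁ 3)
      (fun hcd => hI ⟨_, _, _, by simpa only [ne_eq, Prod.mk.injEq] using hN', hcd, ?_, ?_⟩)
      (by rw [← hform, ← hform, ← e₀, ← e₁])
    · have hmem : ![a₀, 0, c₀, d₀] ∈ Submodule.span k {w₀, w₁} :=
        hspan ▸ Submodule.subset_span (Set.mem_insert _ _)
      obtain ⟨s, t, hst⟩ := Submodule.mem_span_pair.1 hmem
      have g0 : s * w₀ 0 + t * w₁ 0 = a₀ := congrFun hst 0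
      have g2 : s * w₀ 2 + t * w₁ 2 = c₀ := congrFun hst 2
      have g3 : s * w₀ 3 + t * w₁ 3 = d₀ := congrFun hst 3
      rw [← g0, ← g2, ← g3]
      ring
    · have hmem : ![a₁, 0, c₁, d₁] ∈ Submodule.span k {w₀, w₁} :=
        hspan ▸ Submodule.subset_span (Set.mem_insert_of_mem _ rfl)
      obtain ⟨s, t, hst⟩ := Submodule.mem_span_pair.1 hmem
      have g0 : s * w₀ 0 + t * w₁ 0 = a₁ := congrFun hst 0
      have g2 : s * w₀ 2 + t * w₁ 2 = c₁ := congrFun hst 2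
      have g3 : s * w₀ 3 + t * w₁ 3 = d₁ := congrFun hst 3
      rw [← g0, ← g2, ← g3]
      ring

theorem exists_span_pair_eq_of_apply_ne_zero {ι : Type*} {v₀ v₁ : ι → k} {i : ι}
    (h : ¬ (v₀ i = 0 ∧ v₁ i = 0)) : ∃ w₀ w₁ : ι → k, w₀ i = 1 ∧ w₁ i = 0 ∧
      Submodule.span k {w₀, w₁} = Submodule.span k {v₀, v₁} := by
  by_cases h1 : v₁ i = 0
  · have h0 : v₀ i ≠ 0 := fun h0 => h ⟨h0, h1⟩
    refine ⟨(v₀ i)⁻¹ • v₀, v₁, by simp [h0], h1,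
      span_pair_combination_eq (α := (v₀ i)⁻¹) (β := 0) (γ := 0) (δ := 1) (by simp) (by simp) ?_⟩
    simpa using h0
  · refine ⟨(v₁ i)⁻¹ • v₁, v₁ i • v₀ - v₀ i • v₁, by simp [h1], by simp [mul_comm],
      span_pair_combination_eq (α := 0) (β := (v₁ i)⁻¹) (γ := v₁ i) (δ := - v₀ i) (by simp)
        (by module) ?_⟩
    simp [h1]

/-- Lines in the plane `Y = 0`. -/
theorem IsGenPair.isGalois_of_span_eq [IsAlgClosed k] [CharP k p] [Fact p.Prime] [CharP F p]
    (hE : ExponentData p n q m) (h : IsGenPair k q m x y) {v₀ v₁ : Fin 4 → k}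
    (hlin : LinearIndependent k ![v₀, v₁]) (hu : u = formEval x y v₀ / formEval x y v₁)
    {A B D : k} (hQ : IsSpecialQuadric q A B D)
    (hspan : Submodule.span k {v₀, v₁} = Submodule.span k {![0, 1, 0, 0], ![B, 0, D, A]}) :
    IsGalois k⟮u⟯ F := by
  have hw₁ : ![B, 0, D, A] ≠ 0 := (linearIndependent_of_span_pair_eq hlin hspan.symm).ne_zero 1
  have hv₁ : v₁ ≠ 0 := hlin.ne_zero 1
  rw [hu, ← adjoin_div_eq_of_span_eq (h.formEval_injective hE) hv₁ hw₁ hspan.symm]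
  refine h.isGalois_of_special hE ?_ hQ ?_
  · rintro ⟨rfl, rfl, rfl⟩
    exact hw₁ (by ext i; fin_cases i <;> rfl)
  · simp [formEval_apply]
    ring

/-- Galois lines not passing through `(0 : 1 : 0 : 0)` lie in the plane `Y = 0`. -/
theorem IsGenPair.exists_special_of_isGalois [IsAlgClosed k] [CharP k p] [Fact p.Prime] [CharP F p]
    (hE : ExponentData p n q m) (h : IsGenPair k q m x y) {v₀ v₁ : Fin 4 → k}
    (hlin : LinearIndependent k ![v₀, v₁]) (hv : ¬ (v₀ 1 = 0 ∧ v₁ 1 = 0))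
    (hu : u = formEval x y v₀ / formEval x y v₁) (hG : IsGalois k⟮u⟯ F) :
    ∃ A B D : k, IsSpecialQuadric q A B D ∧
      Submodule.span k {v₀, v₁} = Submodule.span k {![0, 1, 0, 0], ![B, 0, D, A]} := by
  obtain ⟨w₀, w₁, h0, h1, hspan⟩ := exists_span_pair_eq_of_apply_ne_zero hv
  have hv₁ : v₁ ≠ 0 := hlin.ne_zero 1
  have hw₁ : w₁ ≠ 0 := (linearIndependent_of_span_pair_eq hlin hspan).ne_zero 1
  rw [hu, ← adjoin_div_eq_of_span_eq (h.formEval_injective hE) hv₁ hw₁ hspan] at hG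
  have e₁ : w₁ = ![w₁ 0, 0, w₁ 2, w₁ 3] := by
    ext i
    fin_cases i <;> simp [h1]
  obtain ⟨⟨s, hA, hB, hD⟩, hQ⟩ := h.special_of_isGalois hE (A₀ := w₀ 3) (B₀ := w₀ 0) (C₀ := w₀ 2)
    (A₁ := w₁ 3) (B₁ := w₁ 0) (C₁ := w₁ 2) (by
      rintro ⟨h3, h0, h2⟩
      apply hw₁
      rw [e₁, h3, h0, h2]
      ext i
      fin_cases i <;> rfl) (by
      rw [formEval_apply, formEval_apply, h0, h1, map_one, map_zero]
      congr 1 <;> ring) hG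
  refine ⟨_, _, _, hQ, ?_⟩
  rw [← hspan, ← e₁]
  refine span_pair_combination_eq (α := 1) (β := s) (γ := 0) (δ := 1) ?_ (by simp) (by simp)
  ext i
  fin_cases i <;> simp [h0, h1, hA, hB, hD]

/-- The two kinds of lines in the plane `Y = 0` cut out by special quadrics. -/
theorem exists_special_iff [CharP k p] [Fact p.Prime] (hE : ExponentData p n q m) {v₀ v₁ : Fin 4 → k}
    (hlin : LinearIndependent k ![v₀, v₁]) :
    (∃ A B D : k, IsSpecialQuadric q A B D ∧
      Submodule.span k {v₀, v₁} = Submodule.span k {![0, 1, 0, 0], ![B, 0, D, A]}) ↔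
    (![0, 1, 0, 0] ∈ Submodule.span k {v₀, v₁} ∧ IsRationalSpan q (Submodule.span k {v₀, v₁})) ∨
      ∃ α : k, α ^ q ^ 2 = α ∧ α ^ q ≠ α ∧
        Submodule.span k {v₀, v₁} = Submodule.span k {![0, 1, 0, 0], ![-2 * α, 0, α ^ 2, 1]} := by
  have hq := hE.one_lt
  constructor
  · rintro ⟨A, B, D, hQ, hspan⟩
    have hw₁ : ![B, 0, D, A] ≠ 0 := (linearIndependent_of_span_pair_eq hlin hspan.symm).ne_zero 1
    rcases hQ with ⟨s, a, b, c, ha, hb, hc, rfl, rfl, rfl⟩ | ⟨s, α, hα, hα', rfl, rfl, rfl⟩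
    · have hs : s ≠ 0 := by
        rintro rfl
        exact hw₁ (by ext i; fin_cases i <;> simp)
      refine Or.inl ⟨hspan ▸ Submodule.subset_span (Set.mem_insert _ _), ![0, 1, 0, 0],
        ![b, 0, c, a], ?_, ?_, ?_⟩
      · intro i
        fin_cases i <;> simp <;> omega
      · intro i
        fin_cases i <;> simp [ha, hb, hc]
        omega
      · rw [hspan]
        refine span_pair_combination_eq (α := 1) (β := 0) (γ := 0) (δ := s⁻¹) (by simp) ?_
          (by simpa using hs)
        ext i
        fin_cases i <;> simp [hs]
    · have hs : A ≠ 0 := by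
        rintro rfl
        exact hw₁ (by ext i; fin_cases i <;> simp)
      refine Or.inr ⟨α, hα, hα', ?_⟩
      rw [hspan]
      refine span_pair_combination_eq (α := 1) (β := 0) (γ := 0) (δ := A) (by simp) ?_
        (by simpa using hs)
      ext i
      fin_cases i <;> simp
  · rintro (⟨hY, w₀, w₁, hw₀, hw₁, hspan⟩ | ⟨α, hα, hα', hspan⟩)
    · rw [← hspan] at hY ⊢
      obtain ⟨s, t, hst⟩ := Submodule.mem_span_pair.1 hY
      have g1 : s * w₀ 1 + t * w₁ 1 = 1 := congrFun hst 1
      have hr (i : Fin 4) : (w₁ 1 * w₀ i - w₀ 1 * w₁ i) ^ q = w₁ 1 * w₀ i - w₀ 1 * w₁ i := by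
        rw [hE.sub_pow, mul_pow, mul_pow, hw₀, hw₁, hw₀, hw₁]
      refine ⟨_, _, _, Or.inl ⟨1, _, _, _, hr 3, hr 0, hr 2, rfl, rfl, rfl⟩, ?_⟩
      refine (span_pair_combination_eq (α := s) (β := t) (γ := w₁ 1) (δ := - w₀ 1) hst.symm ?_
        ?_).symm
      · ext i
        fin_cases i <;> simp <;> ring
      · intro h0
        exact one_ne_zero (α := k) (by linear_combination -h0 - g1)
    · refine ⟨_, _, _, Or.inr ⟨1, α, hα, hα', rfl, rfl, rfl⟩, ?_⟩
      simpa using hspan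

end

/-- **classification of Galois lines.** Let `L₀ = a₀X + b₀Y + c₀Z + d₀W`
and `L₁ = a₁X + b₁Y + c₁Z + d₁W` be two linearly independent linear forms over `k`, and
set `u = (a₀x + b₀y + c₀ + d₀x²)/(a₁x + b₁y + c₁ + d₁x²) ∈ F`, corresponding to the
projection of `φ(X) ⊂ ℙ³`, `φ = (x : y : 1 : x²)`, from the line `ℓ = {L₀ = L₁ = 0}`.
Then `F/k⟮u⟯` is Galois if and only if one of the four cases (I)–(IV) holds:
(I) `ℓ` passes through `(0:1:0:0)` and meets the conic `Y = X² - ZW = 0`;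
(II) `ℓ` is an `𝔽_q`-line through `(0:1:0:0)` missing the conic;
(III) `ℓ` is an `𝔽_q`-line in the plane `Y = 0`;
(IV) `ℓ` is the tangent line of the conic at an `𝔽_{q²}`-point not defined over `𝔽_q`. -/
theorem stmt_19
    (k : Type*) [Field k] [IsAlgClosed k]
    (p : ℕ) [Fact p.Prime] (hp2 : p ≠ 2) [CharP k p]
    (n q : ℕ) (hq : q = p ^ n) (hq5 : 5 ≤ q)
    (F : Type*) [Field F] [Algebra k F]
    (x y : F) (hx : Transcendental k x)
    (hxy : y ^ ((q + 1) / 2) = x ^ q - x)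
    (hgen : adjoin k {x, y} = ⊤)
    (a₀ b₀ c₀ d₀ a₁ b₁ c₁ d₁ : k)
    (hindep : LinearIndependent k ![![a₀, b₀, c₀, d₀], ![a₁, b₁, c₁, d₁]])
    (u : F)
    (hu : u = (algebraMap k F a₀ * x + algebraMap k F b₀ * y + algebraMap k F c₀
          + algebraMap k F d₀ * x ^ 2)
        / (algebraMap k F a₁ * x + algebraMap k F b₁ * y + algebraMap k F c₁
          + algebraMap k F d₁ * x ^ 2)) :
    IsGalois k⟮u⟯ F ↔
      -- (I) ℓ ∋ (0:1:0:0) and ℓ meets the conic Y = X² - ZW = 0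
      (b₀ = 0 ∧ b₁ = 0 ∧ ∃ a c d : k, (a, c, d) ≠ (0, 0, 0) ∧ a ^ 2 = c * d ∧
          a₀ * a + c₀ * c + d₀ * d = 0 ∧ a₁ * a + c₁ * c + d₁ * d = 0) ∨
      -- (II) ℓ is an 𝔽_q-line through (0:1:0:0) missing the conic
      (b₀ = 0 ∧ b₁ = 0 ∧
        ¬ (∃ a c d : k, (a, c, d) ≠ (0, 0, 0) ∧ a ^ 2 = c * d ∧
            a₀ * a + c₀ * c + d₀ * d = 0 ∧ a₁ * a + c₁ * c + d₁ * d = 0) ∧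
        (∃ w₀ w₁ : Fin 4 → k, (∀ i, w₀ i ^ q = w₀ i) ∧ (∀ i, w₁ i ^ q = w₁ i) ∧
          Submodule.span k {w₀, w₁}
            = Submodule.span k {![a₀, b₀, c₀, d₀], ![a₁, b₁, c₁, d₁]})) ∨
      -- (III) ℓ is an 𝔽_q-line contained in the plane Y = 0
      ((![0, 1, 0, 0] : Fin 4 → k)
          ∈ Submodule.span k {![a₀, b₀, c₀, d₀], ![a₁, b₁, c₁, d₁]} ∧
        (∃ w₀ w₁ : Fin 4 → k, (∀ i, w₀ i ^ q = w₀ i) ∧ (∀ i, w₁ i ^ q = w₁ i) ∧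
          Submodule.span k {w₀, w₁}
            = Submodule.span k {![a₀, b₀, c₀, d₀], ![a₁, b₁, c₁, d₁]})) ∨
      -- (IV) ℓ is the tangent line of the conic at an 𝔽_{q²}-point not over 𝔽_q
      (∃ α : k, α ^ q ^ 2 = α ∧ α ^ q ≠ α ∧
        Submodule.span k ({![a₀, b₀, c₀, d₀], ![a₁, b₁, c₁, d₁]} : Set (Fin 4 → k))
          = Submodule.span k {![0, 1, 0, 0], ![-2 * α, 0, α ^ 2, 1]}) := by
  obtain ⟨m, hm⟩ : ∃ m, 2 * m = q + 1 := by
    have hodd : Odd q := hq ▸ ((Fact.out : p.Prime).odd_of_ne_two hp2).pow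
    obtain ⟨r, rfl⟩ := hodd
    exact ⟨r + 1, by ring⟩
  have hE : ExponentData p n q m := ⟨hq, hm, by omega⟩
  rw [← hm, Nat.mul_div_cancel_left m two_pos] at hxy
  have h : IsGenPair k q m x y := ⟨hx, hxy, hgen⟩
  have hF : CharP F p := charP_of_injective_algebraMap (algebraMap k F).injective p
  replace hu : u = formEval x y ![a₀, b₀, c₀, d₀] / formEval x y ![a₁, b₁, c₁, d₁] := by
    rw [hu]
    simp [formEval_apply]
  by_cases hb : b₀ = 0 ∧ b₁ = 0
  · obtain ⟨rfl, rfl⟩ := hb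
    have hY : (![0, 1, 0, 0] : Fin 4 → k) ∉
        Submodule.span k {![a₀, 0, c₀, d₀], ![a₁, 0, c₁, d₁]} := fun hY =>
      one_ne_zero (α := k) (mem_span_pair_apply_eq_zero (i := 1) rfl rfl hY)
    rw [h.isGalois_iff_of_mem_line hE hindep hu]
    simp only [hY, false_and, false_or, true_and, IsRationalSpan]
    refine or_congr_right (or_iff_left ?_).symm
    rintro ⟨α, -, -, hspan⟩
    exact hY (hspan ▸ Submodule.subset_span (Set.mem_insert _ _))
  · have hI (P : Prop) : ¬ (b₀ = 0 ∧ b₁ = 0 ∧ P) := fun hP => hb ⟨hP.1, hP.2.1⟩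
    simp only [hI, false_or]
    exact Iff.trans ⟨h.exists_special_of_isGalois hE hindep hb hu,
      fun ⟨_, _, _, hQ, hspan⟩ => h.isGalois_of_span_eq hE hindep hu hQ hspan⟩
      (exists_special_iff hE hindep)
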